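/- Let Ω₁ and Ω₂ be bounded domains in ℂⁿ (n ≥ 2) with C^k (k ≥ 3)-smooth boundaries. If ∂Ω₁ and ∂Ω₂ are CR-equivalent (i.e., there exists a CR-diffeomorphism f : ∂Ω₁ → ∂Ω₂), then S(Ω₁) = S(Ω₂). -/

import Mathlib

open Complex
open scoped ComplexOrder

noncomputable section

/-- Points of ℂⁿ. -/
abbrev Pt (n : ℕ) := Fin n → ℂ

/-- Wirtinger derivative ∂f/∂z_j at z (junk value if f is not differentiable). -/
def dZ (n : ℕ) (f : Pt n → ℂ) (j : Fin n) (z : Pt n) : ℂ :=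
  (1 / 2 : ℂ) * (fderiv ℝ f z (Pi.single j 1) - Complex.I * fderiv ℝ f z (Pi.single j Complex.I))

/-- Wirtinger derivative ∂f/∂z̄_j at z. -/
def dZb (n : ℕ) (f : Pt n → ℂ) (j : Fin n) (z : Pt n) : ℂ :=
  (1 / 2 : ℂ) * (fderiv ℝ f z (Pi.single j 1) + Complex.I * fderiv ℝ f z (Pi.single j Complex.I))

/-- Complexification of a real-valued function. -/
def cR (n : ℕ) (ρ : Pt n → ℝ) : Pt n → ℂ := fun z => (ρ z : ℂ)

/-- Levi form of ρ at z: Levi_ρ(X,Y) = Σ_{j,k} ∂²ρ/∂z_j∂z̄_k X_j conj(Y_k), where X, Y are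
(1,0)-vectors given by their coefficient tuples. -/
def levi (n : ℕ) (ρ : Pt n → ℝ) (z : Pt n) (X Y : Fin n → ℂ) : ℂ :=
  ∑ j, ∑ k, dZ n (fun w => dZb n (cR n ρ) k w) j z * X j * (starRingEnd ℂ) (Y k)

/-- Holomorphic tangent space T^{1,0}_p(∂Ω) (for boundary points p), described via a defining
function: (1,0)-vectors X with Σ_j X_j ∂ρ/∂z_j(p) = 0. -/
def T10 (n : ℕ) (ρ : Pt n → ℝ) (p : Pt n) : Set (Fin n → ℂ) :=
  {X | ∑ j, X j * dZ n (cR n ρ) j p = 0}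

/-- Null space of the Levi form inside T^{1,0}_p(∂Ω). -/
def nullSp (n : ℕ) (ρ : Pt n → ℝ) (p : Pt n) : Set (Fin n → ℂ) :=
  {X | X ∈ T10 n ρ p ∧ ∀ Y ∈ T10 n ρ p, levi n ρ p X Y = 0}

/-- ρ is a C^s defining function of Ω on the neighborhood V of the closure of Ω. -/
def IsDefining (n : ℕ) (s : ℕ∞) (Ω : Set (Pt n)) (ρ : Pt n → ℝ) (V : Set (Pt n)) : Prop :=
  IsOpen V ∧ closure Ω ⊆ V ∧ ContDiffOn ℝ s ρ V ∧
    Ω = {z | z ∈ V ∧ ρ z < 0} ∧ ∀ z ∈ frontier Ω, fderiv ℝ ρ z ≠ 0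

/-- Strict plurisubharmonicity on a set, via positivity of the Levi form. -/
def StrictPSHOn (n : ℕ) (f : Pt n → ℝ) (s : Set (Pt n)) : Prop :=
  ∀ z ∈ s, ∀ X : Fin n → ℂ, X ≠ 0 → 0 < (levi n f z X X).re

/-- Diederich–Fornaess exponent of a defining function ρ (0 if the defining set is empty). -/
def DFexp (n : ℕ) (ρ : Pt n → ℝ) (Ω : Set (Pt n)) : ℝ :=
  sSup {η : ℝ | 0 < η ∧ η < 1 ∧ StrictPSHOn n (fun z => -((-ρ z) ^ η)) Ω}

/-- Diederich–Fornaess index of Ω: supremum over all (C¹) defining functions. -/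
def DFindex (n : ℕ) (Ω : Set (Pt n)) : ℝ :=
  sSup {e : ℝ | ∃ ρ V, IsDefining n 1 Ω ρ V ∧ e = DFexp n ρ Ω}

/-- Steinness exponent of a defining function ρ (⊤ = ∞ if the defining set is empty). -/
def Sexp (n : ℕ) (ρ : Pt n → ℝ) (Ω : Set (Pt n)) : EReal :=
  sInf {e : EReal | ∃ η : ℝ, 1 < η ∧
    (∃ U : Set (Pt n), IsOpen U ∧ frontier Ω ⊆ U ∧
      StrictPSHOn n (fun z => ρ z ^ η) ((closure Ω)ᶜ ∩ U)) ∧ e = (η : EReal)}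

/-- Steinness index of Ω: infimum over all (C¹) defining functions. -/
def Sindex (n : ℕ) (Ω : Set (Pt n)) : EReal :=
  sInf {e : EReal | ∃ ρ V, IsDefining n 1 Ω ρ V ∧ e = Sexp n ρ Ω}

/-- A complex vector field Σ_j a_j ∂/∂z_j + Σ_j b_j ∂/∂z̄_j on ℂⁿ, recorded by its
coefficient functions. -/
structure VF (n : ℕ) where
  a : Pt n → Fin n → ℂ
  b : Pt n → Fin n → ℂ

/-- Action of a complex vector field on a function. -/
def VF.app {n : ℕ} (V : VF n) (f : Pt n → ℂ) (z : Pt n) : ℂ :=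
  ∑ j, V.a z j * dZ n f j z + ∑ j, V.b z j * dZb n f j z

/-- The value of a vector field at a point, as a pair ((1,0)-part, (0,1)-part). -/
def VF.atPt {n : ℕ} (V : VF n) (p : Pt n) : (Fin n → ℂ) × (Fin n → ℂ) := (V.a p, V.b p)

/-- A complex 1-form Σ_j w_j dz_j + Σ_j t_j dz̄_j on ℂⁿ. -/
structure Form1 (n : ℕ) where
  w : Pt n → Fin n → ℂ
  t : Pt n → Fin n → ℂ

/-- Value of a 1-form at a point on a complex tangent vector (pair of (1,0) and (0,1) parts). -/
def Form1.eval {n : ℕ} (η : Form1 n) (z : Pt n) (X : (Fin n → ℂ) × (Fin n → ℂ)) : ℂ :=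
  ∑ j, η.w z j * X.1 j + ∑ j, η.t z j * X.2 j

/-- Pairing of a 1-form with a vector field. -/
def Form1.app {n : ℕ} (η : Form1 n) (V : VF n) (z : Pt n) : ℂ :=
  η.eval z (V.atPt z)

/-- Lie bracket of complex vector fields. -/
def VF.bracket {n : ℕ} (V W : VF n) : VF n :=
  ⟨fun z j => V.app (fun w => W.a w j) z - W.app (fun w => V.a w j) z,
   fun z j => V.app (fun w => W.b w j) z - W.app (fun w => V.b w j) z⟩

/-- Levi-Civita covariant derivative ∇_V W of the Euclidean metric (componentwise derivative). -/
def covD {n : ℕ} (V W : VF n) : VF n :=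
  ⟨fun z j => V.app (fun w => W.a w j) z, fun z j => V.app (fun w => W.b w j) z⟩

/-- Lie derivative of a 1-form along a vector field, in coordinates. -/
def lieD {n : ℕ} (T : VF n) (η : Form1 n) : Form1 n :=
  ⟨fun z j => T.app (fun w => η.w w j) z + ∑ m, η.w z m * dZ n (fun w => T.a w m) j z
      + ∑ m, η.t z m * dZ n (fun w => T.b w m) j z,
   fun z j => T.app (fun w => η.t w j) z + ∑ m, η.w z m * dZb n (fun w => T.a w m) j z
      + ∑ m, η.t z m * dZb n (fun w => T.b w m) j z⟩

/-- Negation of a 1-form. -/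
def Form1.neg {n : ℕ} (η : Form1 n) : Form1 n := ⟨fun z j => -η.w z j, fun z j => -η.t z j⟩

/-- Σ_j |∂ρ/∂z_j|². -/
def gradSq (n : ℕ) (ρ : Pt n → ℝ) (z : Pt n) : ℝ :=
  ∑ j, Complex.normSq (dZ n (cR n ρ) j z)

/-- Norm of the real gradient of ρ: ‖∇ρ‖ = 2 (Σ_j |∂ρ/∂z_j|²)^{1/2}. -/
def gradNorm (n : ℕ) (ρ : Pt n → ℝ) (z : Pt n) : ℝ := 2 * Real.sqrt (gradSq n ρ z)

/-- The (1,0) field L_n = (Σ|∂ρ/∂z_j|²)⁻¹ Σ_j (∂ρ/∂z̄_j) ∂/∂z_j. -/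
def LnVF (n : ℕ) (ρ : Pt n → ℝ) : VF n :=
  ⟨fun z j => dZb n (cR n ρ) j z / (gradSq n ρ z : ℂ), fun _ _ => 0⟩

/-- The (1,0) field N = (Σ|∂ρ/∂z_j|²)^{-1/2} Σ_j (∂ρ/∂z̄_j) ∂/∂z_j. -/
def NVF (n : ℕ) (ρ : Pt n → ℝ) : VF n :=
  ⟨fun z j => dZb n (cR n ρ) j z / ((Real.sqrt (gradSq n ρ z) : ℝ) : ℂ), fun _ _ => 0⟩

/-- T = L_n − conj(L_n). -/
def TVF (n : ℕ) (ρ : Pt n → ℝ) : VF n :=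
  ⟨fun z j => (LnVF n ρ).a z j, fun z j => -(starRingEnd ℂ) ((LnVF n ρ).a z j)⟩

/-- η = (1/2)(∂ρ − ∂̄ρ). -/
def etaF (n : ℕ) (ρ : Pt n → ℝ) : Form1 n :=
  ⟨fun z j => (1 / 2 : ℂ) * dZ n (cR n ρ) j z,
   fun z j => -(1 / 2 : ℂ) * dZb n (cR n ρ) j z⟩

/-- The D'Angelo 1-form α_ρ = −Lie_T η of a defining function ρ. -/
def dAngelo (n : ℕ) (ρ : Pt n → ℝ) : Form1 n := Form1.neg (lieD (TVF n ρ) (etaF n ρ))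

/-- Evaluation of the (1,0)-part ∂η of the exterior derivative of a 1-form on two
complex tangent vectors. -/
def delEval {n : ℕ} (η : Form1 n) (X Y : (Fin n → ℂ) × (Fin n → ℂ)) (z : Pt n) : ℂ :=
  (∑ m, ∑ l, dZ n (fun w => η.w w l) m z * (X.1 m * Y.1 l - Y.1 m * X.1 l)) +
  (∑ m, ∑ l, dZ n (fun w => η.t w l) m z * (X.1 m * Y.2 l - Y.1 m * X.2 l))

/-- Evaluation of ∂̄η of a 1-form η on two complex tangent vectors. -/
def delbEval {n : ℕ} (η : Form1 n) (X Y : (Fin n → ℂ) × (Fin n → ℂ)) (z : Pt n) : ℂ :=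
  (∑ m, ∑ l, dZb n (fun w => η.w w l) m z * (X.2 m * Y.1 l - Y.2 m * X.1 l)) +
  (∑ m, ∑ l, dZb n (fun w => η.t w l) m z * (X.2 m * Y.2 l - Y.2 m * X.2 l))

/-- Evaluation of dη = ∂η + ∂̄η. -/
def dEval {n : ℕ} (η : Form1 n) (X Y : (Fin n → ℂ) × (Fin n → ℂ)) (z : Pt n) : ℂ :=
  delEval η X Y z + delbEval η X Y z

/-- Evaluation of d^c η = i(∂̄ − ∂)η. -/
def dcEval {n : ℕ} (η : Form1 n) (X Y : (Fin n → ℂ) × (Fin n → ℂ)) (z : Pt n) : ℂ :=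
  Complex.I * (delbEval η X Y z - delEval η X Y z)

/-- Evaluation of ω ∧ ω̄ on two complex tangent vectors, where ω = π_{1,0} η is the
(1,0)-component of the real 1-form η. -/
def omegaWedge {n : ℕ} (η : Form1 n) (X Y : (Fin n → ℂ) × (Fin n → ℂ)) (z : Pt n) : ℂ :=
  (∑ j, η.w z j * X.1 j) * (∑ j, (starRingEnd ℂ) (η.w z j) * Y.2 j) -
  (∑ j, η.w z j * Y.1 j) * (∑ j, (starRingEnd ℂ) (η.w z j) * X.2 j)

/-- Evaluation of ∂̄ω where ω = π_{1,0} η. -/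
def delbOmega {n : ℕ} (η : Form1 n) (X Y : (Fin n → ℂ) × (Fin n → ℂ)) (z : Pt n) : ℂ :=
  delbEval ⟨η.w, fun _ _ => 0⟩ X Y z

/-- The standard Euclidean complex Hermitian metric g on complexified tangent vectors
(so that g(∂/∂z_j, ∂/∂z_j) = 1/2). -/
def gMet {n : ℕ} (X Y : (Fin n → ℂ) × (Fin n → ℂ)) : ℂ :=
  (1 / 2 : ℂ) * (∑ j, X.1 j * (starRingEnd ℂ) (Y.1 j) + ∑ j, X.2 j * (starRingEnd ℂ) (Y.2 j))

/-- The real gradient ∇ρ as a complex vector field: 2Σ_j (∂ρ/∂z̄_j ∂/∂z_j + ∂ρ/∂z_j ∂/∂z̄_j). -/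
def gradVF (n : ℕ) (ρ : Pt n → ℝ) : VF n :=
  ⟨fun z j => 2 * dZb n (cR n ρ) j z, fun z j => 2 * dZ n (cR n ρ) j z⟩

/-- Pseudoconvexity of Ω (w.r.t. the defining function ρ): the Levi form is positive
semidefinite on the holomorphic tangent spaces of the boundary. -/
def LeviPseudoconvex (n : ℕ) (ρ : Pt n → ℝ) (Ω : Set (Pt n)) : Prop :=
  ∀ p ∈ frontier Ω, ∀ X ∈ T10 n ρ p, 0 ≤ (levi n ρ p X X).re

/-- The set Σ of weakly pseudoconvex boundary points. -/
def weakPts (n : ℕ) (ρ : Pt n → ℝ) (Ω : Set (Pt n)) : Set (Pt n) :=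
  {p | p ∈ frontier Ω ∧ ∃ X ∈ T10 n ρ p, X ≠ 0 ∧ levi n ρ p X X = 0}

/-- Action of a complex tangent vector at p on a function. -/
def vecApp (n : ℕ) (X : (Fin n → ℂ) × (Fin n → ℂ)) (f : Pt n → ℂ) (p : Pt n) : ℂ :=
  ∑ j, X.1 j * dZ n f j p + ∑ j, X.2 j * dZb n f j p

/-- Pushforward (complexified differential) of a complex tangent vector at p by a map f. -/
def push (n : ℕ) (f : Pt n → Pt n) (p : Pt n) (X : (Fin n → ℂ) × (Fin n → ℂ)) :
    (Fin n → ℂ) × (Fin n → ℂ) :=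
  (fun l => vecApp n X (fun w => f w l) p,
   fun l => vecApp n X (fun w => (starRingEnd ℂ) (f w l)) p)

/-- Conjugation of a coefficient tuple. -/
def conjVec {n : ℕ} (X : Fin n → ℂ) : Fin n → ℂ := fun j => (starRingEnd ℂ) (X j)

/-- A C^k CR-diffeomorphism between ∂Ω₁ and ∂Ω₂, presented by a C^k map f on a
neighborhood U₁ of ∂Ω₁ together with a C^k local inverse g: f maps ∂Ω₁ onto ∂Ω₂
diffeomorphically and its differential maps T^{1,0}(∂Ω₁) into T^{1,0}(∂Ω₂). -/
def IsCRDiffeo (n : ℕ) (k : ℕ∞) (Ω₁ Ω₂ : Set (Pt n)) (ρ₁ ρ₂ : Pt n → ℝ)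
    (f g : Pt n → Pt n) (U₁ U₂ : Set (Pt n)) : Prop :=
  IsOpen U₁ ∧ IsOpen U₂ ∧ frontier Ω₁ ⊆ U₁ ∧ frontier Ω₂ ⊆ U₂ ∧
  (∀ l, ContDiffOn ℝ k (fun z => f z l) U₁) ∧
  (∀ l, ContDiffOn ℝ k (fun z => g z l) U₂) ∧
  f '' frontier Ω₁ = frontier Ω₂ ∧
  (∀ p ∈ frontier Ω₁, g (f p) = p) ∧ (∀ q ∈ frontier Ω₂, f (g q) = q) ∧
  (∀ p ∈ frontier Ω₁, ∀ L ∈ T10 n ρ₁ p,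
    (push n f p (L, 0)).2 = 0 ∧ (push n f p (L, 0)).1 ∈ T10 n ρ₂ (f p))

/-- The 1-form d^c ψ = i(∂̄ψ − ∂ψ) of a real function ψ. -/
def dcForm (n : ℕ) (ψ : Pt n → ℝ) : Form1 n :=
  ⟨fun z j => -Complex.I * dZ n (cR n ψ) j z, fun z j => Complex.I * dZb n (cR n ψ) j z⟩

end

namespace SteinnessIndex

open Filter Topology Set Metric

section TwiceDifferentiable

variable {E F G : Type*} [NormedAddCommGroup E] [NormedSpace ℝ E]
  [NormedAddCommGroup F] [NormedSpace ℝ F] [NormedAddCommGroup G] [NormedSpace ℝ G]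

/-- Twice differentiability at a point. -/
def C2At (u : E → F) (z : E) : Prop :=
  (∀ᶠ w in 𝓝 z, DifferentiableAt ℝ u w) ∧ DifferentiableAt ℝ (fderiv ℝ u) z

/-- The diagonal second derivative. -/
noncomputable def hess (u : E → F) (z X : E) : F := fderiv ℝ (fderiv ℝ u) z X X

theorem C2At.differentiableAt {u : E → F} {z : E} (h : C2At u z) : DifferentiableAt ℝ u z :=
  h.1.self_of_nhds

theorem C2At.congr {u v : E → F} {z : E} (h : C2At u z) (e : v =ᶠ[𝓝 z] u) : C2At v z := by
  refine ⟨?_, ?_⟩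
  · filter_upwards [h.1, e.eventuallyEq_nhds] with w hw hw'
    exact hw.congr_of_eventuallyEq hw'
  · exact h.2.congr_of_eventuallyEq e.fderiv

theorem hess_congr {u v : E → F} {z : E} (e : v =ᶠ[𝓝 z] u) : hess v z = hess u z := by
  funext X
  simp only [hess]
  rw [e.fderiv.fderiv_eq]

theorem _root_.ContDiffAt.c2At {u : E → F} {z : E} (h : ContDiffAt ℝ 2 u z) : C2At u z := by
  refine ⟨?_, ?_⟩
  · filter_upwards [h.eventually (by simp)] with w hw
    exact hw.differentiableAt (by simp)
  · exact (h.fderiv_right (m := 1) (by norm_num)).differentiableAt (by simp)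

theorem C2At.add {u v : E → F} {z : E} (hu : C2At u z) (hv : C2At v z) :
    C2At (fun w => u w + v w) z := by
  have e : fderiv ℝ (fun w => u w + v w) =ᶠ[𝓝 z] fun w => fderiv ℝ u w + fderiv ℝ v w := by
    filter_upwards [hu.1, hv.1] with w h1 h2
    exact fderiv_fun_add h1 h2
  refine ⟨?_, (hu.2.add hv.2).congr_of_eventuallyEq e⟩
  filter_upwards [hu.1, hv.1] with w h1 h2
  exact h1.add h2

theorem hess_add {u v : E → F} {z : E} (hu : C2At u z) (hv : C2At v z) (X : E) :
    hess (fun w => u w + v w) z X = hess u z X + hess v z X := by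
  have e : fderiv ℝ (fun w => u w + v w) =ᶠ[𝓝 z] fun w => fderiv ℝ u w + fderiv ℝ v w := by
    filter_upwards [hu.1, hv.1] with w h1 h2
    exact fderiv_fun_add h1 h2
  simp only [hess]
  rw [e.fderiv_eq, fderiv_fun_add hu.2 hv.2]
  simp

theorem C2At.const_smul {u : E → F} {z : E} (hu : C2At u z) (c : ℝ) :
    C2At (fun w => c • u w) z := by
  have e : fderiv ℝ (fun w => c • u w) =ᶠ[𝓝 z] fun w => c • fderiv ℝ u w := by
    filter_upwards [hu.1] with w h1
    exact fderiv_fun_const_smul h1 c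
  refine ⟨?_, (hu.2.const_smul c).congr_of_eventuallyEq e⟩
  filter_upwards [hu.1] with w h1
  exact h1.const_smul c

theorem hess_const_smul {u : E → F} {z : E} (hu : C2At u z) (c : ℝ) (X : E) :
    hess (fun w => c • u w) z X = c • hess u z X := by
  have e : fderiv ℝ (fun w => c • u w) =ᶠ[𝓝 z] fun w => c • fderiv ℝ u w := by
    filter_upwards [hu.1] with w h1
    exact fderiv_fun_const_smul h1 c
  simp only [hess]
  rw [e.fderiv_eq, fderiv_fun_const_smul hu.2]
  simp

theorem C2At.fderiv_comp {v : F → G} {P : E → F} {z : E} (hv : C2At v (P z)) (hP : C2At P z) :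
    fderiv ℝ (fun w => v (P w)) =ᶠ[𝓝 z] fun w => (fderiv ℝ v (P w)).comp (fderiv ℝ P w) := by
  filter_upwards [hP.1, hP.differentiableAt.continuousAt.eventually hv.1] with w h1 h2
  exact fderiv_fun_comp w h2 h1

theorem C2At.comp {v : F → G} {P : E → F} {z : E} (hv : C2At v (P z)) (hP : C2At P z) :
    C2At (fun w => v (P w)) z := by
  refine ⟨?_, ?_⟩
  · filter_upwards [hP.1, hP.differentiableAt.continuousAt.eventually hv.1] with w h1 h2
    exact h2.fun_comp' w h1
  · refine DifferentiableAt.congr_of_eventuallyEq ?_ (hv.fderiv_comp hP)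
    exact (hv.2.fun_comp' z hP.differentiableAt).clm_comp hP.2

theorem hess_comp {v : F → G} {P : E → F} {z : E} (hv : C2At v (P z)) (hP : C2At P z) (X : E) :
    hess (fun w => v (P w)) z X =
      hess v (P z) (fderiv ℝ P z X) + fderiv ℝ v (P z) (hess P z X) := by
  simp only [hess]
  rw [(hv.fderiv_comp hP).fderiv_eq,
    fderiv_clm_comp (hv.2.fun_comp' z hP.differentiableAt) hP.2,
    fderiv_fun_comp z hv.2 hP.differentiableAt]
  simp [add_comm]

theorem hess_real (φ : ℝ → ℝ) (s a : ℝ) (h : DifferentiableAt ℝ (fderiv ℝ φ) s) :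
    hess φ s a = deriv (deriv φ) s * a ^ 2 := by
  have : deriv φ = fun t => fderiv ℝ φ t 1 := by ext t; rfl
  simp only [hess]
  rw [this]
  have h2 : deriv (fun t => fderiv ℝ φ t 1) s = fderiv ℝ (fderiv ℝ φ) s 1 1 := by
    rw [← fderiv_apply_one_eq_deriv]
    rw [fderiv_clm_apply h (differentiableAt_const _)]
    simp
  rw [h2]
  have : a = a • (1 : ℝ) := by simp
  rw [this, map_smul, map_smul]
  simp
  ring

theorem hess_comp_real {φ : ℝ → ℝ} {u : E → ℝ} {z : E} (hφ : C2At φ (u z)) (hu : C2At u z)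
    (X : E) : hess (fun w => φ (u w)) z X =
      deriv φ (u z) * hess u z X + deriv (deriv φ) (u z) * (fderiv ℝ u z X) ^ 2 := by
  rw [hess_comp hφ hu, hess_real _ _ _ hφ.2, add_comm]
  congr 1
  rw [fderiv_eq_smul_deriv, smul_eq_mul, mul_comm]

theorem c2At_of_hasDerivAt {φ φ' : ℝ → ℝ} {c s : ℝ} (h1 : ∀ᶠ t in 𝓝 s, HasDerivAt φ (φ' t) t)
    (h2 : HasDerivAt φ' c s) : C2At φ s ∧ deriv φ s = φ' s ∧ deriv (deriv φ) s = c := by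
  have e : deriv φ =ᶠ[𝓝 s] φ' := by
    filter_upwards [h1] with t ht using ht.deriv
  refine ⟨⟨?_, ?_⟩, h1.self_of_nhds.deriv, ?_⟩
  · filter_upwards [h1] with t ht using ht.differentiableAt
  · have e2 : fderiv ℝ φ =ᶠ[𝓝 s] fun t => ContinuousLinearMap.toSpanSingleton ℝ (φ' t) := by
      filter_upwards [h1] with t ht using ht.hasFDerivAt.fderiv
    refine DifferentiableAt.congr_of_eventuallyEq ?_ e2
    exact (ContinuousLinearMap.toSpanSingletonCLE (𝕜 := ℝ) (E := ℝ)).differentiableAt.fun_comp' s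
      h2.differentiableAt
  · rw [e.deriv_eq]; exact h2.deriv

variable (J : E →L[ℝ] E)

/-- The Laplacian of `u` along the complex line spanned by `X`, up to scaling. -/
noncomputable def lap (u : E → ℝ) (z X : E) : ℝ := hess u z X + hess u z (J X)

theorem lap_congr {u v : E → ℝ} {z : E} (e : v =ᶠ[𝓝 z] u) (X : E) : lap J v z X = lap J u z X := by
  simp only [lap, hess_congr e]

theorem lap_add {u v : E → ℝ} {z : E} (hu : C2At u z) (hv : C2At v z) (X : E) :
    lap J (fun w => u w + v w) z X = lap J u z X + lap J v z X := by
  simp only [lap, hess_add hu hv]; ring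

theorem lap_const_mul {u : E → ℝ} {z : E} (hu : C2At u z) (c : ℝ) (X : E) :
    lap J (fun w => c * u w) z X = c * lap J u z X := by
  simp only [lap]
  have := fun X => hess_const_smul hu c X
  simp only [smul_eq_mul] at this
  rw [this, this]; ring

theorem lap_comp_real {φ : ℝ → ℝ} {u : E → ℝ} {z : E} (hφ : C2At φ (u z)) (hu : C2At u z)
    (X : E) : lap J (fun w => φ (u w)) z X = deriv φ (u z) * lap J u z X
      + deriv (deriv φ) (u z) * ((fderiv ℝ u z X) ^ 2 + (fderiv ℝ u z (J X)) ^ 2) := by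
  simp only [lap, hess_comp_real hφ hu]; ring

end TwiceDifferentiable

section PowerExp

variable {E : Type*} [NormedAddCommGroup E] [NormedSpace ℝ E] (J : E →L[ℝ] E)

theorem c2At_log {s : ℝ} (hs : 0 < s) :
    C2At Real.log s ∧ deriv Real.log s = s⁻¹ ∧ deriv (deriv Real.log) s = -(s ^ 2)⁻¹ := by
  refine c2At_of_hasDerivAt (φ' := fun t => t⁻¹) ?_ (hasDerivAt_inv hs.ne')
  filter_upwards [lt_mem_nhds hs] with t ht using Real.hasDerivAt_log (ne_of_gt ht)

theorem c2At_exp (s : ℝ) :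
    C2At Real.exp s ∧ deriv Real.exp s = Real.exp s ∧ deriv (deriv Real.exp) s = Real.exp s :=
  c2At_of_hasDerivAt (Eventually.of_forall Real.hasDerivAt_exp) (Real.hasDerivAt_exp s)

/-- The Levi form of `v ^ σ * exp b` dominates that of `b` up to a gradient term. -/
theorem lap_exp_log_ge {v b : E → ℝ} {z : E} (hv : C2At v z) (hb : C2At b z) (hv0 : 0 < v z)
    {σ : ℝ} (hσ : 1 < σ) (X : E) (hl : 0 ≤ lap J v z X) :
    C2At (fun w => Real.exp (σ * Real.log (v w) + b w)) z ∧
    Real.exp (σ * Real.log (v z) + b z) *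
      (lap J b z X - ((fderiv ℝ b z X) ^ 2 + (fderiv ℝ b z (J X)) ^ 2) / (σ - 1)) ≤
      lap J (fun w => Real.exp (σ * Real.log (v w) + b w)) z X := by
  obtain ⟨L1, L2, L3⟩ := c2At_log hv0
  have hlog : C2At (fun w => Real.log (v w)) z := L1.comp hv
  have hslog : C2At (fun w => σ * Real.log (v w)) z := hlog.const_smul σ
  have hm : C2At (fun w => σ * Real.log (v w) + b w) z := hslog.add hb
  obtain ⟨E1, E2, E3⟩ := c2At_exp (σ * Real.log (v z) + b z)
  refine ⟨C2At.comp (P := fun w => σ * Real.log (v w) + b w) E1 hm, ?_⟩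
  rw [lap_comp_real J E1 hm, lap_add J hslog hb, lap_const_mul J hlog, lap_comp_real J L1 hv,
    E2, E3, L2, L3, ← mul_add]
  refine mul_le_mul_of_nonneg_left ?_ (Real.exp_pos _).le
  have hd : ∀ Y, fderiv ℝ (fun w => σ * Real.log (v w) + b w) z Y =
      σ * ((v z)⁻¹ * fderiv ℝ v z Y) + fderiv ℝ b z Y := by
    intro Y
    rw [fderiv_fun_add hslog.differentiableAt hb.differentiableAt,
      fderiv_const_mul hlog.differentiableAt, fderiv.log hv.differentiableAt hv0.ne']
    simp
  rw [hd, hd]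
  set s := (v z)⁻¹ with hsdef
  have hs : 0 < s := inv_pos.2 hv0
  have hinv : ((v z) ^ 2)⁻¹ = s ^ 2 := by rw [hsdef, inv_pow]
  rw [hinv]
  set p := fderiv ℝ v z X
  set p' := fderiv ℝ v z (J X)
  set β := fderiv ℝ b z X
  set β' := fderiv ℝ b z (J X)
  have hs1 : 0 < σ - 1 := by linarith
  have key : ∀ a β : ℝ, -(β ^ 2) / (σ - 1) ≤ (σ ^ 2 - σ) * a ^ 2 + 2 * σ * a * β + β ^ 2 := by
    intro a β
    rw [div_le_iff₀ hs1]
    nlinarith [mul_nonneg (by linarith : (0:ℝ) ≤ σ) (sq_nonneg ((σ - 1) * a + β))]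
  have k1 := key (s * p) β
  have k2 := key (s * p') β'
  have k3 : 0 ≤ σ * (s * lap J v z X) := by positivity
  have : (β ^ 2 + β' ^ 2) / (σ - 1) = -(-(β ^ 2) / (σ - 1)) - (-(β' ^ 2) / (σ - 1)) := by ring
  rw [this]
  nlinarith

end PowerExp

section SoftMax

theorem hasDerivAt_posPart_pow (k : ℕ) (x : ℝ) :
    HasDerivAt (fun x : ℝ => max x 0 ^ (k + 2)) ((k + 2) * max x 0 ^ (k + 1)) x := by
  rcases lt_trichotomy x 0 with h | h | h
  · have : (fun x : ℝ => max x 0 ^ (k + 2)) =ᶠ[𝓝 x] fun _ => 0 := by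
      filter_upwards [gt_mem_nhds h] with y hy
      rw [max_eq_right hy.le]; simp
    rw [max_eq_right h.le]
    simpa using (hasDerivAt_const x (0:ℝ)).congr_of_eventuallyEq this
  · subst h
    have : HasDerivAt (fun x : ℝ => max x 0 ^ (k + 2)) 0 0 := by
      rw [hasDerivAt_iff_isLittleO]
      simp only [max_self, sub_zero, smul_zero]
      rw [zero_pow (by omega)]
      simp only [sub_zero]
      have h1 : (fun x : ℝ => max x 0 ^ (k + 2)) =O[𝓝 0] fun x : ℝ => x ^ (k + 2) := by
        refine Asymptotics.IsBigO.of_bound 1 (Eventually.of_forall fun y => ?_)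
        rw [norm_pow, norm_pow, one_mul]
        refine pow_le_pow_left₀ (norm_nonneg _) ?_ _
        rw [Real.norm_eq_abs, Real.norm_eq_abs, abs_of_nonneg (le_max_right _ _)]
        exact max_le (le_abs_self _) (abs_nonneg _)
      refine h1.trans_isLittleO ?_
      have := Asymptotics.isLittleO_pow_pow (𝕜 := ℝ) (m := 1) (n := k + 2) (by omega)
      simpa using this
    simpa using this
  · have : (fun x : ℝ => max x 0 ^ (k + 2)) =ᶠ[𝓝 x] fun x => x ^ (k + 2) := by
      filter_upwards [lt_mem_nhds h] with y hy
      rw [max_eq_left hy.le]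
    rw [max_eq_left h.le]
    have h2 := (hasDerivAt_pow (k + 2) x).congr_of_eventuallyEq this
    simpa using h2

/-- A convex `C²` function equal to `max x 0` off `[-1, 1]`. -/
noncomputable def softPos (x : ℝ) : ℝ :=
  (max (x + 1) 0 ^ 3 + max (x - 1) 0 ^ 3) / 4 - (max (x + 1) 0 ^ 4 - max (x - 1) 0 ^ 4) / 16

/-- The derivative of `softPos`. -/
noncomputable def softPos' (x : ℝ) : ℝ :=
  3 * (max (x + 1) 0 ^ 2 + max (x - 1) 0 ^ 2) / 4 - (max (x + 1) 0 ^ 3 - max (x - 1) 0 ^ 3) / 4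

/-- The second derivative of `softPos`. -/
noncomputable def softPos'' (x : ℝ) : ℝ :=
  3 * (max (x + 1) 0 + max (x - 1) 0) / 2 - 3 * (max (x + 1) 0 ^ 2 - max (x - 1) 0 ^ 2) / 4

theorem hasDerivAt_posPart_pow_add (k : ℕ) (x a : ℝ) :
    HasDerivAt (fun x : ℝ => max (x + a) 0 ^ (k + 2)) ((k + 2) * max (x + a) 0 ^ (k + 1)) x := by
  have := (hasDerivAt_posPart_pow k (x + a)).comp_add_const x a
  simpa using this

theorem hasDerivAt_softPos (x : ℝ) : HasDerivAt softPos (softPos' x) x := by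
  have h1 := hasDerivAt_posPart_pow_add 1 x 1
  have h2 := hasDerivAt_posPart_pow_add 1 x (-1)
  have h3 := hasDerivAt_posPart_pow_add 2 x 1
  have h4 := hasDerivAt_posPart_pow_add 2 x (-1)
  have := ((h1.add h2).div_const 4).sub ((h3.sub h4).div_const 16)
  refine this.congr_deriv ?_
  simp only [softPos', ← sub_eq_add_neg]; push_cast; ring

theorem hasDerivAt_softPos' (x : ℝ) : HasDerivAt softPos' (softPos'' x) x := by
  have h1 := hasDerivAt_posPart_pow_add 0 x 1
  have h2 := hasDerivAt_posPart_pow_add 0 x (-1)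
  have h3 := hasDerivAt_posPart_pow_add 1 x 1
  have h4 := hasDerivAt_posPart_pow_add 1 x (-1)
  have := (((h1.add h2).const_mul 3).div_const 4).sub ((h3.sub h4).div_const 4)
  refine this.congr_deriv ?_
  simp only [softPos'', ← sub_eq_add_neg]; push_cast; ring

theorem softPos_cases (x : ℝ) :
    (x ≤ -1 ∧ softPos x = 0 ∧ softPos' x = 0 ∧ softPos'' x = 0) ∨
    (1 ≤ x ∧ softPos x = x ∧ softPos' x = 1 ∧ softPos'' x = 0) ∨
    (-1 ≤ x ∧ x ≤ 1 ∧ softPos x = (x + 1) ^ 3 / 4 - (x + 1) ^ 4 / 16 ∧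
      softPos' x = (x + 1) ^ 2 * (2 - x) / 4 ∧ softPos'' x = 3 * (1 - x ^ 2) / 4) := by
  rcases le_total x (-1) with h | h
  · left
    have a : max (x + 1) 0 = 0 := max_eq_right (by linarith)
    have b : max (x - 1) 0 = 0 := max_eq_right (by linarith)
    simp [softPos, softPos', softPos'', a, b, h]
  · right
    have a : max (x + 1) 0 = x + 1 := max_eq_left (by linarith)
    rcases le_total 1 x with h' | h'
    · left
      have b : max (x - 1) 0 = x - 1 := max_eq_left (by linarith)
      refine ⟨h', ?_, ?_, ?_⟩ <;> simp only [softPos, softPos', softPos'', a, b] <;> ring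
    · right
      have b : max (x - 1) 0 = 0 := max_eq_right (by linarith)
      refine ⟨h, h', ?_, ?_, ?_⟩ <;> simp only [softPos, softPos', softPos'', a, b] <;> ring

theorem softPos_ge (x : ℝ) : max x 0 ≤ softPos x := by
  rcases softPos_cases x with ⟨h, e, -⟩ | ⟨h, e, -⟩ | ⟨h1, h2, e, -⟩
  · rw [e, max_eq_right (by linarith)]
  · rw [e, max_eq_left (by linarith)]
  · rw [e]
    have h3 : 0 ≤ x + 1 := by linarith
    have h4 : 0 ≤ 1 - x := by linarith
    refine max_le ?_ ?_
    · nlinarith [pow_nonneg h4 3, mul_nonneg (pow_nonneg h4 3) h3,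
        mul_nonneg (pow_nonneg h4 3) (by linarith : 0 ≤ 3 + x)]
    · nlinarith [pow_nonneg h3 3, mul_nonneg (pow_nonneg h3 3) h4]

theorem softPos_le (x : ℝ) : softPos x ≤ max x 0 + 1 := by
  rcases softPos_cases x with ⟨h, e, -⟩ | ⟨h, e, -⟩ | ⟨h1, h2, e, -⟩
  · rw [e]; linarith [le_max_right x 0]
  · rw [e]; linarith [le_max_left x 0]
  · rw [e]
    have h3 : 0 ≤ x + 1 := by linarith
    have h4 : 0 ≤ 1 - x := by linarith
    rcases le_total x 0 with h5 | h5
    · rw [max_eq_right h5]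
      have : (x + 1) ^ 3 ≤ 1 := pow_le_one₀ h3 (by linarith)
      nlinarith [pow_nonneg h3 4]
    · rw [max_eq_left h5]
      nlinarith [pow_le_one₀ h4 (by linarith) (n := 3), mul_nonneg (pow_nonneg h4 3) h3]

theorem softPos'_mem (x : ℝ) : 0 ≤ softPos' x ∧ softPos' x ≤ 1 := by
  rcases softPos_cases x with ⟨h, -, e, -⟩ | ⟨h, -, e, -⟩ | ⟨h1, h2, -, e, -⟩
  · rw [e]; norm_num
  · rw [e]; norm_num
  · rw [e]
    have h3 : 0 ≤ x + 1 := by linarith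
    have h4 : 0 ≤ 1 - x := by linarith
    constructor
    · have : 0 ≤ 2 - x := by linarith
      positivity
    · nlinarith [mul_nonneg (sq_nonneg (1 - x)) (by linarith : 0 ≤ x + 2)]

theorem softPos''_nonneg (x : ℝ) : 0 ≤ softPos'' x := by
  rcases softPos_cases x with ⟨h, -, -, e⟩ | ⟨h, -, -, e⟩ | ⟨h1, h2, -, -, e⟩
  · rw [e]
  · rw [e]
  · rw [e]; nlinarith

/-- A regularized maximum, equal to the maximum when the arguments differ by at least `ε`. -/
noncomputable def smax (ε s t : ℝ) : ℝ := s + ε * softPos ((t - s) / ε)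

theorem smax_ge {ε : ℝ} (hε : 0 < ε) (s t : ℝ) : max s t ≤ smax ε s t := by
  have h := mul_le_mul_of_nonneg_left (softPos_ge ((t - s) / ε)) hε.le
  rw [mul_max_of_nonneg _ _ hε.le, mul_div_cancel₀ _ hε.ne', mul_zero] at h
  simp only [smax]
  have h1 := (le_max_left _ _).trans h
  have h2 := (le_max_right _ _).trans h
  exact max_le (by linarith) (by linarith)

theorem smax_le {ε : ℝ} (hε : 0 < ε) (s t : ℝ) : smax ε s t ≤ max s t + ε := by
  have h := mul_le_mul_of_nonneg_left (softPos_le ((t - s) / ε)) hε.le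
  rw [mul_add, mul_max_of_nonneg _ _ hε.le, mul_div_cancel₀ _ hε.ne', mul_zero] at h
  simp only [smax]
  have : s + max (t - s) 0 = max s t := by
    rcases le_total s t with h | h
    · rw [max_eq_left (by linarith), max_eq_right h]; ring
    · rw [max_eq_right (by linarith), max_eq_left h]; ring
  linarith

theorem smax_eq_left {ε s t : ℝ} (hε : 0 < ε) (h : t + ε ≤ s) : smax ε s t = s := by
  have : (t - s) / ε ≤ -1 := by rw [div_le_iff₀ hε]; linarith
  rcases softPos_cases ((t - s) / ε) with ⟨h, e, -⟩ | ⟨h, e, -⟩ | ⟨h1, h2, e, -⟩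
  · simp [smax, e]
  · linarith
  · have h3 : (t - s) / ε = -1 := le_antisymm this h1
    rw [h3] at e
    simp [smax, h3, e]

variable {E : Type*} [NormedAddCommGroup E] [NormedSpace ℝ E] (J : E →L[ℝ] E)

theorem C2At.smax {u v : E → ℝ} {z : E} (hu : C2At u z) (hv : C2At v z) {ε : ℝ} (hε : 0 < ε) :
    C2At (fun w => smax ε (u w) (v w)) z ∧
    ∃ θ : ℝ, 0 ≤ θ ∧ θ ≤ 1 ∧
      fderiv ℝ (fun w => SteinnessIndex.smax ε (u w) (v w)) z =
        (1 - θ) • fderiv ℝ u z + θ • fderiv ℝ v z ∧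
      ∀ X, (1 - θ) * lap J u z X + θ * lap J v z X ≤
        lap J (fun w => SteinnessIndex.smax ε (u w) (v w)) z X := by
  have hd : C2At (fun w => (v w - u w) / ε) z := by
    have := (hv.add (hu.const_smul (-1))).const_smul ε⁻¹
    refine this.congr (Eventually.of_forall fun w => ?_)
    simp only [smul_eq_mul]; ring
  obtain ⟨S1, S2, S3⟩ := c2At_of_hasDerivAt (s := (v z - u z) / ε)
    (Eventually.of_forall hasDerivAt_softPos) (hasDerivAt_softPos' _)
  have hS : C2At (fun w => softPos ((v w - u w) / ε)) z :=
    C2At.comp (P := fun w => (v w - u w) / ε) S1 hd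
  have hεS : C2At (fun w => ε * softPos ((v w - u w) / ε)) z := hS.const_smul ε
  obtain ⟨t0, t1⟩ := softPos'_mem ((v z - u z) / ε)
  have hlapd : ∀ X, lap J (fun w => (v w - u w) / ε) z X = ε⁻¹ * (lap J v z X - lap J u z X) := by
    intro X
    have e : (fun w => (v w - u w) / ε) = fun w => ε⁻¹ * (v w + (-1) * u w) := by
      ext w; ring
    have h2 : C2At (fun w => (-1 : ℝ) * u w) z := hu.const_smul (-1)
    rw [e, lap_const_mul J (hv.add h2), lap_add J hv h2, lap_const_mul J hu]
    ring
  refine ⟨hu.add hεS, _, t0, t1, ?_, ?_⟩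
  · have h1 : HasFDerivAt (fun w => (v w - u w) / ε)
        (ε⁻¹ • (fderiv ℝ v z - fderiv ℝ u z)) z := by
      have := (hv.differentiableAt.hasFDerivAt.sub hu.differentiableAt.hasFDerivAt).const_mul ε⁻¹
      refine this.congr_of_eventuallyEq (Eventually.of_forall fun w => ?_)
      simp only [Pi.sub_apply]; ring
    have h2 := ((hasDerivAt_softPos ((v z - u z) / ε)).comp_hasFDerivAt z h1).const_mul ε
    have h3 := (hu.differentiableAt.hasFDerivAt.add h2).fderiv
    refine Eq.trans h3 ?_
    rw [smul_smul, smul_smul]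
    have : ε * softPos' ((v z - u z) / ε) * ε⁻¹ = softPos' ((v z - u z) / ε) := by
      field_simp
    rw [this, smul_sub, sub_smul, one_smul]
    abel
  · intro X
    have := lap_add J hu hεS X
    refine le_of_le_of_eq ?_ this.symm
    rw [lap_const_mul J hS, lap_comp_real J S1 hd, hlapd, S2, S3]
    have h4 := mul_nonneg hε.le (mul_nonneg (softPos''_nonneg ((v z - u z) / ε))
      (add_nonneg (sq_nonneg (fderiv ℝ (fun w => (v w - u w) / ε) z X))
      (sq_nonneg (fderiv ℝ (fun w => (v w - u w) / ε) z (J X)))))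
    have h5 : ε * (softPos' ((v z - u z) / ε) * (ε⁻¹ * (lap J v z X - lap J u z X))) =
      softPos' ((v z - u z) / ε) * (lap J v z X - lap J u z X) := by
      field_simp
    rw [mul_add, h5]
    nlinarith

end SoftMax

section Bridge

variable {n : ℕ}

/-- Multiplication by the imaginary unit, as a real linear map. -/
noncomputable def mulI (n : ℕ) : Pt n →L[ℝ] Pt n :=
  (Complex.I • ContinuousLinearMap.id ℂ (Pt n)).restrictScalars ℝ

theorem mulI_apply (x : Pt n) (j : Fin n) : mulI n x j = Complex.I * x j := by
  simp [mulI]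

theorem mulI_mulI (x : Pt n) : mulI n (mulI n x) = -x := by
  ext j
  rw [mulI_apply, mulI_apply, ← mul_assoc, I_mul_I]
  simp

theorem pt_eq_sum (X : Pt n) :
    X = ∑ j, ((X j).re • (Pi.single j 1 : Pt n) + (X j).im • (Pi.single j Complex.I : Pt n)) := by
  ext k
  rw [Finset.sum_apply, Finset.sum_eq_single k]
  · simp
  · intro b _ hb
    simp [Ne.symm hb]
  · simp

theorem mulI_eq_sum (X : Pt n) : mulI n X =
    ∑ j, ((X j).re • (Pi.single j Complex.I : Pt n) - (X j).im • (Pi.single j 1 : Pt n)) := by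
  rw [pt_eq_sum (mulI n X)]
  refine Finset.sum_congr rfl fun j _ => ?_
  rw [mulI_apply]
  simp [sub_eq_add_neg, add_comm]

theorem fderiv_cR (u : Pt n → ℝ) (z v : Pt n) :
    fderiv ℝ (cR n u) z v = (fderiv ℝ u z v : ℂ) := by
  by_cases h : DifferentiableAt ℝ u z
  · have := (ofRealCLM.hasFDerivAt (x := u z)).comp z h.hasFDerivAt
    have h2 : HasFDerivAt (cR n u) (ofRealCLM.comp (fderiv ℝ u z)) z := this
    rw [h2.fderiv]; rfl
  · have h' : ¬ DifferentiableAt ℝ (cR n u) z := by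
      intro h2
      apply h
      have := (reCLM.hasFDerivAt (x := cR n u z)).comp z h2.hasFDerivAt
      exact this.differentiableAt
    rw [fderiv_zero_of_not_differentiableAt h, fderiv_zero_of_not_differentiableAt h']
    simp

theorem dZb_cR (u : Pt n → ℝ) (k : Fin n) : (fun w => dZb n (cR n u) k w) = fun w =>
    (1 / 2 : ℂ) * ((fderiv ℝ u w (Pi.single k 1) : ℂ)
      + Complex.I * (fderiv ℝ u w (Pi.single k Complex.I) : ℂ)) := by
  ext w
  simp only [dZb, fderiv_cR]

theorem fderiv_dZb_cR {u : Pt n → ℝ} {z : Pt n} (h : DifferentiableAt ℝ (fderiv ℝ u) z)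
    (k : Fin n) (v : Pt n) : fderiv ℝ (fun w => dZb n (cR n u) k w) z v =
    (1 / 2 : ℂ) * ((fderiv ℝ (fderiv ℝ u) z v (Pi.single k 1) : ℂ)
      + Complex.I * (fderiv ℝ (fderiv ℝ u) z v (Pi.single k Complex.I) : ℂ)) := by
  rw [dZb_cR]
  have h1 : ∀ a : Pt n, HasFDerivAt (fun w => ((fderiv ℝ u w a : ℝ) : ℂ))
      (ofRealCLM.comp ((fderiv ℝ (fderiv ℝ u) z).flip a)) z := by
    intro a
    have h2 : HasFDerivAt (fun w => fderiv ℝ u w a) ((fderiv ℝ (fderiv ℝ u) z).flip a) z := by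
      simpa using h.hasFDerivAt.clm_apply (hasFDerivAt_const a z)
    exact (ofRealCLM.hasFDerivAt (x := fderiv ℝ u z a)).comp z h2
  have h3 := ((h1 (Pi.single k 1)).add
    ((h1 (Pi.single k Complex.I)).const_mul Complex.I)).const_mul (1 / 2 : ℂ)
  refine (congrArg (fun L => L v) h3.fderiv).trans ?_
  simp
  ring

/-- For twice differentiable functions the Levi form is a quarter of the directional
Laplacian. -/
theorem levi_re_eq {u : Pt n → ℝ} {z : Pt n} (h : DifferentiableAt ℝ (fderiv ℝ u) z)
    (X : Pt n) : (levi n u z X X).re = (1 / 4) * lap (mulI n) u z X := by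
  set B := fderiv ℝ (fderiv ℝ u) z with hB
  have hX : B X X = ∑ j, ∑ k, ((X j).re * ((X k).re * B (Pi.single j 1) (Pi.single k 1))
      + (X j).re * ((X k).im * B (Pi.single j 1) (Pi.single k Complex.I))
      + (X j).im * ((X k).re * B (Pi.single j Complex.I) (Pi.single k 1))
      + (X j).im * ((X k).im * B (Pi.single j Complex.I) (Pi.single k Complex.I))) := by
    conv_lhs => rw [pt_eq_sum X]
    simp only [map_sum, _root_.sum_apply]
    rw [Finset.sum_comm]
    refine Finset.sum_congr rfl fun j _ => Finset.sum_congr rfl fun k _ => ?_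
    simp only [map_add, map_smul, _root_.add_apply, _root_.smul_apply,
      smul_eq_mul]
    ring
  have hJ : B (mulI n X) (mulI n X) = ∑ j, ∑ k,
      ((X j).re * ((X k).re * B (Pi.single j Complex.I) (Pi.single k Complex.I))
      - (X j).re * ((X k).im * B (Pi.single j Complex.I) (Pi.single k 1))
      - (X j).im * ((X k).re * B (Pi.single j 1) (Pi.single k Complex.I))
      + (X j).im * ((X k).im * B (Pi.single j 1) (Pi.single k 1))) := by
    rw [mulI_eq_sum X]
    simp only [map_sum, _root_.sum_apply]
    rw [Finset.sum_comm]
    refine Finset.sum_congr rfl fun j _ => Finset.sum_congr rfl fun k _ => ?_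
    simp only [map_sub, map_smul, _root_.sub_apply, _root_.smul_apply,
      smul_eq_mul]
    ring
  simp only [lap, hess, ← hB]
  rw [hX, hJ, ← Finset.sum_add_distrib, Finset.mul_sum, levi, re_sum]
  refine Finset.sum_congr rfl fun j _ => ?_
  rw [← Finset.sum_add_distrib, Finset.mul_sum, re_sum]
  refine Finset.sum_congr rfl fun k _ => ?_
  simp only [dZ, fderiv_dZb_cR h, ← hB]
  simp
  ring

theorem dZ_eq_zero_of_not_differentiableAt {φ : Pt n → ℂ} {z : Pt n} (j : Fin n)
    (h : ¬ DifferentiableAt ℝ φ z) : dZ n φ j z = 0 := by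
  simp [dZ, fderiv_zero_of_not_differentiableAt h]

/-- Nondegeneracy of the Levi form forces the gradient to be differentiable. -/
theorem differentiableAt_fderiv_of_levi_ne {u : Pt n → ℝ} {z : Pt n}
    (h : ∀ X : Pt n, X ≠ 0 → 0 < (levi n u z X X).re) : DifferentiableAt ℝ (fderiv ℝ u) z := by
  have hd : ∀ k, DifferentiableAt ℝ (fun w => dZb n (cR n u) k w) z := by
    intro k
    by_contra hk
    have h1 := h (Pi.single k 1) (by simp)
    rw [levi, Finset.sum_eq_single k, Finset.sum_eq_single k] at h1
    · rw [dZ_eq_zero_of_not_differentiableAt _ hk] at h1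
      simp at h1
    · intro b _ hb; simp [hb]
    · simp
    · intro b _ hb; simp [hb]
    · simp
  have e : fderiv ℝ u = fun w => ∑ j, ((2 * (dZb n (cR n u) j w).re) •
      (reCLM.comp (ContinuousLinearMap.proj (R := ℝ) (φ := fun _ : Fin n => ℂ) j)) +
      (2 * (dZb n (cR n u) j w).im) •
      (imCLM.comp (ContinuousLinearMap.proj (R := ℝ) (φ := fun _ : Fin n => ℂ) j))) := by
    ext w v
    conv_lhs => rw [pt_eq_sum v]
    simp only [map_sum, _root_.sum_apply]
    refine Finset.sum_congr rfl fun j _ => ?_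
    rw [congrFun (dZb_cR u j) w]
    simp
    ring
  rw [e]
  refine DifferentiableAt.fun_sum fun j _ => ?_
  have hre : DifferentiableAt ℝ (fun w => 2 * (dZb n (cR n u) j w).re) z :=
    ((reCLM.differentiableAt (x := dZb n (cR n u) j z)).comp z (hd j)).const_mul 2
  have him : DifferentiableAt ℝ (fun w => 2 * (dZb n (cR n u) j w).im) z :=
    ((imCLM.differentiableAt (x := dZb n (cR n u) j z)).comp z (hd j)).const_mul 2
  exact (hre.smul_const _).add (him.smul_const _)

theorem sum_mul_dZ (φ : Pt n → ℂ) (z L : Pt n) : ∑ j, L j * dZ n φ j z =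
    (1 / 2 : ℂ) * (fderiv ℝ φ z L - Complex.I * fderiv ℝ φ z (mulI n L)) := by
  conv_rhs => rw [mulI_eq_sum L]
  have : fderiv ℝ φ z L = ∑ j, fderiv ℝ φ z
      ((L j).re • (Pi.single j 1 : Pt n) + (L j).im • (Pi.single j Complex.I : Pt n)) := by
    conv_lhs => rw [pt_eq_sum L]
    rw [map_sum]
  rw [this, map_sum, Finset.mul_sum, ← Finset.sum_sub_distrib, Finset.mul_sum]
  refine Finset.sum_congr rfl fun j _ => ?_
  simp only [dZ, map_add, map_sub, map_smul, real_smul]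
  conv_lhs => rw [← re_add_im (L j)]
  linear_combination (1 / 2) * ((L j).im * (fderiv ℝ φ z) (Pi.single j Complex.I)) * (-I_mul_I)

theorem mem_T10_iff (u : Pt n → ℝ) (p L : Pt n) :
    L ∈ T10 n u p ↔ fderiv ℝ u p L = 0 ∧ fderiv ℝ u p (mulI n L) = 0 := by
  rw [T10, mem_ofPred_eq, sum_mul_dZ, fderiv_cR, fderiv_cR]
  rw [mul_eq_zero, or_iff_right (by norm_num), Complex.ext_iff]
  simp

theorem fderiv_apply_of_push {f : Pt n → Pt n} {p L : Pt n} (hf : DifferentiableAt ℝ f p)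
    (h : (push n f p (L, 0)).2 = 0) : fderiv ℝ f p (mulI n L) = mulI n (fderiv ℝ f p L) := by
  ext l
  have h1 := congrFun h l
  simp only [push, vecApp, Pi.zero_apply, zero_mul, Finset.sum_const_zero, add_zero] at h1
  rw [sum_mul_dZ] at h1
  have hl : HasFDerivAt (fun w => f w l)
      ((ContinuousLinearMap.proj (R := ℝ) (φ := fun _ : Fin n => ℂ) l).comp (fderiv ℝ f p)) p :=
    hasFDerivAt_pi'.1 hf.hasFDerivAt l
  have hc : HasFDerivAt (fun w => (starRingEnd ℂ) (f w l)) ((conjCLE : ℂ →L[ℝ] ℂ).comp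
      ((ContinuousLinearMap.proj (R := ℝ) (φ := fun _ : Fin n => ℂ) l).comp (fderiv ℝ f p))) p :=
    ((conjCLE : ℂ →L[ℝ] ℂ).hasFDerivAt).comp p hl
  rw [hc.fderiv] at h1
  have h2 : (starRingEnd ℂ) (fderiv ℝ f p L l) -
      Complex.I * (starRingEnd ℂ) (fderiv ℝ f p (mulI n L) l) = 0 := by
    simpa using h1
  have h3 := congrArg (starRingEnd ℂ) h2
  simp only [map_sub, map_mul, conj_conj, conj_I, map_zero] at h3
  rw [mulI_apply]
  linear_combination (-Complex.I) * h3 + (fderiv ℝ f p (mulI n L) l) * I_mul_I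

end Bridge

section Glue

variable {E : Type*} [NormedAddCommGroup E] [NormedSpace ℝ E] (J : E →L[ℝ] E)
  (ψ : ℕ → E → ℝ) (T : ℕ → Set E) (ε : ℕ → ℝ)

open Classical in
/-- Successive regularized maxima of the functions `ψ k`, each used only on `T k`. -/
noncomputable def glueAux : ℕ → E → ℝ
  | 0, _ => 0
  | m + 1, z => if z ∈ T m then smax (ε m) (glueAux m z) (ψ m z) else glueAux m z

/-- The glued function. -/
noncomputable def glue (z : E) : ℝ := limUnder atTop fun m => glueAux ψ T ε m z

variable {ψ T ε}

theorem glue_eq {z : E} {M : ℕ} (h : ∀ m, M ≤ m → z ∉ T m) : glue ψ T ε z = glueAux ψ T ε M z := by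
  have h1 : ∀ m, M ≤ m → glueAux ψ T ε m z = glueAux ψ T ε M z := by
    intro m hm
    induction m, hm using Nat.le_induction with
    | base => rfl
    | succ m hm ih => rw [glueAux, if_neg (h m hm), ih]
  refine Tendsto.limUnder_eq (tendsto_const_nhds.congr' ?_)
  filter_upwards [eventually_ge_atTop M] with m hm using (h1 m hm).symm

theorem glueAux_eq (hε : ∀ k, 0 < ε k) {S : Finset ℕ} {w : E} {i : ℕ} {tol : ℝ}
    (hS : ∀ k, k ∉ S → w ∉ T k) (htol : 2 * ∑ k ∈ S, ε k ≤ tol) (hi : i ∈ S) (hiT : w ∈ T i)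
    (hl : ∀ l ∈ S, w ∈ T l ∨ ψ l w + tol ≤ ψ i w) (m : ℕ) :
    (glueAux ψ T ε m w = glueAux ψ (fun k => {_z | k ∈ S}) ε m w ∨
      (m ≤ i ∧ glueAux ψ T ε m w ≤ ψ i w - tol + 2 * ∑ k ∈ S with k < m, ε k ∧
      glueAux ψ (fun k => {_z | k ∈ S}) ε m w ≤ ψ i w - tol + 2 * ∑ k ∈ S with k < m, ε k)) ∧
    (i < m → ψ i w ≤ glueAux ψ (fun k => {_z | k ∈ S}) ε m w) := by
  have hsum : ∀ m ∈ S, ∑ k ∈ S with k < m + 1, ε k = (∑ k ∈ S with k < m, ε k) + ε m := by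
    intro m hm
    have : (S.filter fun k => k < m + 1) = insert m (S.filter fun k => k < m) := by
      ext k
      simp only [Finset.mem_filter, Finset.mem_insert]
      constructor
      · rintro ⟨h1, h2⟩
        rcases Nat.lt_succ_iff_lt_or_eq.1 h2 with h | h
        · exact Or.inr ⟨h1, h⟩
        · exact Or.inl h
      · rintro (h | ⟨h1, h2⟩)
        · subst h; exact ⟨hm, by omega⟩
        · exact ⟨h1, by omega⟩
    rw [this, Finset.sum_insert (by simp), add_comm]
  have hmono : ∀ m, ∑ k ∈ S with k < m, ε k ≤ ∑ k ∈ S, ε k := fun m =>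
    Finset.sum_le_sum_of_subset_of_nonneg (Finset.filter_subset _ _) fun k _ _ => (hε k).le
  have hnn : ∀ m, 0 ≤ ∑ k ∈ S with k < m, ε k := fun m => Finset.sum_nonneg fun k _ => (hε k).le
  induction m with
  | zero => simp [glueAux]
  | succ m ih =>
    obtain ⟨ih1, ih2⟩ := ih
    rw [glueAux, glueAux]
    by_cases hm : m ∈ S
    swap
    · rw [if_neg (hS m hm), if_neg (by simpa using hm)]
      have hne : m ≠ i := fun h => hm (h ▸ hi)
      have hs : (S.filter fun k => k < m + 1) = S.filter fun k => k < m := by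
        refine Finset.filter_congr fun k hk => ?_
        have : k ≠ m := fun h => hm (h ▸ hk)
        omega
      rw [hs]
      refine ⟨ih1.imp id fun h => ⟨by omega, h.2⟩, fun h => ih2 (by omega)⟩
    · have hm' : w ∈ {_z : E | m ∈ S} := hm
      rw [if_pos hm', hsum m hm]
      have hεm := hε m
      have hm1 := hsum m hm
      have hm2 := hmono (m + 1)
      have hm0 := hnn m
      set a := glueAux ψ T ε m w
      set b := glueAux ψ (fun k => {_z | k ∈ S}) ε m w
      set σ := ∑ k ∈ S with k < m, ε k
      have hbge := smax_ge hεm b (ψ m w)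
      refine ⟨?_, fun h => ?_⟩
      swap
      · rcases Nat.lt_succ_iff_lt_or_eq.1 h with h | h
        · exact (ih2 h).trans ((le_max_left _ _).trans hbge)
        · subst h; exact (le_max_right _ _).trans hbge
      have key : ∀ s B : ℝ, s ≤ B → ψ m w ≤ B → smax (ε m) s (ψ m w) ≤ B + ε m := fun s B h1 h2 =>
        (smax_le hεm _ _).trans (by linarith [max_le h1 h2])
      by_cases hT : w ∈ T m
      · rw [if_pos hT]
        rcases ih1 with h | ⟨h0, h1, h2⟩
        · rw [h]; exact Or.inl rfl
        · by_cases hc : ψ i w - tol + 2 * σ + ε m ≤ ψ m w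
          · left
            have e : ∀ s, s ≤ ψ i w - tol + 2 * σ → smax (ε m) s (ψ m w) = ψ m w := by
              intro s hs
              have h1 : 1 ≤ (ψ m w - s) / ε m := by rw [le_div_iff₀ hεm]; linarith
              rcases softPos_cases ((ψ m w - s) / ε m) with ⟨h, -⟩ | ⟨h, e, -⟩ | ⟨h, h2, e, -⟩
              · linarith
              · rw [smax, e]; field_simp; ring
              · have h3 := le_antisymm h2 h1
                rw [smax, e, h3]
                have : ψ m w - s = ε m := by field_simp at h3; linarith
                linarith
            rw [e _ h1, e _ h2]
          · right
            have hne : m ≠ i := by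
              intro h; subst h
              apply hc; linarith
            refine ⟨by omega, (key _ _ (h1.trans (by linarith)) (not_le.1 hc).le).trans ?_,
              (key _ _ (h2.trans (by linarith)) (not_le.1 hc).le).trans ?_⟩ <;> linarith
      · rw [if_neg hT]
        have hψ := (hl m hm).resolve_left hT
        have hne : m ≠ i := fun h => hT (h ▸ hiT)
        rcases ih1 with h | ⟨h0, h1, h2⟩
        · rw [h]
          by_cases hc : ψ m w + ε m ≤ b
          · left; rw [smax_eq_left hεm hc]
          · right
            have hmi : m ≤ i := by
              by_contra hcon
              have := ih2 (not_le.1 hcon)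
              linarith
            have hb := (not_le.1 hc).le
            refine ⟨by omega, by linarith, ?_⟩
            refine (key b (ψ i w - tol + ε m) (by linarith) (by linarith)).trans ?_
            linarith
        · right
          refine ⟨by omega, by linarith, ?_⟩
          refine (key _ _ h2 (by linarith)).trans ?_
          linarith

theorem glueAux_props (hε : ∀ k, 0 < ε k) {S : Finset ℕ} {z : E}
    (hC : ∀ k ∈ S, C2At (ψ k) z) (hlap : ∀ k ∈ S, ∀ X, X ≠ 0 → 0 < lap J (ψ k) z X)
    (hpos : ∀ k ∈ S, ε k < ψ k z) (m : ℕ) :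
    ((∀ k ∈ S, m ≤ k) ∧ ∀ w, glueAux ψ (fun k => {_z | k ∈ S}) ε m w = 0) ∨
    (C2At (glueAux ψ (fun k => {_z | k ∈ S}) ε m) z ∧
      (∀ X, X ≠ 0 → 0 < lap J (glueAux ψ (fun k => {_z | k ∈ S}) ε m) z X) ∧
      ∀ lo hi (V : E →L[ℝ] ℝ) e, (∀ k ∈ S, lo ≤ ψ k z ∧ ψ k z ≤ hi ∧ ‖fderiv ℝ (ψ k) z - V‖ ≤ e) →
        lo ≤ glueAux ψ (fun k => {_z | k ∈ S}) ε m z ∧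
        glueAux ψ (fun k => {_z | k ∈ S}) ε m z ≤ hi + ∑ k ∈ S with k < m, ε k ∧
        ‖fderiv ℝ (glueAux ψ (fun k => {_z | k ∈ S}) ε m) z - V‖ ≤ e) := by
  induction m with
  | zero => left; exact ⟨fun _ _ => Nat.zero_le _, fun _ => rfl⟩
  | succ m ih =>
    have hmono : ∑ k ∈ S with k < m, ε k ≤ ∑ k ∈ S with k < m + 1, ε k :=
      Finset.sum_le_sum_of_subset_of_nonneg
        (Finset.monotone_filter_right _ fun k h1 h2 => by omega) fun k _ _ => (hε k).le
    by_cases hm : m ∈ S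
    swap
    · have e : glueAux ψ (fun k => {_z | k ∈ S}) ε (m + 1) =
          glueAux ψ (fun k => {_z | k ∈ S}) ε m := by
        ext w
        rw [glueAux, if_neg (by simpa using hm)]
      rw [e]
      rcases ih with ⟨h1, h2⟩ | ⟨h1, h2, h3⟩
      · left
        refine ⟨fun k hk => ?_, h2⟩
        have := h1 k hk
        have : k ≠ m := fun h => hm (h ▸ hk)
        omega
      · right
        refine ⟨h1, h2, fun lo hi V e h => ?_⟩
        obtain ⟨h4, h5, h6⟩ := h3 lo hi V e h
        exact ⟨h4, h5.trans (by linarith), h6⟩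
    · right
      have e : glueAux ψ (fun k => {_z | k ∈ S}) ε (m + 1) =
          fun w => smax (ε m) (glueAux ψ (fun k => {_z | k ∈ S}) ε m w) (ψ m w) := by
        ext w
        rw [glueAux, if_pos (show w ∈ {_z : E | m ∈ S} from hm)]
      have hnn : ∀ m, 0 ≤ ∑ k ∈ S with k < m, ε k :=
        fun m => Finset.sum_nonneg fun k _ => (hε k).le
      rcases ih with ⟨h1, h2⟩ | ⟨h1, h2, h3⟩
      · have e2 : glueAux ψ (fun k => {_z | k ∈ S}) ε (m + 1) =ᶠ[𝓝 z] ψ m := by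
          have hc := (hC m hm).differentiableAt.continuousAt
          filter_upwards [hc.eventually (lt_mem_nhds (hpos m hm))] with w hw
          rw [e]
          simp only [h2]
          have h1 : 1 ≤ (ψ m w - 0) / ε m := by rw [le_div_iff₀ (hε m)]; linarith
          rcases softPos_cases ((ψ m w - 0) / ε m) with ⟨h, -⟩ | ⟨h, e, -⟩ | ⟨h, h2, e, -⟩
          · linarith
          · rw [smax, e]; have := (hε m).ne'; field_simp; ring
          · have h3 := le_antisymm h2 h1
            rw [div_eq_one_iff_eq (hε m).ne'] at h3
            linarith
        refine ⟨(hC m hm).congr e2, fun X hX => ?_, fun lo hi V e h => ?_⟩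
        · rw [lap_congr J e2]; exact hlap m hm X hX
        · rw [e2.self_of_nhds, e2.fderiv_eq]
          obtain ⟨h4, h5, h6⟩ := h m hm
          exact ⟨h4, by linarith [hnn (m + 1)], h6⟩
      · obtain ⟨c1, θ, t0, t1, c2, c3⟩ := h1.smax J (hC m hm) (hε m)
        rw [e]
        refine ⟨c1, fun X hX => ?_, fun lo hi V e h => ?_⟩
        · refine lt_of_lt_of_le ?_ (c3 X)
          rcases eq_or_lt_of_le t0 with h | h
          · rw [← h]; simpa using h2 X hX
          · have := mul_nonneg (sub_nonneg.2 t1) (h2 X hX).le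
            have := mul_pos h (hlap m hm X hX)
            linarith
        · obtain ⟨h4, h5, h6⟩ := h3 lo hi V e h
          obtain ⟨g4, g5, g6⟩ := h m hm
          refine ⟨h4.trans ((le_max_left _ _).trans (smax_ge (hε m) _ _)), ?_, ?_⟩
          · refine (smax_le (hε m) _ _).trans ?_
            have hs : (S.filter fun k => k < m + 1) = insert m (S.filter fun k => k < m) := by
              ext k
              simp only [Finset.mem_filter, Finset.mem_insert]
              constructor
              · rintro ⟨h1, h2⟩
                by_cases hk : k = m
                · exact Or.inl hk
                · exact Or.inr ⟨h1, by omega⟩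
              · rintro (h | ⟨h1, h2⟩)
                · subst h; exact ⟨hm, by omega⟩
                · exact ⟨h1, by omega⟩
            rw [hs, Finset.sum_insert (by simp)]
            have := max_le h5 (g5.trans (by linarith [hnn m] : hi ≤ hi + ∑ k ∈ S with k < m, ε k))
            linarith
          · rw [c2]
            have : (1 - θ) • fderiv ℝ (glueAux ψ (fun k => {_z | k ∈ S}) ε m) z +
                θ • fderiv ℝ (ψ m) z - V =
                (1 - θ) • (fderiv ℝ (glueAux ψ (fun k => {_z | k ∈ S}) ε m) z - V) +
                θ • (fderiv ℝ (ψ m) z - V) := by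
              rw [smul_sub, smul_sub, sub_smul 1 θ V, one_smul]; abel
            rw [this]
            refine (norm_add_le _ _).trans ?_
            rw [norm_smul, norm_smul, Real.norm_of_nonneg t0, Real.norm_of_nonneg (sub_nonneg.2 t1)]
            nlinarith [mul_le_mul_of_nonneg_left h6 (sub_nonneg.2 t1),
              mul_le_mul_of_nonneg_left g6 t0]

/-- Local regularity and positivity of the glued function. -/
theorem glue_props (hε : ∀ k, 0 < ε k) {S : Finset ℕ} {z : E} {i : ℕ} {tol : ℝ}
    (hC : ∀ k ∈ S, C2At (ψ k) z) (hlap : ∀ k ∈ S, ∀ X, X ≠ 0 → 0 < lap J (ψ k) z X)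
    (hpos : ∀ k ∈ S, ε k < ψ k z)
    (hS : ∀ᶠ w in 𝓝 z, ∀ k, k ∉ S → w ∉ T k) (htol : 2 * ∑ k ∈ S, ε k ≤ tol) (hi : i ∈ S)
    (hiT : T i ∈ 𝓝 z) (hl : ∀ l ∈ S, T l ∈ 𝓝 z ∨ ψ l z + tol < ψ i z) :
    C2At (glue ψ T ε) z ∧ (∀ X, X ≠ 0 → 0 < lap J (glue ψ T ε) z X) ∧
      ∀ lo hi (V : E →L[ℝ] ℝ) e, (∀ k ∈ S, lo ≤ ψ k z ∧ ψ k z ≤ hi ∧ ‖fderiv ℝ (ψ k) z - V‖ ≤ e) →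
        lo ≤ glue ψ T ε z ∧ glue ψ T ε z ≤ hi + tol ∧ ‖fderiv ℝ (glue ψ T ε) z - V‖ ≤ e := by
  obtain ⟨M, hM⟩ : ∃ M, ∀ k ∈ S, k < M := ⟨S.sup id + 1, fun k hk =>
    Nat.lt_succ_of_le (Finset.le_sup (f := id) hk)⟩
  have hcont : ∀ k ∈ S, ContinuousAt (ψ k) z := fun k hk =>
    (hC k hk).differentiableAt.continuousAt
  have hl' : ∀ᶠ w in 𝓝 z, ∀ l ∈ S, w ∈ T l ∨ ψ l w + tol ≤ ψ i w := by
    rw [Filter.eventually_all_finset]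
    intro l hlS
    rcases hl l hlS with h | h
    · filter_upwards [h] with w hw using Or.inl hw
    · have h1 : ContinuousAt (fun w => ψ l w + tol) z := (hcont l hlS).add continuousAt_const
      filter_upwards [h1.eventually_lt (hcont i hi) h] with w hw using Or.inr hw.le
  have e : glue ψ T ε =ᶠ[𝓝 z] glueAux ψ (fun k => {_z | k ∈ S}) ε M := by
    filter_upwards [hS, hiT, hl'] with w h1 h2 h3
    rw [glue_eq (M := M) fun m hm => h1 m fun h => absurd (hM m h) (by omega)]
    obtain ⟨h4, -⟩ := glueAux_eq hε h1 htol hi h2 h3 M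
    rcases h4 with h | ⟨h, -⟩
    · exact h
    · exact absurd (hM i hi) (by omega)
  rcases glueAux_props J hε hC hlap hpos M with ⟨h, -⟩ | ⟨h1, h2, h3⟩
  · exact absurd (hM i hi) (by have := h i hi; omega)
  · refine ⟨h1.congr e, fun X hX => ?_, fun lo hi' V e' h => ?_⟩
    · rw [lap_congr J e]; exact h2 X hX
    · rw [e.self_of_nhds, e.fderiv_eq]
      obtain ⟨h4, h5, h6⟩ := h3 lo hi' V e' h
      refine ⟨h4, h5.trans ?_, h6⟩
      have : ∑ k ∈ S with k < M, ε k ≤ ∑ k ∈ S, ε k :=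
        Finset.sum_le_sum_of_subset_of_nonneg (Finset.filter_subset _ _) fun k _ _ => (hε k).le
      have : 0 ≤ ∑ k ∈ S, ε k := Finset.sum_nonneg fun k _ => (hε k).le
      linarith

end Glue

section Net

/-- A countable net of a set, with mesh proportional to the distance to `M`. -/
theorem exists_whitney_net {E : Type*} [MetricSpace E] [ProperSpace E] {M W : Set E}
    (hM : IsCompact M) (hMn : M.Nonempty) {δ : ℝ} (hδ : 0 < δ) :
    ∃ (a : ℕ → E) (s : ℕ → ℝ), (∀ k, 0 ≤ s k) ∧
      (∀ k, 0 < s k → a k ∈ W ∧ s k ≤ infDist (a k) M ∧ infDist (a k) M ≤ 2 * s k ∧ s k ≤ 1) ∧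
      (∀ z ∈ W, 0 < infDist z M → infDist z M ≤ 1 → ∃ k, 0 < s k ∧ dist z (a k) < δ * s k) ∧
      ∀ t, 0 < t → {k | t ≤ s k}.Finite := by
  have hshell : ∀ j : ℕ, TotallyBounded
      {z | z ∈ W ∧ (1 / 2 : ℝ) ^ (j + 1) ≤ infDist z M ∧ infDist z M ≤ (1 / 2) ^ j} := by
    intro j
    refine TotallyBounded.subset ?_ (hM.cthickening (r := 1)).totallyBounded
    rintro z ⟨-, -, hz⟩
    obtain ⟨y, hy, hzy⟩ := hM.exists_infDist_eq_dist hMn z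
    refine mem_cthickening_of_dist_le z y 1 M hy (hzy ▸ hz.trans (pow_le_one₀ ?_ ?_)) <;> norm_num
  have hnet : ∀ j : ℕ, ∃ F : Finset E,
      (∀ x ∈ F, x ∈ W ∧ (1 / 2 : ℝ) ^ (j + 1) ≤ infDist x M ∧ infDist x M ≤ (1 / 2) ^ j) ∧
      ∀ z ∈ W, (1 / 2 : ℝ) ^ (j + 1) ≤ infDist z M → infDist z M ≤ (1 / 2) ^ j →
        ∃ x ∈ F, dist z x < δ * (1 / 2) ^ (j + 1) := by
    intro j
    obtain ⟨t, ht1, ht2, ht3⟩ := finite_approx_of_totallyBounded (hshell j)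
      (δ * (1 / 2) ^ (j + 1)) (by positivity)
    refine ⟨ht2.toFinset, fun x hx => ht1 (ht2.mem_toFinset.1 hx), fun z h1 h2 h3 => ?_⟩
    obtain ⟨x, hx, hx'⟩ := mem_iUnion₂.1 (ht3 ⟨h1, h2, h3⟩)
    exact ⟨x, ht2.mem_toFinset.2 hx, hx'⟩
  choose F hF1 hF2 using hnet
  let ι := Σ j : ℕ, {x // x ∈ F j}
  let _ : Encodable ι := Encodable.ofCountable ι
  obtain ⟨m0, hm0⟩ := hMn
  let a : ℕ → E := fun k => (Encodable.decode₂ ι k).elim m0 fun i => i.2.1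
  let s : ℕ → ℝ := fun k => (Encodable.decode₂ ι k).elim 0 fun i => (1 / 2) ^ (i.1 + 1)
  refine ⟨a, s, fun k => ?_, fun k hk => ?_, fun z hz hz0 hz1 => ?_, fun t ht => ?_⟩
  · simp only [s]
    cases Encodable.decode₂ ι k with
    | none => simp
    | some i => simp
  · simp only [s, a] at hk ⊢
    cases h : Encodable.decode₂ ι k with
    | none => simp [h] at hk
    | some i =>
      simp only [Option.elim_some]
      obtain ⟨h1, h2, h3⟩ := hF1 i.1 i.2.1 i.2.2
      refine ⟨h1, h2, h3.trans_eq (by rw [pow_succ]; ring), pow_le_one₀ ?_ ?_⟩ <;> norm_num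
  · obtain ⟨j, hj1, hj2⟩ := exists_nat_pow_near_of_lt_one hz0 hz1
      (y := (1 / 2 : ℝ)) (by norm_num) (by norm_num)
    obtain ⟨x, hx, hx'⟩ := hF2 j z hz hj1.le hj2
    refine ⟨Encodable.encode (⟨j, x, hx⟩ : ι), ?_, ?_⟩
    · simp [s]
    · simpa [s, a] using hx'
  · obtain ⟨N, hN⟩ := exists_pow_lt_of_lt_one ht (by norm_num : (1 / 2 : ℝ) < 1)
    refine ((((Finset.range N).sigma fun j => (Finset.univ : Finset {x // x ∈ F j})).finite_toSet
      ).image (Encodable.encode (α := ι))).subset ?_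
    intro k hk
    simp only [mem_ofPred_eq, s] at hk
    cases h : Encodable.decode₂ ι k with
    | none => rw [h] at hk; simp at hk; linarith
    | some i =>
      rw [h] at hk
      simp only [Option.elim_some] at hk
      refine ⟨i, ?_, ?_⟩
      · refine Finset.mem_coe.2 (Finset.mem_sigma.2 ⟨Finset.mem_range.2 ?_, Finset.mem_univ _⟩)
        by_contra hcon
        have : (1 / 2 : ℝ) ^ (i.1 + 1) ≤ (1 / 2) ^ N :=
          pow_le_pow_of_le_one (by norm_num) (by norm_num) (by omega)
        linarith
      · exact Encodable.mem_decode₂.1 h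

end Net

section Holomorphic

variable {E : Type*} [NormedAddCommGroup E] [NormedSpace ℝ E] {J : E →L[ℝ] E}

theorem hess_add_hess_of_holomorphic (hJ : ∀ x, J (J x) = -x) {P : E → E}
    (hP : ContDiff ℝ 2 P) (hol : ∀ z X, fderiv ℝ P z (J X) = J (fderiv ℝ P z X)) (z X : E) :
    hess P z X + hess P z (J X) = 0 := by
  have hd : DifferentiableAt ℝ (fderiv ℝ P) z := (hP.contDiffAt.c2At).2
  have key : ∀ Y X, fderiv ℝ (fderiv ℝ P) z Y (J X) = J (fderiv ℝ (fderiv ℝ P) z Y X) := by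
    intro Y X
    have h1 : HasFDerivAt (fun w => fderiv ℝ P w (J X))
        ((fderiv ℝ (fderiv ℝ P) z).flip (J X)) z := by
      simpa using hd.hasFDerivAt.clm_apply (hasFDerivAt_const (J X) z)
    have h2 : HasFDerivAt (fun w => fderiv ℝ P w X) ((fderiv ℝ (fderiv ℝ P) z).flip X) z := by
      simpa using hd.hasFDerivAt.clm_apply (hasFDerivAt_const X z)
    have h3 := (J.hasFDerivAt (x := fderiv ℝ P z X)).comp z h2
    have h4 : (fun w => fderiv ℝ P w (J X)) = (⇑J ∘ fun w => fderiv ℝ P w X) := by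
      ext w; exact hol w X
    rw [h4] at h1
    have := congrArg (fun L => L Y) (h1.unique h3)
    simpa using this
  have hs := (hP.contDiffAt (x := z)).isSymmSndFDerivAt (by simp)
  simp only [hess]
  rw [key, hs.eq (J X) X, key, hJ, add_neg_cancel]

theorem lap_comp_holomorphic (hJ : ∀ x, J (J x) = -x) {P : E → E} {v : E → ℝ} {z : E}
    (hP : ContDiff ℝ 2 P) (hol : ∀ z X, fderiv ℝ P z (J X) = J (fderiv ℝ P z X))
    (hv : C2At v (P z)) (X : E) :
    lap J (fun w => v (P w)) z X = lap J v (P z) (fderiv ℝ P z X) := by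
  have hP' : C2At P z := hP.contDiffAt.c2At
  simp only [lap]
  rw [hess_comp hv hP', hess_comp hv hP', hol]
  have := congrArg (fderiv ℝ v (P z)) (hess_add_hess_of_holomorphic hJ hP hol z X)
  rw [map_add, map_zero] at this
  linarith

end Holomorphic

section Quadratic

variable {E : Type*} [NormedAddCommGroup E] [NormedSpace ℝ E] {J : E →L[ℝ] E}

/-- A Euclidean inner product compatible with the complex structure `J`. -/
structure IsHermitianForm (J : E →L[ℝ] E) (q : E →L[ℝ] E →L[ℝ] ℝ) : Prop where
  sq : ∀ x, J (J x) = -x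
  symm : ∀ x y, q x y = q y x
  inv : ∀ x y, q (J x) (J y) = q x y
  norm_sq_le : ∀ x, ‖x‖ ^ 2 ≤ q x x

variable {q : E →L[ℝ] E →L[ℝ] ℝ}

theorem IsHermitianForm.pos (h : IsHermitianForm J q) {x : E} (hx : x ≠ 0) : 0 < q x x :=
  lt_of_lt_of_le (by positivity) (h.norm_sq_le x)

theorem IsHermitianForm.hasFDerivAt (h : IsHermitianForm J q) (a z : E) :
    HasFDerivAt (fun w => q (w - a) (w - a)) ((2 : ℝ) • q (z - a)) z := by
  have h1 : HasFDerivAt (fun w => w - a) (ContinuousLinearMap.id ℝ E) z :=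
    (hasFDerivAt_id z).sub_const a
  have h2 := (q.hasFDerivAt.comp z h1).clm_apply h1
  refine h2.congr_fderiv ?_
  ext v
  simp [h.symm v, two_mul]

theorem IsHermitianForm.c2At (h : IsHermitianForm J q) (a z : E) :
    C2At (fun w => q (w - a) (w - a)) z := by
  have e : fderiv ℝ (fun w => q (w - a) (w - a)) = fun w => (2 : ℝ) • q (w - a) := by
    ext1 w; exact (h.hasFDerivAt a w).fderiv
  refine ⟨Eventually.of_forall fun w => (h.hasFDerivAt a w).differentiableAt, ?_⟩
  rw [e]
  fun_prop

theorem IsHermitianForm.lap_eq (h : IsHermitianForm J q) (a z X : E) :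
    lap J (fun w => q (w - a) (w - a)) z X = 4 * q X X := by
  have e : fderiv ℝ (fun w => q (w - a) (w - a)) = fun w => (2 : ℝ) • q (w - a) := by
    ext1 w; exact (h.hasFDerivAt a w).fderiv
  have h1 : HasFDerivAt (fun w => (2 : ℝ) • q (w - a)) ((2 : ℝ) • q) z :=
    (((2 : ℝ) • q).hasFDerivAt (x := z - a)).comp z ((hasFDerivAt_id z).sub_const a)
  simp only [lap, hess]
  rw [e, h1.fderiv]
  simp [h.inv]
  ring

/-- The weight used to localize near `a`. -/
noncomputable def bump (q : E →L[ℝ] E →L[ℝ] ℝ) (ε : ℝ) (a z : E) : ℝ :=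
  ε * q z z - ε / 2 * q (z - a) (z - a)

theorem IsHermitianForm.hasFDerivAt_bump (h : IsHermitianForm J q) (ε : ℝ) (a z : E) :
    HasFDerivAt (bump q ε a) ((2 * ε) • q z - ε • q (z - a)) z := by
  have h0 := h.hasFDerivAt 0 z
  simp only [sub_zero] at h0
  refine ((h0.const_mul ε).sub ((h.hasFDerivAt a z).const_mul (ε / 2))).congr_fderiv ?_
  rw [smul_smul, smul_smul]
  congr 2 <;> ring

theorem IsHermitianForm.bump_props (h : IsHermitianForm J q) (ε : ℝ) (a z : E) :
    C2At (bump q ε a) z ∧ ∀ X, lap J (bump q ε a) z X = 2 * ε * q X X := by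
  have h0 := h.c2At 0 z
  have h0' := h.lap_eq 0 z
  simp only [sub_zero] at h0 h0'
  have h1 : C2At (fun w => ε * q w w) z := h0.const_smul ε
  have h2 : C2At (fun w => -(ε / 2) * q (w - a) (w - a)) z := (h.c2At a z).const_smul _
  have e : bump q ε a = fun w => ε * q w w + -(ε / 2) * q (w - a) (w - a) := by
    ext w; simp only [bump]; ring
  rw [e]
  refine ⟨h1.add h2, fun X => ?_⟩
  rw [lap_add J h1 h2, lap_const_mul J h0, lap_const_mul J (h.c2At a z), h0', h.lap_eq]
  ring

/-- Strict plurisubharmonicity of the local model `(ρ ∘ P * exp (bump))^η'`. -/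
theorem IsHermitianForm.lap_local_pos (h : IsHermitianForm J q) {P : E → E} {ρ : E → ℝ} {z a : E}
    {η η' ε B : ℝ} (hP : ContDiff ℝ 2 P)
    (hol : ∀ z X, fderiv ℝ P z (J X) = J (fderiv ℝ P z X)) (hη : 0 < η) (hη' : η < η')
    (hρ : 0 < ρ (P z)) (hρc : ContinuousAt ρ (P z)) (hC : C2At (fun w => ρ w ^ η) (P z))
    (hl : ∀ X, 0 ≤ lap J (fun w => ρ w ^ η) (P z) X) (hε : 0 < ε)
    (hB : ‖q‖ * (2 * ‖z‖ + ‖z - a‖) ≤ B) (hεB : ε * (η' * B ^ 2) < η' / η - 1) :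
    C2At (fun w => (ρ (P w) * Real.exp (bump q ε a w)) ^ η') z ∧
    ∀ X, X ≠ 0 → 0 < lap J (fun w => (ρ (P w) * Real.exp (bump q ε a w)) ^ η') z X := by
  have hPc : ContinuousAt (fun w => ρ (P w)) z :=
    ContinuousAt.comp (g := ρ) hρc hP.continuous.continuousAt
  have hσ : 1 < η' / η := by rw [lt_div_iff₀ hη]; linarith
  have e : (fun w => (ρ (P w) * Real.exp (bump q ε a w)) ^ η') =ᶠ[𝓝 z]
      fun w => Real.exp (η' / η * Real.log (ρ (P w) ^ η) + η' * bump q ε a w) := by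
    filter_upwards [hPc.eventually (lt_mem_nhds hρ)] with w hw
    rw [Real.log_rpow hw, Real.rpow_def_of_pos (by positivity), Real.log_mul hw.ne'
      (Real.exp_pos _).ne', Real.log_exp]
    congr 1
    field_simp
  obtain ⟨b1, b2⟩ := h.bump_props ε a z
  have hv : C2At (fun w => ρ (P w) ^ η) z :=
    C2At.comp (v := fun w => ρ w ^ η) hC hP.contDiffAt.c2At
  have hb : C2At (fun w => η' * bump q ε a w) z := b1.const_smul η'
  have hv0 : 0 < ρ (P z) ^ η := Real.rpow_pos_of_pos hρ _
  have hη'0 : 0 < η' := hη.trans hη'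
  have key : ∀ X, C2At (fun w => Real.exp (η' / η * Real.log (ρ (P w) ^ η) + η' * bump q ε a w)) z ∧
      (X ≠ 0 → 0 < lap J (fun w => Real.exp (η' / η * Real.log (ρ (P w) ^ η) +
        η' * bump q ε a w)) z X) := by
    intro X
    have hlX : 0 ≤ lap J (fun w => ρ (P w) ^ η) z X := by
      rw [lap_comp_holomorphic h.sq (v := fun w => ρ w ^ η) hP hol hC]
      exact hl _
    obtain ⟨k1, k2⟩ := lap_exp_log_ge J hv hb hv0 hσ X hlX
    refine ⟨k1, fun hX => lt_of_lt_of_le (mul_pos (Real.exp_pos _) ?_) k2⟩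
    rw [lap_const_mul J b1, b2, fderiv_const_mul b1.differentiableAt,
      (h.hasFDerivAt_bump ε a z).fderiv]
    have hq := h.pos hX
    have hbd : ∀ Y, ‖Y‖ ^ 2 ≤ q X X →
        ((η' • ((2 * ε) • q z - ε • q (z - a))) Y) ^ 2 ≤ η' ^ 2 * ε ^ 2 * B ^ 2 * q X X := by
      intro Y hY
      have h1 : |(η' • ((2 * ε) • q z - ε • q (z - a))) Y| ≤ η' * ε * B * ‖Y‖ := by
        have a1 : |q z Y| ≤ ‖q‖ * ‖z‖ * ‖Y‖ := q.le_opNorm₂ z Y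
        have a2 : |q (z - a) Y| ≤ ‖q‖ * ‖z - a‖ * ‖Y‖ := q.le_opNorm₂ (z - a) Y
        have a3 : (η' • ((2 * ε) • q z - ε • q (z - a))) Y = η' * ε * (2 * q z Y - q (z - a) Y) := by
          simp; ring
        rw [a3, abs_mul, abs_of_pos (mul_pos hη'0 hε), mul_assoc (η' * ε)]
        refine mul_le_mul_of_nonneg_left ?_ (mul_pos hη'0 hε).le
        refine (abs_sub _ _).trans ?_
        rw [abs_mul, abs_two]
        refine le_trans ?_ (mul_le_mul_of_nonneg_right hB (norm_nonneg Y))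
        nlinarith
      calc ((η' • ((2 * ε) • q z - ε • q (z - a))) Y) ^ 2
          = |(η' • ((2 * ε) • q z - ε • q (z - a))) Y| ^ 2 := (sq_abs _).symm
        _ ≤ (η' * ε * B * ‖Y‖) ^ 2 := pow_le_pow_left₀ (abs_nonneg _) h1 2
        _ = η' ^ 2 * ε ^ 2 * B ^ 2 * ‖Y‖ ^ 2 := by ring
        _ ≤ _ := mul_le_mul_of_nonneg_left hY (by positivity)
    have c1 := hbd X (h.norm_sq_le X)
    have c2 := hbd (J X) (by rw [← h.inv]; exact h.norm_sq_le _)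
    rw [sub_pos, div_lt_iff₀ (by linarith)]
    refine (add_le_add c1 c2).trans_lt ?_
    have : 0 < 2 * η' * ε * q X X := by positivity
    nlinarith [mul_lt_mul_of_pos_left hεB this]
  refine ⟨(key 0).1.congr e, fun X hX => ?_⟩
  rw [lap_congr J e]
  exact (key X).2 hX

end Quadratic

section Construct

variable {E : Type*} [NormedAddCommGroup E]

/-- The filter of points of `W` approaching the set `M`. -/
noncomputable def approach (M W : Set E) : Filter E := comap (fun z => infDist z M) (𝓝 0) ⊓ 𝓟 W

theorem eventually_approach {M W : Set E} {Q : E → Prop} :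
    (∀ᶠ z in approach M W, Q z) ↔ ∃ t > 0, ∀ z ∈ W, infDist z M < t → Q z := by
  have h : (approach M W).HasBasis (fun t : ℝ => 0 < t)
      fun t => (fun z => infDist z M) ⁻¹' ball 0 t ∩ W :=
    (Metric.nhds_basis_ball.comap _).inf_principal W
  rw [h.eventually_iff]
  simp only [mem_inter_iff, mem_preimage, mem_ball, dist_zero_right, Real.norm_eq_abs,
    abs_of_nonneg infDist_nonneg]
  exact exists_congr fun t => and_congr_right fun _ =>
    ⟨fun h z h1 h2 => h ⟨h2, h1⟩, fun h z h1 => h z h1.2 h1.1⟩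

theorem eventually_approach_mem {M W : Set E} : ∀ᶠ z in approach M W, z ∈ W :=
  eventually_approach.2 ⟨1, one_pos, fun _ h _ => h⟩

theorem eventually_approach_lt {M W : Set E} {t : ℝ} (ht : 0 < t) :
    ∀ᶠ z in approach M W, infDist z M < t :=
  eventually_approach.2 ⟨t, ht, fun _ _ h => h⟩

variable [NormedSpace ℝ E]

/-- Powers depend continuously on the function and its differential, in a scale invariant way. -/
theorem exists_power_close (β K : ℝ) {e : ℝ} (he : 0 < e) :
    ∃ δ > 0, δ < 1 ∧ ∀ (x u m : ℝ) (A B : E →L[ℝ] ℝ), 0 < u → |x - u| ≤ δ * u → ‖A - B‖ ≤ δ * m →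
      ‖B‖ ≤ K * m → 0 ≤ m → 0 < x ∧ |x ^ β - u ^ β| ≤ e * u ^ β ∧
        ‖(β * x ^ (β - 1)) • A - (β * u ^ (β - 1)) • B‖ ≤ e * u ^ (β - 1) * m := by
  have hc : ∀ γ : ℝ, Tendsto (fun s : ℝ => s ^ γ) (𝓝 1) (𝓝 1) := by
    intro γ
    have := (Real.continuousAt_rpow_const 1 γ (Or.inl one_ne_zero)).tendsto
    rwa [Real.one_rpow] at this
  have h1 : ∀ᶠ s : ℝ in 𝓝 1, |s ^ β - 1| < e := by
    have := (hc β).eventually (Metric.ball_mem_nhds 1 he)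
    simpa [Real.dist_eq] using this
  set e2 : ℝ := min 1 (e / (2 * (|β| * |K| + 1))) with he2
  have he2p : 0 < e2 := lt_min one_pos (by positivity)
  have h2 : ∀ᶠ s : ℝ in 𝓝 1, |s ^ (β - 1) - 1| < e2 := by
    have := (hc (β - 1)).eventually (Metric.ball_mem_nhds 1 he2p)
    simpa [Real.dist_eq] using this
  obtain ⟨δ, hδ, hb⟩ := Metric.eventually_nhds_iff.1 (h1.and h2)
  set δ' : ℝ := min (min (1 / 2) (δ / 2)) (e / (4 * (|β| + 1))) with hδ'
  have hδp : 0 < δ' := lt_min (lt_min (by norm_num) (by positivity)) (by positivity)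
  have hδ1 : δ' ≤ 1 / 2 := (min_le_left _ _).trans (min_le_left _ _)
  have hδ2 : δ' ≤ δ / 2 := (min_le_left _ _).trans (min_le_right _ _)
  have hδ3 : δ' ≤ e / (4 * (|β| + 1)) := min_le_right _ _
  refine ⟨δ', hδp, by linarith, ?_⟩
  intro x u m A B hu hx hAB hB hm
  have hs : |x / u - 1| ≤ δ' := by
    rw [div_sub_one hu.ne', abs_div, abs_of_pos hu, div_le_iff₀ hu]; exact hx
  have hxu : x = (x / u) * u := by field_simp
  have hsp : 0 < x / u := by
    have := (abs_le.1 hs).1; linarith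
  obtain ⟨b1, b2⟩ := hb (y := x / u) (by rw [Real.dist_eq]; linarith)
  generalize x / u = s at *
  subst hxu
  refine ⟨by positivity, ?_, ?_⟩
  · rw [Real.mul_rpow hsp.le hu.le, ← sub_one_mul, abs_mul,
      abs_of_pos (Real.rpow_pos_of_pos hu β)]
    exact mul_le_mul_of_nonneg_right b1.le (Real.rpow_pos_of_pos hu β).le
  · have hU := Real.rpow_pos_of_pos hu (β - 1)
    rw [Real.mul_rpow hsp.le hu.le]
    have e1 : (β * (s ^ (β - 1) * u ^ (β - 1))) • A - (β * u ^ (β - 1)) • B =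
        (β * u ^ (β - 1)) • (s ^ (β - 1) • (A - B) + (s ^ (β - 1) - 1) • B) := by
      module
    rw [e1, norm_smul, norm_mul, Real.norm_eq_abs, Real.norm_eq_abs, abs_of_pos hU]
    have hs2 : s ^ (β - 1) ≤ 2 := by
      have := (abs_lt.1 b2).2
      have : e2 ≤ 1 := min_le_left _ _
      linarith
    have hsp' := Real.rpow_pos_of_pos hsp (β - 1)
    have e3 : ‖s ^ (β - 1) • (A - B) + (s ^ (β - 1) - 1) • B‖ ≤ 2 * (δ' * m) + e2 * (|K| * m) := by
      refine (norm_add_le _ _).trans (add_le_add ?_ ?_)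
      · rw [norm_smul, Real.norm_eq_abs, abs_of_pos hsp']
        exact mul_le_mul hs2 hAB (norm_nonneg _) (by norm_num)
      · rw [norm_smul, Real.norm_eq_abs]
        exact mul_le_mul b2.le (hB.trans (mul_le_mul_of_nonneg_right (le_abs_self K) hm))
          (norm_nonneg _) he2p.le
    have e4 : |β| * (2 * δ') ≤ e / 2 := by
      have : δ' * (4 * (|β| + 1)) ≤ e := (le_div_iff₀ (by positivity)).1 hδ3
      nlinarith [abs_nonneg β]
    have e5 : |β| * (e2 * |K|) ≤ e / 2 := by
      have h6 : e2 ≤ e / (2 * (|β| * |K| + 1)) := min_le_right _ _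
      have : e2 * (2 * (|β| * |K| + 1)) ≤ e := (le_div_iff₀ (by positivity)).1 h6
      nlinarith
    calc |β| * u ^ (β - 1) * ‖s ^ (β - 1) • (A - B) + (s ^ (β - 1) - 1) • B‖
        ≤ |β| * u ^ (β - 1) * (2 * (δ' * m) + e2 * (|K| * m)) := by gcongr
      _ = (|β| * (2 * δ') + |β| * (e2 * |K|)) * (u ^ (β - 1) * m) := by ring
      _ ≤ (e / 2 + e / 2) * (u ^ (β - 1) * m) := by gcongr
      _ = e * u ^ (β - 1) * m := by ring

end Construct

section Construct

variable {E : Type*} [NormedAddCommGroup E] [NormedSpace ℝ E]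

/-- A map `F` of a one-sided neighbourhood `W` of `M`, approximated near each point `p` of `M` by
holomorphic maps `P p` agreeing to third order with each other, together with a
function `ρ` on the target whose power `ρ ^ η` is plurisubharmonic where `ρ > 0`. -/
structure JetData (J : E →L[ℝ] E) (M W : Set E) (ρ : E → ℝ) (η : ℝ) (F : E → E) (P : E → E → E)
    (K c : ℝ) : Prop where
  compact : IsCompact M
  nonempty : M.Nonempty
  pos : ∀ z ∈ W, 0 < infDist z M
  open_W : IsOpen W
  K_nonneg : 0 ≤ K
  c_pos : 0 < c
  smooth : ∀ p ∈ M, ContDiff ℝ 2 (P p)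
  hol : ∀ p ∈ M, ∀ z X, fderiv ℝ (P p) z (J X) = J (fderiv ℝ (P p) z X)
  jet : ∀ e > 0, ∃ t > 0, ∀ p ∈ M, ∀ z, dist z p < t →
    ‖P p z - F z‖ ≤ e * dist z p ∧ ‖fderiv ℝ (P p) z - fderiv ℝ F z‖ ≤ e
  jet3 : ∀ e > 0, ∃ t₀ > 0, ∀ p ∈ M, ∀ p' ∈ M, ∀ z t, t < t₀ → dist z p ≤ t → dist z p' ≤ t →
    ‖P p z - P p' z‖ ≤ e * t ^ 3
  F_diff : ∃ t > 0, ∀ p ∈ M, ∀ z, dist z p < t → DifferentiableAt ℝ F z ∧ ‖fderiv ℝ F z‖ ≤ K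
  ρ_zero : ∀ p ∈ M, ρ (F p) = 0
  ρ_diff : ∃ t > 0, ∀ p ∈ M, ∀ x, dist x (F p) < t → DifferentiableAt ℝ ρ x ∧ ‖fderiv ℝ ρ x‖ ≤ K
  ρ_osc : ∀ e > 0, ∃ t > 0, ∀ p ∈ M, ∀ x y, dist x (F p) < t → dist y (F p) < t →
    ‖fderiv ℝ ρ x - fderiv ℝ ρ y‖ ≤ e
  ρ_psh : ∃ t > 0, ∀ p ∈ M, ∀ x, dist x (F p) < t → 0 < ρ x →
    C2At (fun w => ρ w ^ η) x ∧ ∀ X, 0 ≤ lap J (fun w => ρ w ^ η) x X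
  low : ∃ t > 0, ∀ z ∈ W, infDist z M < t → c * infDist z M ≤ ρ (F z)

variable {J : E →L[ℝ] E} {M W : Set E} {ρ : E → ℝ} {η : ℝ} {F : E → E} {P : E → E → E} {K c : ℝ}

theorem JetData.exists_dist (h : JetData J M W ρ η F P K c) (z : E) :
    ∃ p ∈ M, dist z p = infDist z M := by
  obtain ⟨p, hp, e⟩ := h.compact.exists_infDist_eq_dist h.nonempty z
  exact ⟨p, hp, e.symm⟩

theorem JetData.lipschitz_F (h : JetData J M W ρ η F P K c) :
    ∃ t > 0, ∀ p ∈ M, ∀ z, dist z p < t → dist (F z) (F p) ≤ K * dist z p := by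
  obtain ⟨t, ht, hF⟩ := h.F_diff
  refine ⟨t, ht, fun p hp z hz => ?_⟩
  have := (convex_ball p t).norm_image_sub_le_of_norm_fderiv_le (𝕜 := ℝ) (f := F) (C := K)
    (fun x hx => (hF p hp x hx).1) (fun x hx => (hF p hp x hx).2) (mem_ball_self ht) hz
  rwa [← dist_eq_norm, ← dist_eq_norm] at this

theorem JetData.lipschitz_ρ (h : JetData J M W ρ η F P K c) :
    ∃ t > 0, ∀ p ∈ M, ∀ x y, dist x (F p) < t → dist y (F p) < t → |ρ x - ρ y| ≤ K * ‖x - y‖ := by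
  obtain ⟨t, ht, hF⟩ := h.ρ_diff
  refine ⟨t, ht, fun p hp x y hx hy => ?_⟩
  exact (convex_ball (F p) t).norm_image_sub_le_of_norm_fderiv_le (𝕜 := ℝ) (f := ρ) (C := K)
    (fun x hx => (hF p hp x hx).1) (fun x hx => (hF p hp x hx).2) hy hx

/-- Points near `M` are mapped near `F p` by `F` and by `P p`. -/
theorem JetData.eventually_near (h : JetData J M W ρ η F P K c) {t : ℝ} (ht : 0 < t) :
    ∀ᶠ z in approach M W, ∀ p ∈ M, dist z p ≤ 3 * infDist z M →
      dist (F z) (F p) < t ∧ dist (P p z) (F p) < t := by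
  obtain ⟨t1, ht1, h1⟩ := h.lipschitz_F
  obtain ⟨t2, ht2, h2⟩ := h.jet 1 one_pos
  have hK := h.K_nonneg
  filter_upwards [eventually_approach_lt (t := min (t1 / 3) (min (t2 / 3) (t / (3 * (K + 1)))))
    (by positivity)] with z hz p hp hzp
  rw [lt_min_iff, lt_min_iff] at hz
  obtain ⟨hz1, hz2, hz3⟩ := hz
  rw [lt_div_iff₀ (by positivity)] at hz3
  have a1 := h1 p hp z (by linarith)
  have a2 := (h2 p hp z (by linarith)).1
  have a3 : dist (P p z) (F p) ≤ dist (P p z) (F z) + dist (F z) (F p) := dist_triangle _ _ _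
  rw [dist_eq_norm (P p z) (F z)] at a3
  have a4 : (K + 1) * dist z p < t := by nlinarith
  have a5 := dist_nonneg (x := z) (y := p)
  constructor <;> nlinarith

theorem JetData.eventually_F (h : JetData J M W ρ η F P K c) :
    ∀ᶠ z in approach M W, 0 < ρ (F z) ∧ c * infDist z M ≤ ρ (F z) ∧
      ρ (F z) ≤ K * K * infDist z M ∧ DifferentiableAt ℝ ρ (F z) ∧ DifferentiableAt ℝ F z ∧
      ‖fderiv ℝ ρ (F z)‖ ≤ K ∧ ‖fderiv ℝ F z‖ ≤ K := by
  obtain ⟨t1, ht1, h1⟩ := h.lipschitz_F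
  obtain ⟨t2, ht2, h2⟩ := h.lipschitz_ρ
  obtain ⟨t3, ht3, h3⟩ := h.F_diff
  obtain ⟨t4, ht4, h4⟩ := h.ρ_diff
  obtain ⟨t5, ht5, h5⟩ := h.low
  filter_upwards [h.eventually_near (t := min t2 t4) (by positivity), eventually_approach_lt ht1,
    eventually_approach_lt ht3, eventually_approach_lt ht5, eventually_approach_mem]
    with z hz hz1 hz3 hz5 hzW
  obtain ⟨p, hp, e⟩ := h.exists_dist z
  have hd := h.pos z hzW
  obtain ⟨b1, b2⟩ := hz p hp (by rw [e]; linarith)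
  rw [lt_min_iff] at b1 b2
  have a1 := h1 p hp z (by rwa [e])
  have a2 := h2 p hp (F z) (F p) b1.1 (by simpa using ht2)
  rw [h.ρ_zero p hp, sub_zero, ← dist_eq_norm] at a2
  have a5 := h5 z hzW hz5
  refine ⟨lt_of_lt_of_le (mul_pos h.c_pos hd) a5, a5, ?_, (h4 p hp _ b1.2).1,
    (h3 p hp z (by rwa [e])).1, (h4 p hp _ b1.2).2, (h3 p hp z (by rwa [e])).2⟩
  rw [e] at a1
  calc ρ (F z) ≤ |ρ (F z)| := le_abs_self _
    _ ≤ K * dist (F z) (F p) := a2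
    _ ≤ K * (K * infDist z M) := mul_le_mul_of_nonneg_left a1 h.K_nonneg
    _ = _ := by ring

theorem JetData.eventually_P (h : JetData J M W ρ η F P K c) {e : ℝ} (he : 0 < e) :
    ∀ᶠ z in approach M W, ∀ p ∈ M, dist z p ≤ 3 * infDist z M →
      0 < ρ (P p z) ∧ |ρ (P p z) - ρ (F z)| ≤ e * ρ (F z) ∧ DifferentiableAt ℝ ρ (P p z) ∧
      ‖fderiv ℝ (fun w => ρ (P p w)) z - fderiv ℝ (fun w => ρ (F w)) z‖ ≤ e ∧
      C2At (fun w => ρ w ^ η) (P p z) ∧ ∀ X, 0 ≤ lap J (fun w => ρ w ^ η) (P p z) X := by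
  have hK := h.K_nonneg
  have hc := h.c_pos
  obtain ⟨t2, ht2, h2⟩ := h.lipschitz_ρ
  obtain ⟨t4, ht4, h4⟩ := h.ρ_diff
  obtain ⟨t5, ht5, h5⟩ := h.ρ_psh
  set e1 : ℝ := min (1 / 2) (min (e * c / (6 * (K + 1))) (e / (2 * (K + 1)))) with he1
  have he1p : 0 < e1 := by positivity
  set e' : ℝ := min (1 / 2) e with he'
  have he'p : 0 < e' := by positivity
  obtain ⟨t6, ht6, h6⟩ := h.ρ_osc (e / (2 * (K + 1))) (by positivity)
  obtain ⟨t7, ht7, h7⟩ := h.jet (min (min (1 / 2) e * c / (6 * (K + 1))) (min 1 (e / (2 * (K + 1)))))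
    (by positivity)
  filter_upwards [h.eventually_near (t := min (min t2 t4) (min t5 t6)) (by positivity),
    eventually_approach_lt (t := t7 / 3) (by positivity), h.eventually_F,
    eventually_approach_mem] with z hz hz7 hF hzW p hp hzp
  have hd := h.pos z hzW
  obtain ⟨hF0, hF1, -, hF3, hF4, hF5, hF6⟩ := hF
  obtain ⟨b1, b2⟩ := hz p hp hzp
  simp only [lt_min_iff] at b1 b2
  obtain ⟨a1, a2⟩ := h7 p hp z (by linarith)
  have k1 : ‖P p z - F z‖ ≤ min (1 / 2) e * c / (6 * (K + 1)) * dist z p :=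
    a1.trans (mul_le_mul_of_nonneg_right (min_le_left _ _) dist_nonneg)
  have k2 : ‖fderiv ℝ (P p) z - fderiv ℝ F z‖ ≤ 1 :=
    a2.trans ((min_le_right _ _).trans (min_le_left _ _))
  have k3 : ‖fderiv ℝ (P p) z - fderiv ℝ F z‖ ≤ e / (2 * (K + 1)) :=
    a2.trans ((min_le_right _ _).trans (min_le_right _ _))
  have k4 : |ρ (P p z) - ρ (F z)| ≤ min (1 / 2) e * ρ (F z) := by
    have := h2 p hp (P p z) (F z) b2.1.1 b1.1.1
    have s1 : min (1 / 2) e * c / (6 * (K + 1)) * dist z p ≤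
        min (1 / 2) e * c / (6 * (K + 1)) * (3 * infDist z M) := by gcongr
    have s2 : K * ‖P p z - F z‖ ≤ (K + 1) * (min (1 / 2) e * c / (6 * (K + 1)) * (3 * infDist z M)) :=
      mul_le_mul (by linarith) (k1.trans s1) (norm_nonneg _) (by linarith)
    have s3 : (K + 1) * (min (1 / 2) e * c / (6 * (K + 1)) * (3 * infDist z M)) =
        min (1 / 2) e * (c * infDist z M) / 2 := by
      field_simp; ring
    have s4 : min (1 / 2) e * (c * infDist z M) ≤ min (1 / 2) e * ρ (F z) := by gcongr
    have s5 : 0 < min (1 / 2) e * (c * infDist z M) := by positivity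
    linarith
  have k5 : 0 < ρ (P p z) := by
    have s1 : min (1 / 2) e * ρ (F z) ≤ 1 / 2 * ρ (F z) := by
      gcongr; exact min_le_left _ _
    have := (abs_le.1 k4).1
    linarith
  have hρd := (h4 p hp (P p z) b2.1.2).1
  refine ⟨k5, k4.trans ?_, hρd, ?_, h5 p hp _ b2.2.1 k5⟩
  · gcongr; exact min_le_right _ _
  · have hPd : DifferentiableAt ℝ (P p) z :=
      (h.smooth p hp).differentiable (by norm_num) z
    rw [fderiv_fun_comp z (g := ρ) hρd hPd, fderiv_fun_comp z (g := ρ) hF3 hF4]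
    have eq : (fderiv ℝ ρ (P p z)).comp (fderiv ℝ (P p) z) - (fderiv ℝ ρ (F z)).comp (fderiv ℝ F z) =
        (fderiv ℝ ρ (P p z) - fderiv ℝ ρ (F z)).comp (fderiv ℝ (P p) z) +
        (fderiv ℝ ρ (F z)).comp (fderiv ℝ (P p) z - fderiv ℝ F z) := by
      ext v; simp
    rw [eq]
    have n1 : ‖fderiv ℝ (P p) z‖ ≤ K + 1 := by
      have := norm_le_norm_add_norm_sub' (fderiv ℝ (P p) z) (fderiv ℝ F z)
      linarith
    have n2 := h6 p hp _ _ b2.2.2 b1.2.2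
    calc _ ≤ ‖fderiv ℝ ρ (P p z) - fderiv ℝ ρ (F z)‖ * ‖fderiv ℝ (P p) z‖ +
          ‖fderiv ℝ ρ (F z)‖ * ‖fderiv ℝ (P p) z - fderiv ℝ F z‖ :=
          (norm_add_le _ _).trans (add_le_add (ContinuousLinearMap.opNorm_comp_le _ _)
            (ContinuousLinearMap.opNorm_comp_le _ _))
      _ ≤ e / (2 * (K + 1)) * (K + 1) + (K + 1) * (e / (2 * (K + 1))) := by
          refine add_le_add (mul_le_mul n2 n1 (norm_nonneg _) (by positivity))
            (mul_le_mul (by linarith) k3 (norm_nonneg _) (by positivity))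
      _ = e := by field_simp; ring

end Construct

section Construct

variable {E : Type*} [NormedAddCommGroup E] [NormedSpace ℝ E]

/-- The weighted pullback of `ρ`. -/
noncomputable def weighted (q : E →L[ℝ] E →L[ℝ] ℝ) (ε : ℝ) (ρ : E → ℝ) (F : E → E) (z : E) : ℝ :=
  ρ (F z) * Real.exp (ε * q z z)

/-- The localized weighted pullback of `ρ`. -/
noncomputable def localized (q : E →L[ℝ] E →L[ℝ] ℝ) (ε : ℝ) (ρ : E → ℝ) (P : E → E) (a z : E) : ℝ :=
  ρ (P z) * Real.exp (bump q ε a z)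

variable {J : E →L[ℝ] E} {M W : Set E} {ρ : E → ℝ} {η : ℝ} {F : E → E} {P : E → E → E} {K c : ℝ}
  {q : E →L[ℝ] E →L[ℝ] ℝ} {ε : ℝ}

theorem JetData.exists_norm_le (h : JetData J M W ρ η F P K c) :
    ∃ R ≥ 0, ∀ z, infDist z M < 1 → ‖z‖ ≤ R := by
  obtain ⟨R, hR⟩ := h.compact.isBounded.exists_norm_le
  obtain ⟨p, hp⟩ := h.nonempty
  refine ⟨R + 1, by linarith [norm_nonneg p, hR p hp], fun z hz => ?_⟩
  obtain ⟨p, hp, e⟩ := h.exists_dist z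
  have := norm_le_norm_add_norm_sub' z p
  rw [← dist_eq_norm, e] at this
  linarith [hR p hp]

theorem IsHermitianForm.hasFDerivAt_weighted (hq : IsHermitianForm J q) (ε : ℝ) {z : E}
    (h : DifferentiableAt ℝ (fun w => ρ (F w)) z) :
    HasFDerivAt (weighted q ε ρ F) (Real.exp (ε * q z z) • fderiv ℝ (fun w => ρ (F w)) z +
      weighted q ε ρ F z • ((2 * ε) • q z)) z := by
  have h0 := hq.hasFDerivAt 0 z
  simp only [sub_zero] at h0
  refine (h.hasFDerivAt.mul (h0.const_mul ε).exp).congr_fderiv ?_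
  simp only [weighted]
  module

theorem IsHermitianForm.hasFDerivAt_localized (hq : IsHermitianForm J q) (ε : ℝ) (a : E) {z : E}
    {P : E → E} (h : DifferentiableAt ℝ (fun w => ρ (P w)) z) :
    HasFDerivAt (localized q ε ρ P a) (Real.exp (bump q ε a z) • fderiv ℝ (fun w => ρ (P w)) z +
      localized q ε ρ P a z • ((2 * ε) • q z - ε • q (z - a))) z := by
  refine (h.hasFDerivAt.mul (hq.hasFDerivAt_bump ε a z).exp).congr_fderiv ?_
  simp only [localized]
  module

theorem JetData.eventually_weighted (h : JetData J M W ρ η F P K c) (hq : IsHermitianForm J q)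
    (hε : 0 < ε) : ∃ K' ≥ 0, ∀ᶠ z in approach M W, c * infDist z M ≤ weighted q ε ρ F z ∧
      weighted q ε ρ F z ≤ K' * infDist z M ∧ DifferentiableAt ℝ (weighted q ε ρ F) z ∧
      ‖fderiv ℝ (weighted q ε ρ F) z‖ ≤ K' ∧ Real.exp (ε * q z z) ≤ K' ∧ ‖q z‖ ≤ K' ∧
      ‖fderiv ℝ (fun w => ρ (F w)) z‖ ≤ K' := by
  obtain ⟨R, hR, hzR⟩ := h.exists_norm_le
  have hK := h.K_nonneg
  set C : ℝ := Real.exp (ε * (‖q‖ * R * R)) with hC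
  have hCp : 0 < C := Real.exp_pos _
  have hC1 : 1 ≤ C := Real.one_le_exp (by positivity)
  refine ⟨C * (K * K) + K * K * C * (2 * ε * (‖q‖ * R)) + C + ‖q‖ * R, by positivity, ?_⟩
  filter_upwards [h.eventually_F, eventually_approach_mem, eventually_approach_lt one_pos]
    with z hF hzW hz1
  have hd := h.pos z hzW
  obtain ⟨hF0, hF1, hF2, hF3, hF4, hF5, hF6⟩ := hF
  have hn := hzR z hz1
  have hqz : ‖q z‖ ≤ ‖q‖ * R := (q.le_opNorm z).trans (by gcongr)
  have hqzz : q z z ≤ ‖q‖ * R * R :=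
    (le_abs_self _).trans ((q.le_opNorm₂ z z).trans (by gcongr))
  have hqn : 0 ≤ q z z := le_trans (by positivity) (hq.norm_sq_le z)
  have hE1 : 1 ≤ Real.exp (ε * q z z) := Real.one_le_exp (by positivity)
  have hE2 : Real.exp (ε * q z z) ≤ C := Real.exp_le_exp.2 (by gcongr)
  have hD : DifferentiableAt ℝ (fun w => ρ (F w)) z := DifferentiableAt.fun_comp' z hF3 hF4
  have hDn : ‖fderiv ℝ (fun w => ρ (F w)) z‖ ≤ K * K := by
    rw [fderiv_fun_comp z (g := ρ) hF3 hF4]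
    exact (ContinuousLinearMap.opNorm_comp_le _ _).trans
      (mul_le_mul hF5 hF6 (norm_nonneg _) hK)
  have hu : weighted q ε ρ F z ≤ K * K * C * infDist z M := by
    calc _ ≤ K * K * infDist z M * C := mul_le_mul hF2 hE2 (by positivity) (by positivity)
      _ = _ := by ring
  have hu0 : 0 ≤ weighted q ε ρ F z := by unfold weighted; positivity
  have p1 : 0 ≤ K * K * C * (2 * ε * (‖q‖ * R)) := by positivity
  have p2 : 0 ≤ ‖q‖ * R := by positivity
  have p3 : 0 ≤ C * (K * K) := by positivity
  refine ⟨hF1.trans (le_mul_of_one_le_right hF0.le hE1), ?_, ?_, ?_, by linarith, by linarith,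
    by nlinarith⟩
  · refine hu.trans (mul_le_mul_of_nonneg_right ?_ hd.le); linarith
  · exact (hq.hasFDerivAt_weighted ε hD).differentiableAt
  · rw [(hq.hasFDerivAt_weighted ε hD).fderiv]
    have n1 : ‖Real.exp (ε * q z z) • fderiv ℝ (fun w => ρ (F w)) z‖ ≤ C * (K * K) := by
      rw [norm_smul, Real.norm_eq_abs, Real.abs_exp]
      gcongr
    have n2 : ‖weighted q ε ρ F z • ((2 * ε) • q z)‖ ≤ K * K * C * (2 * ε * (‖q‖ * R)) := by
      rw [norm_smul, norm_smul, Real.norm_eq_abs, Real.norm_eq_abs, abs_of_nonneg hu0,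
        abs_of_pos (by positivity : 0 < 2 * ε)]
      have : weighted q ε ρ F z ≤ K * K * C := hu.trans (mul_le_of_le_one_right (by positivity) hz1.le)
      gcongr
    have := norm_add_le (Real.exp (ε * q z z) • fderiv ℝ (fun w => ρ (F w)) z)
      (weighted q ε ρ F z • ((2 * ε) • q z))
    linarith

set_option maxHeartbeats 800000 in
theorem JetData.eventually_localized (h : JetData J M W ρ η F P K c) (hq : IsHermitianForm J q)
    (hε : 0 < ε) {e : ℝ} (he : 0 < e) : ∀ᶠ z in approach M W, ∀ p ∈ M, ∀ a,
      dist z p ≤ 3 * infDist z M → dist z a ≤ infDist z M →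
      DifferentiableAt ℝ (localized q ε ρ (P p) a) z ∧
      |localized q ε ρ (P p) a z - weighted q ε ρ F z| ≤ e * weighted q ε ρ F z ∧
      ‖fderiv ℝ (localized q ε ρ (P p) a) z - fderiv ℝ (weighted q ε ρ F) z‖ ≤ e := by
  obtain ⟨K', hK', hw⟩ := h.eventually_weighted hq hε
  set δ : ℝ := min (min 1 (e / 2)) (e / (4 * (K' + 1))) with hδ
  have hδp : 0 < δ := by positivity
  set H : ℝ := ε / 2 * ‖q‖ with hH
  have hHn : 0 ≤ H := by positivity
  set KB : ℝ := 2 * ε * K' + ε * ‖q‖ with hKB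
  have hKBn : 0 ≤ KB := by positivity
  filter_upwards [hw, h.eventually_P hδp, h.eventually_F, eventually_approach_mem,
    eventually_approach_lt (t := min 1 (min (e / (2 * (H + 1))) (min (e / (4 * (K' * H * K' + 1)))
      (e / (2 * (4 * K' * KB + 1)))))) (by positivity)] with z hz hP hF hzW hzt p hp a hzp hza
  have hd := h.pos z hzW
  simp only [lt_min_iff] at hzt
  obtain ⟨t1, t2, t3, t4⟩ := hzt
  rw [lt_div_iff₀ (by positivity)] at t2 t3 t4
  obtain ⟨w1, w2, w3, w4, w5, w6, w7⟩ := hz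
  obtain ⟨p1, p2, p3, p4, -, -⟩ := hP p hp hzp
  obtain ⟨hF0, -, -, hF3, hF4, -, -⟩ := hF
  have hPd : DifferentiableAt ℝ (P p) z := (h.smooth p hp).differentiable (by norm_num) z
  have hD1 : DifferentiableAt ℝ (fun w => ρ (P p w)) z := DifferentiableAt.fun_comp' z p3 hPd
  have hD2 : DifferentiableAt ℝ (fun w => ρ (F w)) z := DifferentiableAt.fun_comp' z hF3 hF4
  have d1 := hq.hasFDerivAt_localized ε a hD1
  have d2 := hq.hasFDerivAt_weighted ε hD2
  have hu0 : 0 < weighted q ε ρ F z := by unfold weighted; positivity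
  have hx0 : 0 < localized q ε ρ (P p) a z := by unfold localized; positivity
  set dd := infDist z M
  set E2 := Real.exp (ε * q z z) with hE2
  set E1 := Real.exp (bump q ε a z) with hE1
  have hhn : 0 ≤ q (z - a) (z - a) := le_trans (by positivity) (hq.norm_sq_le _)
  have hh : ε / 2 * q (z - a) (z - a) ≤ H * dd := by
    have : q (z - a) (z - a) ≤ ‖q‖ * dd * dd :=
      (le_abs_self _).trans ((q.le_opNorm₂ _ _).trans (by
        rw [← dist_eq_norm]; gcongr))
    calc ε / 2 * q (z - a) (z - a) ≤ ε / 2 * (‖q‖ * dd * dd) := by gcongr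
      _ = H * dd * dd := by ring
      _ ≤ H * dd := mul_le_of_le_one_right (by positivity) t1.le
  have hE12 : E1 ≤ E2 := Real.exp_le_exp.2 (by
    have := mul_nonneg (half_pos hε).le hhn
    unfold bump; linarith)
  have hEd : |E1 - E2| ≤ E2 * (H * dd) := by
    rw [abs_sub_comm, abs_of_nonneg (by linarith)]
    have e1 : E1 = E2 * Real.exp (-(ε / 2 * q (z - a) (z - a))) := by
      rw [hE1, hE2, ← Real.exp_add]; congr 1
    have := Real.add_one_le_exp (-(ε / 2 * q (z - a) (z - a)))
    have e2 : 0 < E2 := Real.exp_pos _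
    rw [e1]
    have e3 := mul_le_mul_of_nonneg_left this e2.le
    have e4 := mul_le_mul_of_nonneg_left hh e2.le
    linarith
  have hE1p : 0 < E1 := Real.exp_pos _
  have hE2p : 0 < E2 := Real.exp_pos _
  have hu : weighted q ε ρ F z = ρ (F z) * E2 := rfl
  have hx : localized q ε ρ (P p) a z = ρ (P p z) * E1 := rfl
  have cmp : |localized q ε ρ (P p) a z - weighted q ε ρ F z| ≤ (δ + H * dd) * weighted q ε ρ F z := by
    rw [hu, hx]
    have : ρ (P p z) * E1 - ρ (F z) * E2 = (ρ (P p z) - ρ (F z)) * E1 + ρ (F z) * (E1 - E2) := by ring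
    rw [this]
    refine (abs_add_le _ _).trans ?_
    rw [abs_mul, abs_mul, abs_of_pos hE1p, abs_of_pos hF0]
    have s1 : |ρ (P p z) - ρ (F z)| * E1 ≤ δ * ρ (F z) * E2 :=
      mul_le_mul p2 hE12 hE1p.le (by positivity)
    have s2 : ρ (F z) * |E1 - E2| ≤ ρ (F z) * (E2 * (H * dd)) :=
      mul_le_mul_of_nonneg_left hEd hF0.le
    linarith
  have c1 : δ ≤ e / 2 := (min_le_left _ _).trans (min_le_right _ _)
  have c1' : δ ≤ 1 := (min_le_left _ _).trans (min_le_left _ _)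
  have c2 : δ * (4 * (K' + 1)) ≤ e := (le_div_iff₀ (by positivity)).1 (min_le_right _ _)
  refine ⟨d1.differentiableAt, cmp.trans ?_, ?_⟩
  · refine mul_le_mul_of_nonneg_right ?_ hu0.le
    linarith
  rw [d1.fderiv, d2.fderiv]
  set A1 := fderiv ℝ (fun w => ρ (P p w)) z
  set A2 := fderiv ℝ (fun w => ρ (F w)) z
  set x := localized q ε ρ (P p) a z
  set u := weighted q ε ρ F z
  have eq : E1 • A1 + x • ((2 * ε) • q z - ε • q (z - a)) - (E2 • A2 + u • (2 * ε) • q z) =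
      E1 • (A1 - A2) + (E1 - E2) • A2 + ((x - u) • ((2 * ε) • q z) - (x * ε) • q (z - a)) := by
    module
  rw [eq]
  clear_value x u A1 A2 E1 E2 dd δ H
  have n1 : ‖E1 • (A1 - A2)‖ ≤ K' * δ := by
    rw [norm_smul, Real.norm_eq_abs, abs_of_pos hE1p]
    exact mul_le_mul (hE12.trans w5) p4 (norm_nonneg _) hK'
  have n2 : ‖(E1 - E2) • A2‖ ≤ K' * (H * dd) * K' := by
    rw [norm_smul, Real.norm_eq_abs]
    refine mul_le_mul (hEd.trans ?_) w7 (norm_nonneg _) (by positivity)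
    gcongr
  have hxle : x ≤ (δ + 1) * u := by
    have h1 : ρ (P p z) ≤ (δ + 1) * ρ (F z) := by have := (abs_le.1 p2).2; linarith
    calc x = ρ (P p z) * E1 := hx
      _ ≤ (δ + 1) * ρ (F z) * E2 := mul_le_mul h1 hE12 hE1p.le (by positivity)
      _ = _ := by rw [hu]; ring
  have hx2 : x ≤ 2 * u := hxle.trans (by gcongr; linarith)
  have hxu2 : |x - u| ≤ 2 * u := by
    rw [abs_le]; constructor <;> linarith
  have n3 : ‖(x - u) • ((2 * ε) • q z)‖ ≤ 2 * (K' * dd) * (2 * ε * K') := by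
    rw [norm_smul, norm_smul, Real.norm_eq_abs, Real.norm_eq_abs, abs_of_pos (by positivity : 0 < 2 * ε)]
    have : |x - u| ≤ 2 * (K' * dd) := hxu2.trans (by gcongr)
    gcongr
  have n4 : ‖(x * ε) • q (z - a)‖ ≤ 2 * (K' * dd) * (ε * ‖q‖) := by
    rw [norm_smul, Real.norm_eq_abs, abs_of_pos (mul_pos hx0 hε), mul_assoc]
    have : ‖q (z - a)‖ ≤ ‖q‖ * 1 := by
      refine (q.le_opNorm _).trans ?_
      rw [← dist_eq_norm]
      exact mul_le_mul_of_nonneg_left (hza.trans t1.le) (norm_nonneg _)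
    rw [mul_one] at this
    have : x ≤ 2 * (K' * dd) := hx2.trans (by gcongr)
    gcongr
  have n5 := norm_add_le (E1 • (A1 - A2) + (E1 - E2) • A2)
    ((x - u) • ((2 * ε) • q z) - (x * ε) • q (z - a))
  have n6 := norm_add_le (E1 • (A1 - A2)) ((E1 - E2) • A2)
  have n7 := norm_sub_le ((x - u) • ((2 * ε) • q z)) ((x * ε) • q (z - a))
  have f1 : K' * δ ≤ e / 4 := by linarith
  have f2 : K' * (H * dd) * K' ≤ e / 4 := by linarith
  have f3 : 2 * (K' * dd) * (2 * ε * K') + 2 * (K' * dd) * (ε * ‖q‖) ≤ e / 2 := by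
    have : 2 * (K' * dd) * (2 * ε * K') + 2 * (K' * dd) * (ε * ‖q‖) = 2 * K' * KB * dd := by
      rw [hKB]; ring
    rw [this]
    have : 0 ≤ K' * KB * dd := by positivity
    linarith
  linarith

end Construct

section Construct

theorem pow_lt_mul_rpow {β C d : ℝ} {N : ℕ} (hN : β + 1 ≤ N) (hd : 0 < d) (hd1 : d < 1)
    (hdC : d < C) : d ^ N < C * d ^ β := by
  rw [← Real.rpow_natCast]
  calc d ^ (N : ℝ) ≤ d ^ (β + 1) := Real.rpow_le_rpow_of_exponent_ge hd hd1.le hN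
    _ = d * d ^ β := by rw [Real.rpow_add hd, Real.rpow_one, mul_comm]
    _ < C * d ^ β := mul_lt_mul_of_pos_right hdC (Real.rpow_pos_of_pos hd β)

theorem exists_gap {β κ c : ℝ} {N : ℕ} (hβ : 0 < β) (hκ : 0 < κ) (hc : 0 < c) (hN : β + 3 ≤ N) :
    ∃ t > 0, ∀ d x y : ℝ, 0 < d → d < t → 0 ≤ x → c * d ≤ y → x ≤ y * Real.exp (-(κ * d ^ 2)) →
      x ^ β + d ^ N < y ^ β := by
  refine ⟨min 1 (min (1 / (κ * β)) (c ^ β * (κ * β / 2))), by positivity, ?_⟩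
  intro d x y hd hdt hx hy hxy
  simp only [lt_min_iff] at hdt
  obtain ⟨h1, h2, h3⟩ := hdt
  rw [lt_div_iff₀ (by positivity)] at h2
  have hy0 : 0 < y := lt_of_lt_of_le (by positivity) hy
  set s : ℝ := κ * β * d ^ 2 with hs
  have hs0 : 0 < s := by positivity
  have hs1 : s ≤ 1 := by
    have : d * (d * (κ * β)) ≤ 1 * 1 := mul_le_mul h1.le h2.le (by positivity) (by norm_num)
    rw [hs]; linarith
  have e1 : x ^ β ≤ y ^ β * Real.exp (-s) := by
    refine (Real.rpow_le_rpow hx hxy hβ.le).trans_eq ?_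
    rw [Real.mul_rpow hy0.le (Real.exp_pos _).le, ← Real.exp_mul]
    congr 2; rw [hs]; ring
  have e2 : Real.exp (-s) ≤ 1 - s / 2 := by
    rw [Real.exp_neg]
    have := Real.add_one_le_exp s
    rw [inv_le_comm₀ (Real.exp_pos _) (by linarith)]
    refine le_trans ?_ this
    rw [inv_le_comm₀ (by linarith) (by linarith), inv_eq_one_div, div_le_iff₀ (by linarith)]
    nlinarith
  have hyβ := Real.rpow_pos_of_pos hy0 β
  have e3 : d ^ N < c ^ β * (κ * β / 2) * d ^ (β + 2) :=
    pow_lt_mul_rpow (by linarith) hd h1 h3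
  have e4 : c ^ β * (κ * β / 2) * d ^ (β + 2) ≤ y ^ β * (s / 2) := by
    rw [Real.rpow_add hd, hs]
    have : (c * d) ^ β ≤ y ^ β := Real.rpow_le_rpow (by positivity) hy hβ.le
    rw [Real.mul_rpow hc.le hd.le] at this
    have h2 : d ^ (2 : ℝ) = d ^ 2 := by norm_num
    rw [h2]
    calc c ^ β * (κ * β / 2) * (d ^ β * d ^ 2) = c ^ β * d ^ β * (κ * β * d ^ 2 / 2) := by ring
      _ ≤ _ := mul_le_mul_of_nonneg_right this (by positivity)
  have e5 := mul_le_mul_of_nonneg_left e2 hyβ.le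
  linarith

variable {E : Type*} [NormedAddCommGroup E] [NormedSpace ℝ E]
variable {J : E →L[ℝ] E} {M W : Set E} {ρ : E → ℝ} {η : ℝ} {F : E → E} {P : E → E → E} {K c : ℝ}
  {q : E →L[ℝ] E →L[ℝ] ℝ} {ε : ℝ}

theorem JetData.eventually_separated (h : JetData J M W ρ η F P K c) (hq : IsHermitianForm J q)
    (hε : 0 < ε) : ∃ δ > 0, δ < 1 / 8 ∧ ∃ κ > 0, ∀ᶠ z in approach M W, ∀ p ∈ M, ∀ p' ∈ M, ∀ a a',
      dist z p ≤ 3 * infDist z M → dist z p' ≤ 3 * infDist z M → infDist z M / 18 ≤ dist z a →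
      dist z a' ≤ δ * (4 / 3 * infDist z M) →
      localized q ε ρ (P p) a z ≤
        localized q ε ρ (P p') a' z * Real.exp (-(κ * infDist z M ^ 2)) := by
  obtain ⟨t2, ht2, h2⟩ := h.lipschitz_ρ
  have hK := h.K_nonneg
  have hc := h.c_pos
  set e1 : ℝ := ε / 2592 with he1
  have he1p : 0 < e1 := by positivity
  obtain ⟨t3, ht3, h3⟩ := h.jet3 (e1 * c / (54 * (K + 1))) (by positivity)
  set δ : ℝ := min (1 / 9) (1 / (1296 * (‖q‖ + 1))) with hδ
  have hδp : 0 < δ := by positivity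
  refine ⟨δ, hδp, (min_le_left _ _).trans_lt (by norm_num), ε / 2592, by positivity, ?_⟩
  filter_upwards [h.eventually_near (t := t2 / 3) (by positivity), eventually_approach_lt (t := t3 / 3) (by positivity),
    h.eventually_P (e := 1 / 2) (by norm_num), h.eventually_F, eventually_approach_mem]
    with z hn hz3 hP hF hzW p hp p' hp' a a' hzp hzp' hza hza'
  have hd := h.pos z hzW
  obtain ⟨hF0, hF1, -⟩ := hF
  obtain ⟨b1, b2⟩ := hn p hp hzp
  obtain ⟨b1', b2'⟩ := hn p' hp' hzp'
  obtain ⟨P0, P1, -⟩ := hP p hp hzp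
  obtain ⟨P0', P1', -⟩ := hP p' hp' hzp'
  have k1 := h3 p hp p' hp' z (3 * infDist z M) (by linarith) hzp hzp'
  set d := infDist z M with hdd
  have hρ : ρ (P p z) ≤ ρ (P p' z) * Real.exp (e1 * d ^ 2) := by
    have m1 : ρ (P p z) - ρ (P p' z) ≤ e1 * d ^ 2 * (c * d) / 2 := by
      rcases le_or_gt (ρ (P p z) - ρ (P p' z)) 0 with hle | hgt
      · exact hle.trans (by positivity)
      have b3 : |ρ (P p z) - ρ (P p' z)| ≤ K * ‖P p z - P p' z‖ := by
        refine h2 p hp _ _ (by linarith) ?_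
        have d1 := dist_triangle4 (P p' z) (F p') (F z) (F p)
        rw [dist_comm (F p')] at d1
        linarith
      calc ρ (P p z) - ρ (P p' z) ≤ K * ‖P p z - P p' z‖ := (le_abs_self _).trans b3
        _ ≤ (K + 1) * (e1 * c / (54 * (K + 1)) * (3 * d) ^ 3) :=
          mul_le_mul (by linarith) k1 (norm_nonneg _) (by linarith)
        _ = e1 * d ^ 2 * (c * d) / 2 := by field_simp; ring
    have m2 : ρ (F z) / 2 ≤ ρ (P p' z) := by have := (abs_le.1 P1').1; linarith
    have m3 : e1 * d ^ 2 * (c * d) / 2 ≤ e1 * d ^ 2 * ρ (P p' z) := by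
      rw [mul_div_assoc]
      exact mul_le_mul_of_nonneg_left (by linarith) (by positivity)
    have m4 := mul_le_mul_of_nonneg_left (Real.add_one_le_exp (e1 * d ^ 2)) P0'.le
    linarith
  have hQ : d ^ 2 / 324 ≤ q (z - a) (z - a) := by
    refine le_trans ?_ (hq.norm_sq_le _)
    rw [← dist_eq_norm]
    nlinarith [dist_nonneg (x := z) (y := a)]
  have hQ' : q (z - a') (z - a') ≤ d ^ 2 / 648 := by
    have := (le_abs_self _).trans (q.le_opNorm₂ (z - a') (z - a'))
    refine this.trans ?_
    rw [← dist_eq_norm]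
    have n1 : ‖q‖ * dist z a' * dist z a' ≤ (‖q‖ + 1) * (δ * (4 / 3 * d)) * (δ * (4 / 3 * d)) := by
      gcongr; linarith
    refine n1.trans ?_
    have n2 : δ * (1296 * (‖q‖ + 1)) ≤ 1 := (le_div_iff₀ (by positivity)).1 (min_le_right _ _)
    have n3 : δ ≤ 1 / 9 := min_le_left _ _
    have n4 : δ * (1296 * (‖q‖ + 1)) * (δ * d ^ 2) ≤ 1 * (1 / 9 * d ^ 2) := by gcongr
    have : 0 ≤ d ^ 2 := by positivity
    nlinarith
  unfold localized
  rw [mul_assoc, ← Real.exp_add]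
  calc ρ (P p z) * Real.exp (bump q ε a z)
      ≤ ρ (P p' z) * Real.exp (e1 * d ^ 2) * Real.exp (bump q ε a z) := by gcongr
    _ = ρ (P p' z) * Real.exp (e1 * d ^ 2 + bump q ε a z) := by rw [mul_assoc, Real.exp_add]
    _ ≤ _ := by
      refine mul_le_mul_of_nonneg_left (Real.exp_le_exp.2 ?_) P0'.le
      unfold bump
      have := mul_le_mul_of_nonneg_left hQ (half_pos hε).le
      have := mul_le_mul_of_nonneg_left hQ' (half_pos hε).le
      rw [he1]
      linarith

end Construct

section Construct

variable {E : Type*} [NormedAddCommGroup E] [NormedSpace ℝ E]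
variable {J : E →L[ℝ] E} {M W : Set E} {ρ : E → ℝ} {η η' : ℝ} {F : E → E} {P : E → E → E}
  {K c : ℝ} {q : E →L[ℝ] E →L[ℝ] ℝ}

theorem JetData.eventually_localized_psh (h : JetData J M W ρ η F P K c) (hq : IsHermitianForm J q)
    (hη : 0 < η) (hη' : η < η') : ∃ ε > 0, ∀ᶠ z in approach M W, ∀ p ∈ M, ∀ a,
      dist z p ≤ 3 * infDist z M → dist z a ≤ infDist z M →
      C2At (fun w => localized q ε ρ (P p) a w ^ η') z ∧
      ∀ X, X ≠ 0 → 0 < lap J (fun w => localized q ε ρ (P p) a w ^ η') z X := by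
  obtain ⟨R, hR, hzR⟩ := h.exists_norm_le
  set B : ℝ := ‖q‖ * (2 * R + 1) with hB
  have hη'0 : 0 < η' := hη.trans hη'
  have hg : 0 < η' / η - 1 := by rw [sub_pos, lt_div_iff₀ hη]; linarith
  set ε : ℝ := (η' / η - 1) / (2 * (η' * B ^ 2 + 1)) with hε
  have hεp : 0 < ε := by positivity
  refine ⟨ε, hεp, ?_⟩
  filter_upwards [h.eventually_P one_pos, eventually_approach_lt one_pos]
    with z hP hz1 p hp a hzp hza
  obtain ⟨P0, -, P2, -, P4, P5⟩ := hP p hp hzp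
  refine hq.lap_local_pos (B := B) (h.smooth p hp) (h.hol p hp) hη hη' P0 P2.continuousAt P4 P5 hεp
    ?_ ?_
  · rw [← dist_eq_norm]
    have := hzR z hz1
    rw [hB]; gcongr; linarith
  · rw [hε, div_mul_eq_mul_div, div_lt_iff₀ (by positivity)]
    have : 0 ≤ η' * B ^ 2 := by positivity
    nlinarith

set_option maxHeartbeats 1000000 in
/-- Gluing the local models yields a function whose `η'`-th power is strictly plurisubharmonic
and which is tangent to the weighted pullback of `ρ` along `M`. -/
theorem JetData.exists_glued [ProperSpace E] (h : JetData J M W ρ η F P K c)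
    (hq : IsHermitianForm J q) (hη : 0 < η) (hη' : η < η') : ∃ ε > 0, ∃ Φ : E → ℝ, ∀ e > 0,
      ∀ᶠ z in approach M W, C2At Φ z ∧ (∀ X, X ≠ 0 → 0 < lap J Φ z X) ∧
        |Φ z - weighted q ε ρ F z ^ η'| ≤ e * weighted q ε ρ F z ^ η' ∧
        ‖fderiv ℝ Φ z - (η' * weighted q ε ρ F z ^ (η' - 1)) • fderiv ℝ (weighted q ε ρ F) z‖ ≤
          e * weighted q ε ρ F z ^ (η' - 1) := by
  have hη'0 : 0 < η' := hη.trans hη'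
  have hc := h.c_pos
  obtain ⟨ε, hε, hpsh⟩ := h.eventually_localized_psh hq hη hη'
  obtain ⟨δ, hδ, hδ8, κ, hκ, hsep⟩ := h.eventually_separated hq hε
  obtain ⟨K', hK', hw⟩ := h.eventually_weighted hq hε
  obtain ⟨a, s, hs0, hs, hcov, hfin⟩ := exists_whitney_net (W := W) h.compact h.nonempty hδ
  choose p hpM hpd using fun k => h.exists_dist (a k)
  obtain ⟨N, hN⟩ := exists_nat_ge (η' + 3)
  obtain ⟨t₀, ht₀, hgap⟩ := exists_gap hη'0 hκ (half_pos hc) hN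
  set ψ : ℕ → E → ℝ := fun k z => localized q ε ρ (P (p k)) (a k) z ^ η' with hψ
  set T : ℕ → Set E := fun k => ball (a k) (s k / 8) with hT
  set tol : ℕ → ℝ := fun k => (3 / 4 * (if 0 < s k then s k else 1)) ^ N * (1 / 2) ^ k / 4 with htol
  have htolp : ∀ k, 0 < tol k := by
    intro k
    simp only [htol]
    split_ifs <;> positivity
  refine ⟨ε, hε, glue ψ T tol, fun e he => ?_⟩
  obtain ⟨δ₁, hδ₁, hδ₁', hpow⟩ := exists_power_close (E := E) η' K' (half_pos he)
  obtain ⟨δ₂, hδ₂, hδ₂', hpow₂⟩ := exists_power_close (E := E) η' K' (e := 1 / 2) (by norm_num)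
  filter_upwards [hpsh, hsep, hw, h.eventually_localized hq hε hδ₁, h.eventually_localized hq hε hδ₂,
    h.eventually_localized hq hε (e := 1 / 2) (by norm_num), eventually_approach_mem,
    eventually_approach_lt (t := min (min 1 t₀) (min (1 / 2 * c ^ η') (e / 2 * c ^ η')))
    (by positivity)]
    with z hpsh hsep hw hl1 hl2 hl3 hzW hzt
  have hd := h.pos z hzW
  simp only [lt_min_iff] at hzt
  obtain ⟨⟨z1, z2⟩, z3, z4⟩ := hzt
  obtain ⟨w1, -, w3, w4, -⟩ := hw
  set d := infDist z M with hdd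
  set u := weighted q ε ρ F z with hu
  have hu0 : 0 < u := lt_of_lt_of_le (by positivity) w1
  have huη : c ^ η' * d ^ η' ≤ u ^ η' := by
    rw [← Real.mul_rpow hc.le hd.le]
    exact Real.rpow_le_rpow (by positivity) w1 hη'0.le
  have hdN1 : d ^ N < 1 / 2 * u ^ η' := by
    have := pow_lt_mul_rpow (β := η') (N := N) (by linarith) hd z1 z3
    linarith
  have hdN2 : d ^ N < e / 2 * u ^ η' := by
    have := pow_lt_mul_rpow (β := η') (N := N) (by linarith) hd z1 z4
    have := mul_le_mul_of_nonneg_left huη (half_pos he).le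
    linarith
  -- geometry of the cover
  have geo : ∀ k, 0 < s k → dist z (a k) ≤ s k / 4 → 3 / 4 * s k ≤ d ∧ d ≤ 9 / 4 * s k ∧
      dist z (p k) ≤ 3 * d ∧ dist z (a k) ≤ d := by
    intro k hk hz
    obtain ⟨-, g1, g2, -⟩ := hs k hk
    have g3 := infDist_le_infDist_add_dist (x := z) (y := a k) (s := M)
    have g4 := infDist_le_infDist_add_dist (x := a k) (y := z) (s := M)
    rw [dist_comm] at g4
    have g5 := dist_triangle z (a k) (p k)
    rw [hpd] at g5
    refine ⟨by linarith, by linarith, by linarith, by linarith⟩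
  have hF := hfin (4 * d / 17) (by positivity)
  set S : Finset ℕ := {k ∈ hF.toFinset | dist z (a k) ≤ s k / 4} with hSdef
  have memS : ∀ k, k ∈ S ↔ 4 * d / 17 ≤ s k ∧ dist z (a k) ≤ s k / 4 := by
    intro k; simp [hSdef]
  have hSs : ∀ k ∈ S, 0 < s k ∧ dist z (a k) ≤ s k / 4 := fun k hk =>
    ⟨lt_of_lt_of_le (by positivity) ((memS k).1 hk).1, ((memS k).1 hk).2⟩
  have memS' : ∀ k, 0 < s k → dist z (a k) ≤ s k / 4 → k ∈ S := by
    intro k hk hz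
    obtain ⟨-, g2, -⟩ := geo k hk hz
    exact (memS k).2 ⟨by linarith, hz⟩
  obtain ⟨i, hsi, hzi⟩ := hcov z hzW hd z1.le
  have hi : i ∈ S := memS' i hsi (by nlinarith)
  have hψe : ∀ k ∈ S, |ψ k z - u ^ η'| ≤ e / 2 * u ^ η' ∧ |ψ k z - u ^ η'| ≤ 1 / 2 * u ^ η' ∧
      ‖fderiv ℝ (ψ k) z - (η' * u ^ (η' - 1)) • fderiv ℝ (weighted q ε ρ F) z‖ ≤
        e / 2 * u ^ (η' - 1) := by
    intro k hk
    obtain ⟨-, -, g3, g4⟩ := geo k (hSs k hk).1 (hSs k hk).2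
    obtain ⟨m1, m2, m3⟩ := hl1 (p k) (hpM k) (a k) g3 g4
    obtain ⟨-, n2, n3⟩ := hl2 (p k) (hpM k) (a k) g3 g4
    obtain ⟨r1, r2, r3⟩ := hpow _ u 1 _ _ hu0 m2 (by simpa using m3) (by simpa using w4) zero_le_one
    obtain ⟨-, r4, -⟩ := hpow₂ _ u 1 _ _ hu0 n2 (by simpa using n3) (by simpa using w4) zero_le_one
    refine ⟨r2, r4, ?_⟩
    have : HasFDerivAt (ψ k) _ z := m1.hasFDerivAt.rpow_const (p := η') (Or.inl r1.ne')
    rw [this.fderiv]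
    simpa using r3
  clear_value u d
  have huηp := Real.rpow_pos_of_pos hu0 η'
  have htold : ∀ k ∈ S, tol k ≤ d ^ N / 4 * (1 / 2) ^ k := by
    intro k hk
    obtain ⟨g1, -⟩ := geo k (hSs k hk).1 (hSs k hk).2
    simp only [htol, if_pos (hSs k hk).1]
    have h1 : (3 / 4 * s k) ^ N ≤ d ^ N := pow_le_pow_left₀ (by linarith [hs0 k]) g1 N
    have h2 : (0 : ℝ) < (1 / 2) ^ k := by positivity
    have h3 := mul_le_mul_of_nonneg_right h1 h2.le
    linarith
  have hsum : 2 * ∑ k ∈ S, tol k ≤ d ^ N := by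
    have h1 : ∑ k ∈ S, ((1 : ℝ) / 2) ^ k ≤ 2 := by
      exact (summable_geometric_two.sum_le_tsum S fun _ _ => by positivity).trans_eq
        tsum_geometric_two
    have h2 : ∑ k ∈ S, tol k ≤ d ^ N / 4 * ∑ k ∈ S, ((1 : ℝ) / 2) ^ k := by
      rw [Finset.mul_sum]
      exact Finset.sum_le_sum htold
    have h3 := mul_le_mul_of_nonneg_left h1 (by positivity : 0 ≤ d ^ N / 4)
    linarith
  have hzM : ∀ k ∉ S, ∀ᶠ w in 𝓝 z, w ∉ ball (a k) (s k / 8) := by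
    intro k hk
    rcases lt_or_ge 0 (s k) with hsk | hsk
    · have : s k / 4 < dist z (a k) := lt_of_not_ge fun hle => hk (memS' k hsk hle)
      have hc : ContinuousAt (fun w => dist w (a k)) z := by fun_prop
      filter_upwards [hc.eventually (lt_mem_nhds this)] with w hw hwb
      rw [mem_ball] at hwb
      linarith
    · refine Eventually.of_forall fun w hw => ?_
      have := (mem_ball.1 hw).trans_le (by linarith : s k / 8 ≤ 0)
      exact absurd dist_nonneg (not_le.2 this)
  have hS : ∀ᶠ w in 𝓝 z, ∀ k, k ∉ S → w ∉ T k := by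
    have h1 : ∀ᶠ w in 𝓝 z, ∀ k ∈ hF.toFinset, k ∉ S → w ∉ T k := by
      rw [Filter.eventually_all_finset]
      intro k _
      by_cases hk : k ∈ S
      · exact Eventually.of_forall fun w h => absurd hk h
      · filter_upwards [hzM k hk] with w hw _ using hw
    filter_upwards [h1, ball_mem_nhds z (half_pos hd)] with w hw hwz k hk hwT
    by_cases hkF : k ∈ hF.toFinset
    · exact hw k hkF hk hwT
    · have hsk : 0 < s k := by
        have := pos_of_mem_ball hwT
        linarith
      obtain ⟨-, -, g2, -⟩ := hs k hsk
      have g3 := infDist_le_infDist_add_dist (x := w) (y := a k) (s := M)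
      have g4 := infDist_le_infDist_add_dist (x := z) (y := w) (s := M)
      rw [mem_ball] at hwz hwT
      rw [dist_comm] at g4
      apply hkF
      simp only [Finite.mem_toFinset, mem_ofPred_eq]
      linarith
  obtain ⟨gi1, gi2, gi3, gi4⟩ := geo i (hSs i hi).1 (hSs i hi).2
  have hiT : T i ∈ 𝓝 z := isOpen_ball.mem_nhds (by rw [mem_ball]; nlinarith)
  have hl : ∀ l ∈ S, T l ∈ 𝓝 z ∨ ψ l z + d ^ N < ψ i z := by
    intro l hlS
    by_cases hzl : z ∈ T l
    · exact Or.inl (isOpen_ball.mem_nhds hzl)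
    · right
      obtain ⟨g1, g2, g3, g4⟩ := geo l (hSs l hlS).1 (hSs l hlS).2
      have hzl' : s l / 8 ≤ dist z (a l) := by simpa [hT] using hzl
      have sep := hsep (p l) (hpM l) (p i) (hpM i) (a l) (a i) g3 gi3 (by linarith)
        (hzi.le.trans (by gcongr; linarith))
      obtain ⟨-, m2, -⟩ := hl3 (p l) (hpM l) (a l) g3 g4
      obtain ⟨-, n2, -⟩ := hl3 (p i) (hpM i) (a i) gi3 gi4
      have m3 := (abs_le.1 m2).1
      have n3 := (abs_le.1 n2).1
      exact hgap d _ _ hd z2 (by linarith) (by linarith) sep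
  obtain ⟨r1, r2, r3⟩ := glue_props J htolp (fun k hk => (hpsh (p k) (hpM k) (a k)
      (geo k (hSs k hk).1 (hSs k hk).2).2.2.1 (geo k (hSs k hk).1 (hSs k hk).2).2.2.2).1)
    (fun k hk => (hpsh (p k) (hpM k) (a k)
      (geo k (hSs k hk).1 (hSs k hk).2).2.2.1 (geo k (hSs k hk).1 (hSs k hk).2).2.2.2).2)
    (fun k hk => by
      have h1 := htold k hk
      have h2 : ((1 : ℝ) / 2) ^ k ≤ 1 := pow_le_one₀ (by norm_num) (by norm_num)
      have h3 := (abs_le.1 (hψe k hk).2.1).1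
      have h4 : 0 < d ^ N := by positivity
      have h5 : d ^ N / 4 * (1 / 2) ^ k ≤ d ^ N / 4 * 1 := by gcongr
      change tol k < ψ k z
      linarith) hS hsum hi hiT hl
  obtain ⟨f1, f2, f3⟩ := r3 ((1 - e / 2) * u ^ η') ((1 + e / 2) * u ^ η')
    ((η' * u ^ (η' - 1)) • fderiv ℝ (weighted q ε ρ F) z) (e / 2 * u ^ (η' - 1)) (fun k hk => by
      obtain ⟨h1, -, h3⟩ := hψe k hk
      have h4 := abs_le.1 h1
      exact ⟨by linarith [h4.1], by linarith [h4.2], h3⟩)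
  refine ⟨r1, r2, ?_, f3.trans ?_⟩
  · rw [abs_le]
    have := mul_pos he huηp
    constructor <;> linarith
  · have := mul_pos he (Real.rpow_pos_of_pos hu0 (η' - 1))
    linarith

end Construct

section Construct

variable {E : Type*} [NormedAddCommGroup E]

theorem eventually_nhdsSet_of_approach {M W : Set E} {Q : E → Prop}
    (h : ∀ᶠ z in approach M W, Q z) : ∀ᶠ z in 𝓝ˢ M, z ∈ W → Q z := by
  obtain ⟨t, ht, h⟩ := eventually_approach.1 h
  have : {z | infDist z M < t} ∈ 𝓝ˢ M :=
    (isOpen_Iio.preimage (continuous_infDist_pt M)).mem_nhdsSet.2 fun z hz => by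
      simpa [infDist_zero_of_mem hz] using ht
  filter_upwards [this] with z hz hzW using h z hzW hz

variable [NormedSpace ℝ E]
variable {J : E →L[ℝ] E} {M W : Set E} {ρ : E → ℝ} {η η' : ℝ} {F : E → E} {P : E → E → E}
  {K c : ℝ} {q : E →L[ℝ] E →L[ℝ] ℝ}

theorem JetData.exists_root [ProperSpace E] (h : JetData J M W ρ η F P K c)
    (hq : IsHermitianForm J q) (hη : 0 < η) (hη' : η < η') : ∃ ε > 0, ∃ w : E → ℝ,
      (∀ᶠ z in approach M W, 0 < w z ∧ C2At w z ∧ C2At (fun x => w x ^ η') z ∧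
        ∀ X, X ≠ 0 → 0 < lap J (fun x => w x ^ η') z X) ∧
      ∀ e > 0, ∀ᶠ z in approach M W, |w z - weighted q ε ρ F z| ≤ e * infDist z M ∧
        ‖fderiv ℝ w z - fderiv ℝ (weighted q ε ρ F) z‖ ≤ e := by
  have hη'0 : 0 < η' := hη.trans hη'
  obtain ⟨ε, hε, Φ, hΦ⟩ := h.exists_glued hq hη hη'
  obtain ⟨K', hK', hw⟩ := h.eventually_weighted hq hε
  have pos : ∀ᶠ z in approach M W, 0 < Φ z := by
    filter_upwards [hΦ (1 / 2) (by norm_num), hw, eventually_approach_mem] with z hz hw hzW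
    have hu0 : 0 < weighted q ε ρ F z :=
      lt_of_lt_of_le (mul_pos h.c_pos (h.pos z hzW)) hw.1
    have := Real.rpow_pos_of_pos hu0 η'
    have := (abs_le.1 hz.2.2.1).1
    linarith
  refine ⟨ε, hε, fun z => Φ z ^ (1 / η'), ?_, ?_⟩
  · filter_upwards [pos, hΦ 1 one_pos] with z hz hΦz
    obtain ⟨h1, h2, -⟩ := hΦz
    have e : (fun x => (Φ x ^ (1 / η')) ^ η') =ᶠ[𝓝 z] Φ := by
      filter_upwards [h1.differentiableAt.continuousAt.eventually (lt_mem_nhds hz)] with x hx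
      rw [← Real.rpow_mul hx.le, one_div_mul_cancel hη'0.ne', Real.rpow_one]
    refine ⟨Real.rpow_pos_of_pos hz _, ?_, h1.congr e, fun X hX => ?_⟩
    · exact C2At.comp (v := fun s : ℝ => s ^ (1 / η'))
        (Real.contDiffAt_rpow_const_of_ne hz.ne').c2At h1
    · rw [lap_congr J e]; exact h2 X hX
  · intro e he
    set e' : ℝ := e / (K' + 1) with he'
    have he'p : 0 < e' := by positivity
    obtain ⟨δ₁, hδ₁, hδ₁1, hp⟩ := exists_power_close (E := E) (1 / η') (η' * K')
      (lt_min he he'p)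
    filter_upwards [pos, hΦ δ₁ hδ₁, hw, eventually_approach_mem] with z hz hΦz hw hzW
    obtain ⟨h1, -, h3, h4⟩ := hΦz
    obtain ⟨w1, w2, w3, w4, -⟩ := hw
    have hd := h.pos z hzW
    set u := weighted q ε ρ F z
    have hu0 : 0 < u := lt_of_lt_of_le (mul_pos h.c_pos hd) w1
    have hup := Real.rpow_pos_of_pos hu0 (η' - 1)
    obtain ⟨-, r2, r3⟩ := hp (Φ z) (u ^ η') (u ^ (η' - 1)) _ _ (Real.rpow_pos_of_pos hu0 _) h3 h4
      (by
        rw [norm_smul, Real.norm_eq_abs, abs_of_pos (by positivity)]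
        calc η' * u ^ (η' - 1) * ‖fderiv ℝ (weighted q ε ρ F) z‖ ≤ η' * u ^ (η' - 1) * K' := by
              gcongr
          _ = _ := by ring) hup.le
    have k1 : (u ^ η') ^ (1 / η') = u := by
      rw [← Real.rpow_mul hu0.le, mul_one_div_cancel hη'0.ne', Real.rpow_one]
    have k2 : (u ^ η') ^ (1 / η' - 1) * u ^ (η' - 1) = 1 := by
      rw [← Real.rpow_mul hu0.le, ← Real.rpow_add hu0]
      have : η' * (1 / η' - 1) + (η' - 1) = 0 := by field_simp; ring
      rw [this, Real.rpow_zero]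
    constructor
    · rw [k1] at r2
      refine r2.trans ?_
      have : min e e' * u ≤ e' * (K' * infDist z M) :=
        mul_le_mul (min_le_right _ _) w2 hu0.le he'p.le
      refine this.trans ?_
      have : e' * K' ≤ e := by
        rw [he', div_mul_eq_mul_div, div_le_iff₀ (by positivity)]; nlinarith
      rw [← mul_assoc]
      gcongr
    · have hf : HasFDerivAt (fun z => Φ z ^ (1 / η')) _ z :=
        h1.differentiableAt.hasFDerivAt.rpow_const (p := 1 / η') (Or.inl hz.ne')
      rw [hf.fderiv]
      have k3 : (1 / η' * (u ^ η') ^ (1 / η' - 1)) • (η' * u ^ (η' - 1)) •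
          fderiv ℝ (weighted q ε ρ F) z = fderiv ℝ (weighted q ε ρ F) z := by
        rw [smul_smul]
        have : 1 / η' * (u ^ η') ^ (1 / η' - 1) * (η' * u ^ (η' - 1)) = 1 := by
          calc _ = (1 / η' * η') * ((u ^ η') ^ (1 / η' - 1) * u ^ (η' - 1)) := by ring
            _ = 1 := by rw [k2, one_div_mul_cancel hη'0.ne', one_mul]
        rw [this, one_smul]
      rw [k3, mul_assoc, k2, mul_one] at r3
      exact r3.trans (min_le_left _ _)

/-- The main analytic construction: a `C¹` function `w`, tangent along `M` to a
positive multiple of `ρ ∘ F`, whose power `w ^ η'` is strictly plurisubharmonic on `W` near `M`. -/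
theorem JetData.exists_smooth [ProperSpace E] (h : JetData J M W ρ η F P K c)
    (hq : IsHermitianForm J q) (hη : 0 < η) (hη' : η < η') (hfr : frontier W ⊆ M)
    (hu : ∀ᶠ z in 𝓝ˢ M, ContDiffAt ℝ 1 (fun w => ρ (F w)) z) : ∃ ε : ℝ, ∃ w : E → ℝ,
      (∀ᶠ z in 𝓝ˢ M, ContDiffAt ℝ 1 w z) ∧
      (∀ p ∈ M, w p = 0 ∧ fderiv ℝ w p = Real.exp (ε * q p p) • fderiv ℝ (fun w => ρ (F w)) p) ∧
      (∀ᶠ z in 𝓝ˢ M, z ∈ W → 0 < w z ∧ C2At (fun x => w x ^ η') z ∧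
        ∀ X, X ≠ 0 → 0 < lap J (fun x => w x ^ η') z X) ∧
      ∀ z ∉ W, w z = ρ (F z) * Real.exp (ε * q z z) := by
  classical
  obtain ⟨ε, hε, w, h1, h2⟩ := h.exists_root hq hη hη'
  set u := weighted q ε ρ F with hudef
  set v : E → ℝ := fun z => if z ∈ W then w z else u z with hv
  have hMW : ∀ p ∈ M, p ∉ W := fun p hp hpW => by
    have := h.pos p hpW
    rw [infDist_zero_of_mem hp] at this
    exact lt_irrefl _ this
  have hqc : ContDiff ℝ 1 fun z => Real.exp (ε * q z z) :=
    Real.contDiff_exp.comp (contDiff_const.mul (q.contDiff.clm_apply contDiff_id))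
  have huC : ∀ᶠ z in 𝓝ˢ M, ContDiffAt ℝ 1 u z := by
    filter_upwards [hu] with z hz using hz.mul hqc.contDiffAt
  have hW : ∀ z ∈ W, v =ᶠ[𝓝 z] w := fun z hz => by
    filter_upwards [h.open_W.mem_nhds hz] with x hx using if_pos hx
  have hW' : ∀ z, z ∉ W → z ∉ M → v =ᶠ[𝓝 z] u := fun z hz hzM => by
    have : z ∉ closure W := fun hc => hzM (hfr ⟨hc, by rwa [h.open_W.interior_eq]⟩)
    filter_upwards [isClosed_closure.isOpen_compl.mem_nhds this] with x hx
      using if_neg fun hxW => hx (subset_closure hxW)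
  have huM : ∀ p ∈ M, ContDiffAt ℝ 1 u p := fun p hp => huC.self_of_nhdsSet p hp
  have hvM : ∀ p ∈ M, HasFDerivAt v (fderiv ℝ u p) p := by
    intro p hp
    have hd := ((huM p hp).differentiableAt (by norm_num)).hasFDerivAt
    have key : HasFDerivAt (fun z => v z - u z) (0 : E →L[ℝ] ℝ) p := by
      rw [hasFDerivAt_iff_isLittleO, Asymptotics.isLittleO_iff]
      intro e he
      have := eventually_nhdsSet_of_approach (h2 e he)
      filter_upwards [eventually_nhdsSet_iff_forall.1 this p hp] with z hz
      have : v p = u p := if_neg (hMW p hp)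
      simp only [this, sub_self, sub_zero, _root_.zero_apply]
      by_cases hzW : z ∈ W
      · have e1 : v z = w z := if_pos hzW
        rw [e1]
        refine (hz hzW).1.trans ?_
        rw [← dist_eq_norm]
        exact mul_le_mul_of_nonneg_left (infDist_le_dist_of_mem hp) he.le
      · have e1 : v z = u z := if_neg hzW
        rw [e1, sub_self, norm_zero]
        positivity
    have h3 := key.add hd
    rw [zero_add] at h3
    exact h3.congr_of_eventuallyEq (Eventually.of_forall fun z => by simp)
  have hclose : ∀ e > 0, ∀ᶠ z in 𝓝ˢ M, ‖fderiv ℝ v z - fderiv ℝ u z‖ ≤ e := by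
    intro e he
    filter_upwards [eventually_nhdsSet_of_approach (h2 e he)] with z hz
    by_cases hzW : z ∈ W
    · rw [(hW z hzW).fderiv_eq]; exact (hz hzW).2
    by_cases hzM : z ∈ M
    · rw [(hvM z hzM).fderiv, sub_self, norm_zero]; exact he.le
    · rw [(hW' z hzW hzM).fderiv_eq, sub_self, norm_zero]; exact he.le
  have hdc : ∀ᶠ z in 𝓝ˢ M, DifferentiableAt ℝ v z ∧ ContinuousAt (fderiv ℝ v) z := by
    filter_upwards [huC, eventually_nhdsSet_of_approach h1] with z hz hzw
    have hcont : ContinuousAt (fderiv ℝ u) z :=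
      (hz.fderiv_right (m := 0) (by norm_num)).continuousAt
    by_cases hzW : z ∈ W
    · obtain ⟨-, h3, -⟩ := hzw hzW
      have := h3.congr (hW z hzW)
      exact ⟨this.differentiableAt, this.2.continuousAt⟩
    by_cases hzM : z ∈ M
    · refine ⟨(hvM z hzM).differentiableAt, ?_⟩
      have h0 : Tendsto (fun x => fderiv ℝ v x - fderiv ℝ u x) (𝓝 z) (𝓝 0) := by
        rw [Metric.tendsto_nhds]
        intro e he
        filter_upwards [eventually_nhdsSet_iff_forall.1 (hclose (e / 2) (half_pos he)) z hzM]
          with x hx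
        rw [dist_zero_right]; linarith
      have h3 := h0.add hcont.tendsto
      simp only [sub_add_cancel, zero_add] at h3
      rw [ContinuousAt, (hvM z hzM).fderiv]
      exact h3
    · have e1 := hW' z hzW hzM
      exact ⟨((hz.differentiableAt (by norm_num)).congr_of_eventuallyEq e1),
        hcont.congr_of_eventuallyEq e1.fderiv⟩
  refine ⟨ε, v, ?_, ?_, ?_, fun z hz => if_neg hz⟩
  · obtain ⟨O, hO, hMO, hOd⟩ := eventually_nhdsSet_iff_exists.1 hdc
    rw [eventually_nhdsSet_iff_exists]
    refine ⟨O, hO, hMO, fun z hz => contDiffAt_one_iff.2 ⟨fderiv ℝ v, O, hO.mem_nhds hz,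
      fun x hx => (hOd x hx).2.continuousWithinAt, fun x hx => (hOd x hx).1.hasFDerivAt⟩⟩
  · intro p hp
    refine ⟨?_, ?_⟩
    · have : v p = u p := if_neg (hMW p hp)
      rw [this, hudef, weighted, h.ρ_zero p hp, zero_mul]
    · rw [(hvM p hp).fderiv, hudef, (hq.hasFDerivAt_weighted ε
        ((hu.self_of_nhdsSet p hp).differentiableAt (by norm_num))).fderiv, weighted,
        h.ρ_zero p hp, zero_mul, zero_smul, add_zero]
  · filter_upwards [eventually_nhdsSet_of_approach h1] with z hz hzW
    obtain ⟨a1, -, a3, a4⟩ := hz hzW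
    have e1 := hW z hzW
    have e2 : (fun x => v x ^ η') =ᶠ[𝓝 z] fun x => w x ^ η' := by
      filter_upwards [e1] with x hx; rw [hx]
    refine ⟨by rwa [e1.self_of_nhds], a3.congr e2, fun X hX => ?_⟩
    rw [lap_congr J e2]; exact a4 X hX

end Construct

section Holes

variable {E : Type*} [NormedAddCommGroup E] [NormedSpace ℝ E]

theorem isPreconnected_compl_closedBall (hE : 1 < Module.rank ℝ E) {R : ℝ} (hR : 0 < R) :
    IsPreconnected (closedBall (0 : E) R)ᶜ := by
  have h := (isConnected_compl_singleton_of_one_lt_rank hE (0 : E)).isPreconnected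
  have hc : ContinuousOn (fun x : E => (1 + R / ‖x‖) • x) {0}ᶜ := by
    intro x hx
    have : ‖x‖ ≠ 0 := norm_ne_zero_iff.2 hx
    have : ContinuousAt (fun x : E => (1 + R / ‖x‖) • x) x := by fun_prop (disch := assumption)
    exact this.continuousWithinAt
  convert h.image _ hc
  ext y
  simp only [mem_compl_iff, mem_closedBall, dist_zero_right, not_le, mem_image, mem_singleton_iff]
  constructor
  · intro hy
    have hy0 : 0 < ‖y‖ := hR.trans hy
    have h1 : 0 < 1 - R / ‖y‖ := by rw [sub_pos, div_lt_one hy0]; exact hy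
    refine ⟨(1 - R / ‖y‖) • y, ?_, ?_⟩
    · simp [h1.ne', norm_pos_iff.1 hy0]
    · rw [smul_smul, norm_smul, Real.norm_of_nonneg h1.le]
      have : (1 + R / ((1 - R / ‖y‖) * ‖y‖)) * (1 - R / ‖y‖) = 1 := by
        have h3 : ‖y‖ - R ≠ 0 := (sub_pos.2 hy).ne'
        have : (1 - R / ‖y‖) * ‖y‖ = ‖y‖ - R := by field_simp
        rw [this]
        field_simp
        ring
      rw [this, one_smul]
  · rintro ⟨x, hx, rfl⟩
    have hx0 : 0 < ‖x‖ := norm_pos_iff.2 hx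
    rw [norm_smul, Real.norm_of_nonneg (by positivity), add_mul, div_mul_cancel₀ _ hx0.ne']
    linarith

theorem eq_of_isPreconnected_of_int {X : Type*} [TopologicalSpace X] {S : Set X}
    (hS : IsPreconnected S) {g : X → ℝ} (hg : ContinuousOn g S) (hi : ∀ x ∈ S, ∃ m : ℤ, g x = m)
    {x y : X} (hx : x ∈ S) (hy : y ∈ S) : g x = g y := by
  have : DiscreteTopology (range ((↑) : ℤ → ℝ)) :=
    Int.isClosedEmbedding_coe_real.isEmbedding.toHomeomorph.symm.isEmbedding.discreteTopology
  exact hS.constant_of_mapsTo (T := range ((↑) : ℤ → ℝ)) ⟨this⟩ hg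
    (fun z hz => by obtain ⟨m, hm⟩ := hi z hz; exact ⟨m, hm.symm⟩) hx hy

/-- A bounded domain with disconnected boundary has a bounded complementary component. -/
theorem exists_hole (hE : 1 < Module.rank ℝ E) {Ω A B : Set E} (hΩ : IsOpen Ω)
    (hc : IsPreconnected Ω) (hb : Bornology.IsBounded Ω) (hA : IsClosed A) (hB : IsClosed B)
    (hAB : Disjoint A B) (hA0 : A.Nonempty) (hB0 : B.Nonempty) (hfr : frontier Ω = A ∪ B)
    (hext : frontier Ω ⊆ closure (closure Ω)ᶜ) :
    ∃ K : Set E, IsOpen K ∧ K.Nonempty ∧ Bornology.IsBounded K ∧ K ⊆ (closure Ω)ᶜ ∧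
      frontier K ⊆ frontier Ω := by
  classical
  obtain ⟨u, huA, huB, -⟩ := exists_continuous_zero_one_of_isClosed hA hB hAB
  have hpi := Real.pi_pos
  set θ : E → Circle := fun x => if x ∈ Ω then Circle.exp (2 * Real.pi * u x) else 1 with hθ
  have hθM : ∀ x ∈ frontier Ω, Circle.exp (2 * Real.pi * u x) = 1 := by
    intro x hx
    rw [hfr] at hx
    rcases hx with hx | hx
    · rw [huA hx]; simp
    · rw [huB hx]; simp
  have hθc : Continuous θ := by
    refine continuous_if hθM ?_ continuous_const.continuousOn
    exact (Circle.exp.continuous.comp (continuous_const.mul u.continuous)).continuousOn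
  obtain ⟨h, ⟨-, hh⟩, -⟩ := Circle.isCoveringMap_exp.existsUnique_continuousMap_lifts
    ⟨θ, hθc⟩ 0 (Complex.arg (θ 0)) (Circle.exp_arg (θ 0))
  replace hh : ∀ x, Circle.exp (h x) = θ x := fun x => congrFun hh x
  set g : E → ℝ := fun x => h x / (2 * Real.pi) with hg
  have hgc : Continuous g := h.continuous.div_const _
  have hg1 : ∀ x ∉ Ω, ∃ m : ℤ, g x = m := by
    intro x hx
    obtain ⟨m, hm⟩ := Circle.exp_eq_one.1 ((hh x).trans (if_neg hx))
    exact ⟨m, by simp only [hg, hm]; field_simp⟩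
  have hg2 : ∀ x ∈ closure Ω, ∃ m : ℤ, g x - u x = m := by
    intro x hx
    have : Circle.exp (h x) = Circle.exp (2 * Real.pi * u x) := by
      rw [hh]
      by_cases hxΩ : x ∈ Ω
      · exact if_pos hxΩ
      · exact (if_neg hxΩ).trans (hθM x ⟨hx, by rwa [hΩ.interior_eq]⟩).symm
    obtain ⟨m, hm⟩ := Circle.exp_eq_exp.1 this
    exact ⟨m, by simp only [hg, hm]; field_simp; ring⟩
  have hMc : frontier Ω ⊆ closure Ω := frontier_subset_closure
  have hMn : ∀ x ∈ frontier Ω, x ∉ Ω := fun x hx => by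
    have := hx.2
    rwa [hΩ.interior_eq] at this
  have hAM : A ⊆ frontier Ω := hfr ▸ subset_union_left
  have hBM : B ⊆ frontier Ω := hfr ▸ subset_union_right
  obtain ⟨a, ha⟩ := hA0
  obtain ⟨b, hb'⟩ := hB0
  have hab : g b = g a + 1 := by
    have := eq_of_isPreconnected_of_int hc.closure (g := fun x => g x - u x)
      (hgc.sub u.continuous).continuousOn hg2 (hMc (hAM ha)) (hMc (hBM hb'))
    simp only [huA ha, huB hb', Pi.zero_apply, Pi.one_apply] at this
    linarith
  obtain ⟨R, hR, hR'⟩ := hb.subset_closedBall_lt 0 0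
  have hRΩ : ∀ x ∈ (closedBall (0 : E) R)ᶜ, x ∉ Ω := fun x hx hxΩ => hx (hR' hxΩ)
  obtain ⟨p, hp, hp'⟩ : ∃ p ∈ frontier Ω, ∀ x ∈ (closedBall (0 : E) R)ᶜ, g x ≠ g p := by
    by_cases hex : ∀ x ∈ (closedBall (0 : E) R)ᶜ, g x ≠ g a
    · exact ⟨a, hAM ha, hex⟩
    · push Not at hex
      obtain ⟨x₀, hx₀, e⟩ := hex
      refine ⟨b, hBM hb', fun x hx => ?_⟩
      rw [eq_of_isPreconnected_of_int (isPreconnected_compl_closedBall hE hR) hgc.continuousOn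
        (fun y hy => hg1 y (hRΩ y hy)) hx hx₀, e, hab]
      linarith
  have hclose : ∀ x ∉ Ω, |g x - g p| < 1 → g x = g p := by
    intro x hx hlt
    obtain ⟨m, hm⟩ := hg1 x hx
    obtain ⟨k, hk⟩ := hg1 p (hMn p hp)
    rw [hm, hk] at hlt ⊢
    have : |m - k| < 1 := by exact_mod_cast hlt
    rw [Int.abs_lt_one_iff, sub_eq_zero] at this
    rw [this]
  have hopen : IsOpen {x | |g x - g p| < 1} :=
    isOpen_lt (by fun_prop) continuous_const
  have hext' : (closure Ω)ᶜ ⊆ Ωᶜ := compl_subset_compl.2 subset_closure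
  refine ⟨(closure Ω)ᶜ ∩ {x | |g x - g p| < 1}, isClosed_closure.isOpen_compl.inter hopen, ?_, ?_,
    inter_subset_left, ?_⟩
  · have := mem_closure_iff.1 (hext hp) _ hopen (by simp)
    rwa [inter_comm] at this
  · refine (isBounded_closedBall (x := (0 : E)) (r := R)).subset fun x hx => ?_
    by_contra hxR
    exact hp' x hxR (hclose x (hext' hx.1) hx.2)
  · intro x hx
    have hclosed : IsClosed (Ωᶜ ∩ {x | g x = g p}) :=
      hΩ.isClosed_compl.inter (isClosed_eq hgc continuous_const)
    have hsub : (closure Ω)ᶜ ∩ {x | |g x - g p| < 1} ⊆ Ωᶜ ∩ {x | g x = g p} :=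
      fun y hy => ⟨hext' hy.1, hclose y (hext' hy.1) hy.2⟩
    have hx1 := closure_minimal hsub hclosed hx.1
    refine ⟨?_, by rw [hΩ.interior_eq]; exact hx1.1⟩
    by_contra hxc
    refine hx.2 ?_
    rw [(isClosed_closure.isOpen_compl.inter hopen).interior_eq]
    exact ⟨hxc, by simp [hx1.2.out]⟩

end Holes

section Holes

variable {E : Type*} [NormedAddCommGroup E] [NormedSpace ℝ E]

theorem hess_nonpos_of_isLocalMax {u : E → ℝ} {z X : E} (hu : C2At u z)
    (hmax : IsLocalMax (fun s : ℝ => u (z + s • X)) 0) : hess u z X ≤ 0 := by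
  by_contra! hpos
  set f : ℝ → ℝ := fun s => u (z + s • X) with hf
  have hline : ∀ s : ℝ, HasDerivAt (fun s : ℝ => z + s • X) X s := fun s => by
    simpa using ((hasDerivAt_id s).smul_const X).const_add z
  have hcl : Tendsto (fun s : ℝ => z + s • X) (𝓝 0) (𝓝 z) := by
    simpa using (hline 0).continuousAt.tendsto
  have h1 : ∀ᶠ s in 𝓝 (0 : ℝ), HasDerivAt f (fderiv ℝ u (z + s • X) X) s := by
    filter_upwards [hcl.eventually hu.1] with s hs
    exact hs.hasFDerivAt.comp_hasDerivAt s (hline s)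
  have e1 : deriv f =ᶠ[𝓝 0] fun s => fderiv ℝ u (z + s • X) X := h1.mono fun s hs => hs.deriv
  have h2 : HasDerivAt (fun s : ℝ => fderiv ℝ u (z + s • X) X) (hess u z X) 0 := by
    have h3 : HasFDerivAt (fderiv ℝ u) (fderiv ℝ (fderiv ℝ u) z) (z + (0 : ℝ) • X) := by
      simpa using hu.2.hasFDerivAt
    have h4 : HasDerivAt (fun s : ℝ => fderiv ℝ u (z + s • X)) (fderiv ℝ (fderiv ℝ u) z X) 0 :=
      h3.comp_hasDerivAt (0 : ℝ) (hline 0)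
    exact (ContinuousLinearMap.apply ℝ ℝ X).hasFDerivAt.comp_hasDerivAt (0 : ℝ) h4
  have h0 : deriv f 0 = 0 := hmax.deriv_eq_zero
  have hdd : deriv (deriv f) 0 = hess u z X := by rw [e1.deriv_eq, h2.deriv]
  have hmin : IsLocalMin f 0 := isLocalMin_of_deriv_deriv_pos (by rw [hdd]; exact hpos) h0
    h1.self_of_nhds.continuousAt
  have hconst : f =ᶠ[𝓝 0] fun _ => f 0 := by
    filter_upwards [hmin, hmax] with s h1 h2 using le_antisymm h2 h1
  have : deriv (deriv f) 0 = 0 := by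
    rw [hconst.deriv.deriv_eq]; simp
  linarith

variable {J : E →L[ℝ] E} {q : E →L[ℝ] E →L[ℝ] ℝ}

/-- There is no strictly plurisubharmonic function vanishing on the boundary of a bounded
open set and positive inside, even if it is only defined near the boundary. -/
theorem not_exists_psh_near_frontier [ProperSpace E] (hq : IsHermitianForm J q)
    (hn : ∀ z : E, ∃ X, X ≠ 0 ∧ q z X = 0 ∧ q z (J X) = 0) {K : Set E} (hK : IsOpen K)
    (hK0 : K.Nonempty) (hKb : Bornology.IsBounded K) {w : E → ℝ} {η : ℝ} (hη : 0 < η)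
    (h0 : ∀ p ∈ frontier K, w p = 0) (hc : ∀ᶠ z in 𝓝ˢ (frontier K), ContinuousAt w z)
    (hw : ∀ᶠ z in 𝓝ˢ (frontier K), z ∈ K → 0 < w z ∧ C2At (fun x => w x ^ η) z ∧
      ∀ X, X ≠ 0 → 0 < lap J (fun x => w x ^ η) z X) : False := by
  have hS : IsCompact (closure K) := hKb.isCompact_closure
  have hQc : Continuous fun z => q z z := by fun_prop
  have hperp : ∀ (z X : E) (a b : ℝ), q z X = 0 → q z (J X) = 0 →
      q (z + (a • X + b • J X)) (z + (a • X + b • J X)) = q z z + (a ^ 2 + b ^ 2) * q X X := by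
    intro z X a b h1 h2
    have h3 : q X (J X) = 0 := by
      have e1 := hq.inv X (J X)
      rw [hq.sq, map_neg, hq.symm (J X) X] at e1
      linarith
    simp only [map_add, map_smul, _root_.add_apply, _root_.smul_apply, smul_eq_mul,
      hq.symm X z, hq.symm (J X) z, hq.symm (J X) X, h1, h2, h3, hq.inv]
    ring
  obtain ⟨z₀, hz₀, hmax⟩ := hS.exists_isMaxOn hK0.closure hQc.continuousOn
  obtain ⟨U, hUo, hMU, hU⟩ := eventually_nhdsSet_iff_exists.1 (hc.and hw)
  have hmaxF : ∀ z ∈ closure K, q z₀ z₀ ≤ q z z → z ∈ frontier K := by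
    intro z hz hle
    refine ⟨hz, fun hzi => ?_⟩
    rw [hK.interior_eq] at hzi
    obtain ⟨X, hX0, hX1, hX2⟩ := hn z
    have hcl : Tendsto (fun s : ℝ => z + (s • X + (0 : ℝ) • J X)) (𝓝[>] 0) (𝓝 z) := by
      have : Continuous fun s : ℝ => z + (s • X + (0 : ℝ) • J X) := by fun_prop
      have := this.tendsto 0
      simp only [zero_smul, add_zero] at this
      simp only [zero_smul, add_zero]
      exact this.mono_left nhdsWithin_le_nhds
    obtain ⟨s, hs, hs0⟩ := ((hcl.eventually (hK.mem_nhds hzi)).and self_mem_nhdsWithin).exists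
    have := hmax (subset_closure hs)
    simp only [mem_ofPred_eq] at this
    rw [hperp z X s 0 hX1 hX2] at this
    have h5 : 0 < (s ^ 2 + 0 ^ 2) * q X X := mul_pos (by positivity) (hq.pos hX0)
    linarith
  obtain ⟨t, htT, htU⟩ : ∃ t < q z₀ z₀, ∀ z ∈ closure K, t < q z z → z ∈ U := by
    rcases (closure K \ U).eq_empty_or_nonempty with he | hne
    · exact ⟨q z₀ z₀ - 1, by linarith, fun z hz _ => by
        by_contra hzU
        have : z ∈ closure K \ U := ⟨hz, hzU⟩
        rw [he] at this
        exact this⟩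
    · obtain ⟨z₁, hz₁, hmax₁⟩ := (hS.diff hUo).exists_isMaxOn hne hQc.continuousOn
      refine ⟨q z₁ z₁, ?_, fun z hz hlt => ?_⟩
      · by_contra! hle
        exact hz₁.2 (hMU (hmaxF z₁ hz₁.1 hle))
      · by_contra hzU
        exact absurd (hmax₁ ⟨hz, hzU⟩) (not_le.2 hlt)
  obtain ⟨y, hyt, hyK⟩ := mem_closure_iff.1 hz₀ _ (isOpen_lt continuous_const hQc) htT
  obtain ⟨X, hX0, hX1, hX2⟩ := hn y
  have : FiniteDimensional ℝ (Submodule.span ℝ {X, J X}) :=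
    FiniteDimensional.span_of_finite ℝ (toFinite _)
  set D : Set E := closure K ∩ {z | z - y ∈ Submodule.span ℝ {X, J X}} with hD
  have hspan : ∀ z, z - y ∈ Submodule.span ℝ {X, J X} ↔ ∃ a b : ℝ, z = y + (a • X + b • J X) := by
    intro z
    rw [Submodule.mem_span_pair]
    refine exists_congr fun a => exists_congr fun b => ?_
    rw [eq_sub_iff_add_eq', eq_comm]
  have hDc : IsCompact D := hS.inter_right
    ((Submodule.closed_of_finiteDimensional (Submodule.span ℝ {X, J X})).preimage
      (continuous_id.sub continuous_const))
  have hDU : D ⊆ U := by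
    rintro z ⟨hz, hz'⟩
    refine htU z hz ?_
    obtain ⟨a, b, rfl⟩ := (hspan z).1 hz'
    rw [hperp y X a b hX1 hX2]
    have : 0 ≤ (a ^ 2 + b ^ 2) * q X X := mul_nonneg (by positivity) (hq.pos hX0).le
    have := hyt.out
    linarith
  have hyD : y ∈ D := ⟨subset_closure hyK, by simp⟩
  have hφc : ContinuousOn (fun x => w x ^ η) D := fun z hz =>
    ((hU z (hDU hz)).1.rpow_const (Or.inr hη.le)).continuousWithinAt
  obtain ⟨z₁, hz₁, hmax₁⟩ := hDc.exists_isMaxOn ⟨y, hyD⟩ hφc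
  have hφy : 0 < w y ^ η := Real.rpow_pos_of_pos ((hU y (hDU hyD)).2 hyK).1 η
  have hz₁K : z₁ ∈ K := by
    by_contra hnK
    have := h0 z₁ ⟨hz₁.1, by rwa [hK.interior_eq]⟩
    have h3 := hmax₁ hyD
    simp only [mem_ofPred_eq, this, Real.zero_rpow hη.ne'] at h3
    linarith
  obtain ⟨-, hC, hlap⟩ := (hU z₁ (hDU hz₁)).2 hz₁K
  have hloc : ∀ Y ∈ Submodule.span ℝ {X, J X}, hess (fun x => w x ^ η) z₁ Y ≤ 0 := by
    intro Y hY
    refine hess_nonpos_of_isLocalMax hC ?_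
    have hcl : Tendsto (fun s : ℝ => z₁ + s • Y) (𝓝 0) (𝓝 z₁) := by
      have : Continuous fun s : ℝ => z₁ + s • Y := by fun_prop
      simpa using this.tendsto 0
    filter_upwards [hcl.eventually (hK.mem_nhds hz₁K)] with s hs
    have := hmax₁ (a := z₁ + s • Y) ⟨subset_closure hs, by
      have h6 := Submodule.add_mem _ hz₁.2 (Submodule.smul_mem _ s hY)
      have e : z₁ + s • Y - y = z₁ - y + s • Y := by abel
      simp only [mem_ofPred_eq, e]; exact h6⟩
    simpa using this
  have := hlap X hX0
  have a1 := hloc X (Submodule.subset_span (by simp))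
  have a2 := hloc (J X) (Submodule.subset_span (by simp))
  simp only [lap] at this
  linarith

end Holes

section Hypersurface

variable {E F : Type*} [NormedAddCommGroup E] [NormedSpace ℝ E] [NormedAddCommGroup F]
  [NormedSpace ℝ F]

theorem exists_pos_of_ne_zero {ℓ : E →L[ℝ] ℝ} (h : ℓ ≠ 0) : ∃ v, 0 < ℓ v := by
  obtain ⟨v, hv⟩ := DFunLike.ne_iff.1 h
  rcases lt_or_gt_of_ne hv with hv | hv
  · exact ⟨-v, by rw [map_neg]; simpa using hv⟩
  · exact ⟨v, by simpa using hv⟩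

/-- Increments of a strictly differentiable function along a direction of increase. -/
theorem exists_increment {u : E → ℝ} {ℓ : E →L[ℝ] ℝ} {p v : E} (hu : HasStrictFDerivAt u ℓ p)
    (hv : 0 < ℓ v) : ∃ t > 0, ∀ x s, 0 ≤ s → dist x p < t → dist (x - s • v) p < t →
      ℓ v / 2 * s ≤ u x - u (x - s • v) := by
  have hv0 : v ≠ 0 := by rintro rfl; simp at hv
  have hvn : 0 < ‖v‖ := norm_pos_iff.2 hv0
  have h1 := hu.isLittleO.def (c := ℓ v / (2 * ‖v‖)) (by positivity)
  rw [nhds_prod_eq] at h1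
  obtain ⟨t, ht, h⟩ := (nhds_basis_ball.prod_self.eventually_iff).1 h1
  refine ⟨t, ht, fun x s hs hx hx' => ?_⟩
  have h2 := h (x := (x, x - s • v)) ⟨hx, hx'⟩
  have e : x - (x - s • v) = s • v := by abel
  simp only [e, map_smul, smul_eq_mul, norm_smul, Real.norm_eq_abs, abs_of_nonneg hs] at h2
  have e2 : ℓ v / (2 * ‖v‖) * (s * ‖v‖) = ℓ v / 2 * s := by field_simp
  rw [e2] at h2
  have := (abs_le.1 h2).1
  linarith

/-- A function vanishing on a hypersurface and increasing transversally to it grows at least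
linearly with the distance on the positive side. -/
theorem exists_linear_growth {r u : E → ℝ} {ℓ ℓ' : E →L[ℝ] ℝ} {p v : E} {M : Set E}
    (hr : HasStrictFDerivAt r ℓ p) (hu : HasStrictFDerivAt u ℓ' p) (hv : 0 < ℓ v)
    (hv' : 0 < ℓ' v) (hp : r p = 0) (hM : ∀ᶠ z in 𝓝 p, r z = 0 → z ∈ M ∧ u z = 0)
    (hrc : ∀ᶠ z in 𝓝 p, ContinuousAt r z) :
    ∃ c > 0, ∀ᶠ z in 𝓝 p, 0 < r z → c * infDist z M ≤ u z := by
  have hv0 : v ≠ 0 := by rintro rfl; simp at hv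
  have hvn : 0 < ‖v‖ := norm_pos_iff.2 hv0
  obtain ⟨t₁, ht₁, h1⟩ := exists_increment hr hv
  obtain ⟨t₂, ht₂, h2⟩ := exists_increment hu hv'
  obtain ⟨t₃, ht₃, h3⟩ := Metric.eventually_nhds_iff.1 (hM.and hrc)
  set t := min t₁ (min t₂ t₃) with htdef
  have ht : 0 < t := by positivity
  have hrp : ∀ᶠ z in 𝓝 p, r z < ℓ v / (4 * ‖v‖) * t :=
    hr.hasFDerivAt.continuousAt.eventually_lt_const (by rw [hp]; positivity)
  refine ⟨ℓ' v / (2 * ‖v‖), by positivity, ?_⟩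
  filter_upwards [hrp, ball_mem_nhds p (half_pos ht)] with z hz1 hz2 hz0
  rw [mem_ball] at hz2
  set s₀ := 2 * r z / ℓ v with hs₀
  have hs₀0 : 0 ≤ s₀ := by positivity
  have hnear : ∀ s ∈ Icc 0 s₀, dist (z - s • v) p < t := by
    intro s hs
    have a1 : dist (z - s • v) z = s * ‖v‖ := by
      rw [dist_eq_norm]; simp [norm_smul, abs_of_nonneg hs.1]
    have a2 : s₀ * ‖v‖ < t / 2 := by
      rw [hs₀, div_mul_eq_mul_div, div_lt_iff₀ hv]
      have : ℓ v / (4 * ‖v‖) * t * (2 * ‖v‖) = t / 2 * ℓ v := by field_simp; ring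
      have a3 := mul_lt_mul_of_pos_right hz1 (by positivity : 0 < 2 * ‖v‖)
      linarith
    have a3 := mul_le_mul_of_nonneg_right hs.2 hvn.le
    have := dist_triangle (z - s • v) z p
    linarith
  have ht1 : t ≤ t₁ := min_le_left _ _
  have ht2 : t ≤ t₂ := (min_le_right _ _).trans (min_le_left _ _)
  have ht3 : t ≤ t₃ := (min_le_right _ _).trans (min_le_right _ _)
  have hcont : ContinuousOn (fun s : ℝ => r (z - s • v)) (Icc 0 s₀) := by
    intro s hs
    refine ContinuousAt.continuousWithinAt ?_
    exact ContinuousAt.comp (f := fun s : ℝ => z - s • v) (g := r)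
      (h3 ((hnear s hs).trans_le ht3)).2 (by fun_prop)
  have hend : r (z - s₀ • v) ≤ 0 := by
    have := h1 z s₀ hs₀0 (by linarith) ((hnear s₀ ⟨hs₀0, le_rfl⟩).trans_le ht1)
    have e : ℓ v / 2 * s₀ = r z := by rw [hs₀]; field_simp
    linarith
  obtain ⟨s, hs, hs'⟩ := intermediate_value_Icc' hs₀0 hcont (show (0 : ℝ) ∈ _ from
    ⟨hend, by simpa using hz0.le⟩)
  obtain ⟨hsM, hsu⟩ := (h3 ((hnear s hs).trans_le ht3)).1 hs'
  have b1 := h2 z s hs.1 (by linarith) ((hnear s hs).trans_le ht2)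
  rw [hsu, sub_zero] at b1
  have b2 := infDist_le_dist_of_mem (x := z) hsM
  rw [dist_eq_norm, sub_sub_cancel, norm_smul, Real.norm_eq_abs, abs_of_nonneg hs.1] at b2
  refine le_trans ?_ b1
  calc ℓ' v / (2 * ‖v‖) * infDist z M ≤ ℓ' v / (2 * ‖v‖) * (s * ‖v‖) := by gcongr
    _ = ℓ' v / 2 * s := by field_simp

/-- A local parametrisation straightening the level set of `r` through `p`. -/
structure IsStraightening (r : E → ℝ) (p : E) (σ : E → E) : Prop where
  zero : σ 0 = p
  strict : HasStrictFDerivAt σ (ContinuousLinearMap.id ℝ E) 0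
  smooth : ∀ᶠ y in 𝓝 0, DifferentiableAt ℝ σ y
  level : ∀ᶠ y in 𝓝 0, r (σ y) = r p + fderiv ℝ r p y
  inv : ∃ Θ : E → E, HasStrictFDerivAt Θ (ContinuousLinearMap.id ℝ E) p ∧ Θ p = 0 ∧
    ∀ᶠ z in 𝓝 p, σ (Θ z) = z ∧ r z = r p + fderiv ℝ r p (Θ z)

theorem exists_isStraightening [CompleteSpace E] {r : E → ℝ} {p : E} (hr : ContDiffAt ℝ 1 r p)
    (h0 : fderiv ℝ r p ≠ 0) : ∃ σ, IsStraightening r p σ := by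
  obtain ⟨v, hv⟩ := exists_pos_of_ne_zero h0
  set ℓ := fderiv ℝ r p with hℓ
  set Θ : E → E := fun z => z - p + (r z - r p - ℓ (z - p)) • ((ℓ v)⁻¹ • v) with hΘ
  have hΘC : ContDiffAt ℝ 1 Θ p := by
    have h1 : ContDiffAt ℝ 1 (fun z => ℓ (z - p)) p := by fun_prop
    have h2 : ContDiffAt ℝ 1 (fun z => z - p) p := by fun_prop
    exact h2.add (((hr.sub contDiffAt_const).sub h1).smul contDiffAt_const)
  have hlev : ∀ z, r z = r p + ℓ (Θ z) := by
    intro z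
    simp only [hΘ, map_add, map_smul, smul_eq_mul]
    rw [inv_mul_cancel₀ hv.ne']
    ring
  have hΘp : Θ p = 0 := by simp [hΘ]
  have hd : HasFDerivAt Θ (ContinuousLinearMap.id ℝ E) p := by
    have h1 := (hr.differentiableAt (by norm_num)).hasFDerivAt
    have h2 : HasFDerivAt (fun z => z - p) (ContinuousLinearMap.id ℝ E) p :=
      (hasFDerivAt_id p).sub_const p
    have h3 : HasFDerivAt (fun z => ℓ (z - p)) ℓ p := by
      have h4 := ℓ.hasFDerivAt.comp p h2
      rwa [ContinuousLinearMap.comp_id] at h4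
    have h5 := h2.add (((h1.sub_const (r p)).sub h3).smul_const ((ℓ v)⁻¹ • v))
    rw [← hℓ, sub_self, ContinuousLinearMap.zero_smulRight, add_zero] at h5
    exact h5
  have hd' : HasFDerivAt Θ ((ContinuousLinearEquiv.refl ℝ E : E ≃L[ℝ] E) : E →L[ℝ] E) p := hd
  have hs : HasStrictFDerivAt Θ ((ContinuousLinearEquiv.refl ℝ E : E ≃L[ℝ] E) : E →L[ℝ] E) p :=
    hΘC.hasStrictFDerivAt' hd' (by norm_num)
  have hinv := hs.eventually_left_inverse
  have hrinv := hs.eventually_right_inverse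
  have hsm : ContDiffAt ℝ 1 (hs.localInverse Θ _ p) (Θ p) :=
    hΘC.to_localInverse hd' (by norm_num)
  have hst := hs.to_localInverse
  rw [hΘp] at hrinv hsm hst
  refine ⟨hs.localInverse Θ _ p, ?_, hst, ?_, ?_, Θ, hs, hΘp, ?_⟩
  · have := hs.localInverse_apply_image
    rwa [hΘp] at this
  · filter_upwards [hsm.eventually (by simp)] with y hy using hy.differentiableAt (by norm_num)
  · filter_upwards [hrinv] with y hy
    rw [hlev, hy]
  · filter_upwards [hinv] with z hz using ⟨hz, hlev z⟩

/-- The derivative of a function vanishing on a level set vanishes on tangent vectors. -/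
theorem fderiv_eq_zero_of_level [CompleteSpace E] {r : E → ℝ} {p : E} (hr : ContDiffAt ℝ 1 r p)
    (h0 : fderiv ℝ r p ≠ 0) {h : E → F} (hh : DifferentiableAt ℝ h p)
    (hv : ∀ᶠ z in 𝓝 p, r z = r p → h z = 0) {X : E} (hX : fderiv ℝ r p X = 0) :
    fderiv ℝ h p X = 0 := by
  obtain ⟨σ, hσ⟩ := exists_isStraightening hr h0
  have hl : HasDerivAt (fun s : ℝ => s • X) X 0 := by
    simpa using (hasDerivAt_id (0 : ℝ)).smul_const X
  have h1 : HasDerivAt (fun s : ℝ => σ (s • X)) X 0 := by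
    have : HasFDerivAt σ (ContinuousLinearMap.id ℝ E) ((0 : ℝ) • X) := by
      rw [zero_smul]; exact hσ.strict.hasFDerivAt
    exact this.comp_hasDerivAt (0 : ℝ) hl
  have h2 : HasDerivAt (fun s : ℝ => h (σ (s • X))) (fderiv ℝ h p X) 0 := by
    have : HasFDerivAt h (fderiv ℝ h p) (σ ((0 : ℝ) • X)) := by
      rw [zero_smul, hσ.zero]; exact hh.hasFDerivAt
    exact this.comp_hasDerivAt (0 : ℝ) h1
  have hc1 : Tendsto (fun s : ℝ => s • X) (𝓝 0) (𝓝 0) := by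
    simpa using hl.continuousAt.tendsto
  have hc2 : Tendsto (fun s : ℝ => σ (s • X)) (𝓝 0) (𝓝 p) := by
    simpa [hσ.zero] using h1.continuousAt.tendsto
  have h3 : (fun s : ℝ => h (σ (s • X))) =ᶠ[𝓝 0] fun _ => 0 := by
    filter_upwards [hc1.eventually hσ.level, hc2.eventually hv] with s hs1 hs2
    refine hs2 ?_
    rw [hs1, map_smul, hX, smul_zero, add_zero]
  exact h2.unique ((hasDerivAt_const (0 : ℝ) (0 : F)).congr_of_eventuallyEq h3)

end Hypersurface

section CRPart

variable {E F : Type*} [NormedAddCommGroup E] [NormedSpace ℝ E] [NormedAddCommGroup F]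
  [NormedSpace ℝ F]

/-- A linear choice `R` of a vector transverse to each real hyperplane `ker ℓ`, whose rotation
by the complex structure `J` is tangent to the hyperplane. -/
structure IsTransverse (J : E →L[ℝ] E) (R : (E →L[ℝ] ℝ) →L[ℝ] E) : Prop where
  sq : ∀ x, J (J x) = -x
  pos : ∀ ℓ : E →L[ℝ] ℝ, ℓ ≠ 0 → 0 < ℓ (R ℓ)
  orth : ∀ ℓ : E →L[ℝ] ℝ, ℓ (J (R ℓ)) = 0

/-- The modification of `D` off the hyperplane `ker ℓ` which is complex linear as soon as `D` is
complex linear on the maximal complex subspace of `ker ℓ`. -/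
noncomputable def crPart (J : E →L[ℝ] E) (R : (E →L[ℝ] ℝ) →L[ℝ] E) (JF : F →L[ℝ] F)
    (ℓ : E →L[ℝ] ℝ) (D : E →L[ℝ] F) : E →L[ℝ] F :=
  D - ℓ.smulRight ((ℓ (R ℓ))⁻¹ • JF (D (J (R ℓ)) - JF (D (R ℓ))))

/-- Postcomposition with a complex structure on the target. -/
noncomputable def postJ (E : Type*) [NormedAddCommGroup E] [NormedSpace ℝ E] (JF : F →L[ℝ] F) :
    (E →L[ℝ] F) →L[ℝ] (E →L[ℝ] F) :=
  ContinuousLinearMap.compL ℝ E F F JF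

@[simp]
theorem postJ_apply (JF : F →L[ℝ] F) (C : E →L[ℝ] F) (x : E) : postJ E JF C x = JF (C x) := rfl

theorem postJ_postJ {JF : F →L[ℝ] F} (hF : ∀ x, JF (JF x) = -x) (C : E →L[ℝ] F) :
    postJ E JF (postJ E JF C) = -C := by
  ext x; simp [hF]

variable {J : E →L[ℝ] E} {R : (E →L[ℝ] ℝ) →L[ℝ] E} {JF : F →L[ℝ] F} {ℓ : E →L[ℝ] ℝ}
  {D : E →L[ℝ] F}

theorem crPart_apply_of_mem {u : E} (hu : ℓ u = 0) : crPart J R JF ℓ D u = D u := by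
  simp [crPart, hu]

theorem IsTransverse.exists_decomp (hR : IsTransverse J R) (hℓ : ℓ ≠ 0) (X : E) :
    ∃ (a b : ℝ) (t : E), X = a • R ℓ + b • J (R ℓ) + t ∧ ℓ t = 0 ∧ ℓ (J t) = 0 := by
  have hy := (hR.pos ℓ hℓ).ne'
  refine ⟨ℓ X / ℓ (R ℓ), -(ℓ (J X) / ℓ (R ℓ)),
    X - (ℓ X / ℓ (R ℓ)) • R ℓ - (-(ℓ (J X) / ℓ (R ℓ))) • J (R ℓ), by abel, ?_, ?_⟩
  · simp only [map_sub, map_smul, smul_eq_mul, hR.orth]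
    field_simp
    ring
  · simp only [map_sub, map_smul, smul_eq_mul, hR.orth, hR.sq, map_neg]
    field_simp
    ring

theorem crPart_comm (hR : IsTransverse J R) (hF : ∀ x, JF (JF x) = -x) (hℓ : ℓ ≠ 0)
    (hD : ∀ X, ℓ X = 0 → ℓ (J X) = 0 → D (J X) = JF (D X)) (X : E) :
    crPart J R JF ℓ D (J X) = JF (crPart J R JF ℓ D X) := by
  obtain ⟨a, b, t, rfl, h1, h2⟩ := hR.exists_decomp hℓ X
  have hy := (hR.pos ℓ hℓ).ne'
  have e1 : crPart J R JF ℓ D (R ℓ) = -JF (D (J (R ℓ))) := by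
    simp only [crPart, _root_.sub_apply, ContinuousLinearMap.smulRight_apply, smul_smul]
    rw [mul_inv_cancel₀ hy, one_smul, map_sub, hF]
    abel
  have e2 : crPart J R JF ℓ D (J (R ℓ)) = D (J (R ℓ)) := crPart_apply_of_mem (hR.orth ℓ)
  simp only [map_add, map_smul, hR.sq, map_neg, e1, e2, crPart_apply_of_mem h1,
    crPart_apply_of_mem h2, hD t h1 h2, hF]
  simp

/-- Complex linear maps agreeing on a real hyperplane are equal. -/
theorem IsTransverse.eq_of_eq_on_ker (hR : IsTransverse J R) (hℓ : ℓ ≠ 0) {C C' : E →L[ℝ] F}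
    (hC : ∀ X, C (J X) = JF (C X)) (hC' : ∀ X, C' (J X) = JF (C' X))
    (h : ∀ u, ℓ u = 0 → C u = C' u) : C = C' := by
  ext X
  obtain ⟨a, b, t, rfl, h1, h2⟩ := hR.exists_decomp hℓ X
  have e : C (R ℓ) = C' (R ℓ) := by
    have : R ℓ = -J (J (R ℓ)) := by rw [hR.sq, neg_neg]
    rw [this, map_neg, map_neg, hC, hC', h _ (hR.orth ℓ)]
  simp [e, h _ h1, h _ (hR.orth ℓ)]

/-- The second-order part of a CR map: properties of the derivative of its CR derivative. -/
structure IsCRDeriv (J : E →L[ℝ] E) (JF : F →L[ℝ] F) (ℓ : E →L[ℝ] ℝ)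
    (B : E →L[ℝ] E →L[ℝ] F) : Prop where
  comm : ∀ u, ℓ u = 0 → ∀ X, B u (J X) = JF (B u X)
  symm : ∀ u v, ℓ u = 0 → ℓ v = 0 → B u v = B v u

namespace IsCRDeriv

variable {B : E →L[ℝ] E →L[ℝ] F}

theorem cr (h : IsCRDeriv J JF ℓ B) (hR : IsTransverse J R) (hℓ : ℓ ≠ 0) {w : E}
    (hw : ℓ w = 0) (hw' : ℓ (J w) = 0) : B (J w) = postJ E JF (B w) := by
  refine hR.eq_of_eq_on_ker hℓ (h.comm _ hw') (fun X => ?_) fun v hv => ?_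
  · simp [h.comm _ hw]
  · rw [postJ_apply, h.symm _ _ hw' hv, h.comm _ hv, h.symm _ _ hv hw]

theorem crPart_left (h : IsCRDeriv J JF ℓ B) (hR : IsTransverse J R) (hF : ∀ x, JF (JF x) = -x)
    (hℓ : ℓ ≠ 0) (X : E) :
    crPart J R (postJ E JF) ℓ B (J X) = postJ E JF (crPart J R (postJ E JF) ℓ B X) :=
  crPart_comm hR (postJ_postJ hF) hℓ (fun _ h1 h2 => h.cr hR hℓ h1 h2) X

theorem crPart_symm (h : IsCRDeriv J JF ℓ B) (hR : IsTransverse J R) (hF : ∀ x, JF (JF x) = -x)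
    (hℓ : ℓ ≠ 0) (X Y : E) :
    crPart J R (postJ E JF) ℓ B X Y = crPart J R (postJ E JF) ℓ B Y X := by
  set A := crPart J R (postJ E JF) ℓ B with hA
  have hl : ∀ X Y, A (J X) Y = JF (A X Y) := fun X Y => by
    rw [hA, h.crPart_left hR hF hℓ, postJ_apply]
  have hA0 : ∀ u, ℓ u = 0 → A u = B u := fun u hu => crPart_apply_of_mem hu
  have h1 : ∀ u, ℓ u = 0 → A u = A.flip u := fun u hu => by
    refine hR.eq_of_eq_on_ker (JF := JF) hℓ (fun X => ?_) (fun X => ?_) fun v hv => ?_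
    · rw [hA0 u hu, h.comm u hu]
    · simp [hl]
    · rw [ContinuousLinearMap.flip_apply, hA0 u hu, hA0 v hv, h.symm u v hu hv]
  have h3 : ∀ X Z, A X (J Z) = JF (A X Z) := fun X => by
    have := hR.eq_of_eq_on_ker (JF := postJ E JF) hℓ
      (C := (ContinuousLinearMap.compL ℝ E E F).flip J ∘L A) (C' := (postJ E JF).comp A)
      (fun X => by ext Z; simp [hl]) (fun X => by ext Z; simp [hl])
      (fun u hu => by ext Z; simp [hA0 u hu, h.comm u hu])
    intro Z
    simpa using congrArg (fun C => C X Z) this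
  have h2 : A = A.flip := by
    refine hR.eq_of_eq_on_ker (JF := postJ E JF) hℓ (fun X => ?_) (fun X => ?_) h1
    · ext Z; simp [hl]
    · ext Z; simp [h3]
  exact congrArg (fun C => C X Y) h2

theorem crPart_right (h : IsCRDeriv J JF ℓ B) (hR : IsTransverse J R) (hF : ∀ x, JF (JF x) = -x)
    (hℓ : ℓ ≠ 0) (X Y : E) :
    crPart J R (postJ E JF) ℓ B X (J Y) = JF (crPart J R (postJ E JF) ℓ B X Y) := by
  rw [h.crPart_symm hR hF hℓ, h.crPart_left hR hF hℓ, postJ_apply, h.crPart_symm hR hF hℓ]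

end IsCRDeriv

end CRPart

section CRDeriv

variable {E F : Type*} [NormedAddCommGroup E] [NormedSpace ℝ E] [NormedAddCommGroup F]
  [NormedSpace ℝ F]

/-- The complex linear modification of the derivative of `g` along the level sets of `r`. -/
noncomputable def crDeriv (J : E →L[ℝ] E) (R : (E →L[ℝ] ℝ) →L[ℝ] E) (JF : F →L[ℝ] F)
    (r : E → ℝ) (g : E → F) (z : E) : E →L[ℝ] F :=
  crPart J R JF (fderiv ℝ r z) (fderiv ℝ g z)

variable {J : E →L[ℝ] E} {R : (E →L[ℝ] ℝ) →L[ℝ] E} {JF : F →L[ℝ] F} {r : E → ℝ} {g : E → F}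
  {p : E}

/-- The normal correction in `crDeriv`. -/
noncomputable def crNormal (J : E →L[ℝ] E) (R : (E →L[ℝ] ℝ) →L[ℝ] E) (JF : F →L[ℝ] F)
    (r : E → ℝ) (g : E → F) (z : E) : F :=
  (fderiv ℝ r z (R (fderiv ℝ r z)))⁻¹ •
    JF (fderiv ℝ g z (J (R (fderiv ℝ r z))) - JF (fderiv ℝ g z (R (fderiv ℝ r z))))

theorem crDeriv_eq (z : E) : crDeriv J R JF r g z =
    fderiv ℝ g z - (fderiv ℝ r z).smulRight (crNormal J R JF r g z) := rfl

theorem contDiffAt_crNormal (hR : IsTransverse J R) {m : ℕ} (hr : ContDiffAt ℝ (m + 1) r p)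
    (h0 : fderiv ℝ r p ≠ 0) (hg : ContDiffAt ℝ (m + 1) g p) :
    ContDiffAt ℝ m (crNormal J R JF r g) p := by
  have h1 : ContDiffAt ℝ m (fderiv ℝ r) p := hr.fderiv_right le_rfl
  have h2 : ContDiffAt ℝ m (fderiv ℝ g) p := hg.fderiv_right le_rfl
  have h3 : ContDiffAt ℝ m (fun z => R (fderiv ℝ r z)) p := R.contDiff.contDiffAt.comp p h1
  have h4 : ContDiffAt ℝ m (fun z => J (R (fderiv ℝ r z))) p := J.contDiff.contDiffAt.comp p h3
  have h5 : ContDiffAt ℝ m (fun z => fderiv ℝ r z (R (fderiv ℝ r z))) p := h1.clm_apply h3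
  exact (h5.inv (hR.pos _ h0).ne').smul (JF.contDiff.contDiffAt.comp p
    ((h2.clm_apply h4).sub (JF.contDiff.contDiffAt.comp p (h2.clm_apply h3))))

theorem contDiffAt_crDeriv (hR : IsTransverse J R) {m : ℕ} (hr : ContDiffAt ℝ (m + 1) r p)
    (h0 : fderiv ℝ r p ≠ 0) (hg : ContDiffAt ℝ (m + 1) g p) :
    ContDiffAt ℝ m (crDeriv J R JF r g) p := by
  have h1 : ContDiffAt ℝ m (fderiv ℝ r) p := hr.fderiv_right le_rfl
  have h2 : ContDiffAt ℝ m (fderiv ℝ g) p := hg.fderiv_right le_rfl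
  exact h2.sub (h1.smulRight (contDiffAt_crNormal hR hr h0 hg))

/-- `g` is a CR map along the level set of `r` near `p`. -/
def IsCRNear (J : E →L[ℝ] E) (JF : F →L[ℝ] F) (r : E → ℝ) (g : E → F) (p : E) : Prop :=
  ∀ᶠ z in 𝓝 p, r z = r p → ∀ X, fderiv ℝ r z X = 0 → fderiv ℝ r z (J X) = 0 →
    fderiv ℝ g z (J X) = JF (fderiv ℝ g z X)

theorem eventually_fderiv_ne_zero (hr : ContDiffAt ℝ 1 r p) (h0 : fderiv ℝ r p ≠ 0) :
    ∀ᶠ z in 𝓝 p, fderiv ℝ r z ≠ 0 :=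
  (hr.continuousAt_fderiv (by norm_num)).eventually_ne h0

theorem fderiv_clm_apply_const {g : E → E →L[ℝ] F} (hg : DifferentiableAt ℝ g p) (v : E) :
    HasFDerivAt (fun z => g z v) ((fderiv ℝ g p).flip v) p :=
  ((ContinuousLinearMap.apply ℝ F v).hasFDerivAt (x := g p)).comp p hg.hasFDerivAt

theorem IsCRNear.isCRDeriv [CompleteSpace E] (h : IsCRNear J JF r g p) (hR : IsTransverse J R)
    (hF : ∀ x, JF (JF x) = -x) (hr : ContDiffAt ℝ 2 r p) (h0 : fderiv ℝ r p ≠ 0)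
    (hg : ContDiffAt ℝ 2 g p) :
    IsCRDeriv J JF (fderiv ℝ r p) (fderiv ℝ (crDeriv J R JF r g) p) := by
  have hr1 : ContDiffAt ℝ 1 r p := hr.of_le (by norm_num)
  have hA : DifferentiableAt ℝ (crDeriv J R JF r g) p :=
    (contDiffAt_crDeriv (m := 1) hR (by exact_mod_cast hr) h0
      (by exact_mod_cast hg)).differentiableAt (by norm_num)
  constructor
  · intro u hu X
    have h1 := (fderiv_clm_apply_const hA (J X)).sub
      (JF.hasFDerivAt.comp p (fderiv_clm_apply_const hA X))
    have h2 := fderiv_eq_zero_of_level hr1 h0 h1.differentiableAt ?_ hu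
    · rw [h1.fderiv] at h2
      exact sub_eq_zero.1 (by simpa using h2)
    · filter_upwards [h, eventually_fderiv_ne_zero hr1 h0] with z hz hz0 hzr
      exact sub_eq_zero.2 (crPart_comm hR hF hz0 (hz hzr) X)
  · intro u v hu hv
    have hN : DifferentiableAt ℝ (crNormal J R JF r g) p :=
      (contDiffAt_crNormal (m := 1) hR (by exact_mod_cast hr) h0
        (by exact_mod_cast hg)).differentiableAt (by norm_num)
    have hr' : DifferentiableAt ℝ (fderiv ℝ r) p :=
      (hr.fderiv_right (m := 1) (by norm_num)).differentiableAt (by norm_num)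
    have hg' : DifferentiableAt ℝ (fderiv ℝ g) p :=
      (hg.fderiv_right (m := 1) (by norm_num)).differentiableAt (by norm_num)
    have key : ∀ u v, fderiv ℝ r p v = 0 → fderiv ℝ (crDeriv J R JF r g) p u v =
        fderiv ℝ (fderiv ℝ g) p u v - fderiv ℝ (fderiv ℝ r) p u v • crNormal J R JF r g p := by
      intro u v hv
      have h1 := fderiv_clm_apply_const hA v
      have h2 := (fderiv_clm_apply_const hg' v).sub
        ((fderiv_clm_apply_const hr' v).smul hN.hasFDerivAt)
      have h3 := congrArg (fun L => L u) (h1.unique h2)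
      simpa [hv] using h3
    rw [key u v hv, key v u hu, (hr.isSymmSndFDerivAt (by simp)).eq u v,
      (hg.isSymmSndFDerivAt (by simp)).eq u v]

/-- The complex linear modification of the derivative of a CR map is again CR. -/
theorem IsCRNear.crDeriv [CompleteSpace E] (h : IsCRNear J JF r g p) (hR : IsTransverse J R)
    (hF : ∀ x, JF (JF x) = -x) (hr : ContDiffAt ℝ 2 r p) (h0 : fderiv ℝ r p ≠ 0)
    (hg : ContDiffAt ℝ 2 g p) : IsCRNear J (postJ E JF) r (crDeriv J R JF r g) p := by
  have hr1 : ContDiffAt ℝ 1 r p := hr.of_le (by norm_num)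
  filter_upwards [h.eventually_nhds, hr.eventually (by simp), hg.eventually (by simp),
    eventually_fderiv_ne_zero hr1 h0] with z h1 h2 h3 h4 hz X hX hX'
  have h5 : IsCRNear J JF r g z := by
    filter_upwards [h1] with y hy hyz
    exact hy (hyz.trans hz)
  exact (h5.isCRDeriv hR hF h2 h4 h3).cr hR h4 hX hX'

end CRDeriv

section Jets

variable {E F : Type*} [NormedAddCommGroup E] [NormedSpace ℝ E] [NormedAddCommGroup F]
  [NormedSpace ℝ F]

/-- Complex linear, symmetric coefficients of a cubic polynomial map. -/
structure IsHolJet (J : E →L[ℝ] E) (JF : F →L[ℝ] F) (a₁ : E →L[ℝ] F) (a₂ : E →L[ℝ] E →L[ℝ] F)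
    (a₃ : E →L[ℝ] E →L[ℝ] E →L[ℝ] F) : Prop where
  comm₁ : ∀ X, a₁ (J X) = JF (a₁ X)
  comm₂ : ∀ X Y, a₂ X (J Y) = JF (a₂ X Y)
  comm₃ : ∀ X Y Z, a₃ X Y (J Z) = JF (a₃ X Y Z)
  symm₂ : ∀ X Y, a₂ X Y = a₂ Y X
  symm₃ : ∀ X Y Z, a₃ X Y Z = a₃ Y X Z
  symm₃' : ∀ X Y Z, a₃ X Y Z = a₃ X Z Y

/-- A cubic polynomial map. -/
noncomputable def cubic (a₀ : F) (a₁ : E →L[ℝ] F) (a₂ : E →L[ℝ] E →L[ℝ] F)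
    (a₃ : E →L[ℝ] E →L[ℝ] E →L[ℝ] F) (v : E) : F :=
  a₀ + a₁ v + (1 / 2 : ℝ) • a₂ v v + (1 / 6 : ℝ) • a₃ v v v

/-- The derivative of `cubic` when the coefficients are symmetric. -/
noncomputable def cubicDeriv (a₁ : E →L[ℝ] F) (a₂ : E →L[ℝ] E →L[ℝ] F)
    (a₃ : E →L[ℝ] E →L[ℝ] E →L[ℝ] F) (v : E) : E →L[ℝ] F :=
  a₁ + a₂ v + (1 / 2 : ℝ) • a₃ v v

variable {J : E →L[ℝ] E} {R : (E →L[ℝ] ℝ) →L[ℝ] E} {JF : F →L[ℝ] F} {r : E → ℝ} {g : E → F}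
  {p : E} {a₀ : F} {a₁ : E →L[ℝ] F} {a₂ : E →L[ℝ] E →L[ℝ] F}
  {a₃ : E →L[ℝ] E →L[ℝ] E →L[ℝ] F}

theorem contDiff_cubic {m : WithTop ℕ∞} : ContDiff ℝ m (cubic a₀ a₁ a₂ a₃) := by
  have h2 : ContDiff ℝ m (fun v => a₂ v v) := a₂.contDiff.clm_apply contDiff_id
  have h3 : ContDiff ℝ m (fun v => a₃ v v v) :=
    (a₃.contDiff.clm_apply contDiff_id).clm_apply contDiff_id
  exact ((contDiff_const.add a₁.contDiff).add (contDiff_const.smul h2)).add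
    (contDiff_const.smul h3)

theorem IsHolJet.hasFDerivAt (h : IsHolJet J JF a₁ a₂ a₃) (v : E) :
    HasFDerivAt (cubic a₀ a₁ a₂ a₃) (cubicDeriv a₁ a₂ a₃ v) v := by
  have h2 := (a₂.hasFDerivAt (x := v)).clm_apply (hasFDerivAt_id v)
  have h3 := ((a₃.hasFDerivAt (x := v)).clm_apply (hasFDerivAt_id v)).clm_apply (hasFDerivAt_id v)
  have h4 := ((((hasFDerivAt_const a₀ v).add (a₁.hasFDerivAt (x := v))).add
    (h2.const_smul (1 / 2 : ℝ))).add (h3.const_smul (1 / 6 : ℝ)))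
  refine h4.congr_fderiv ?_
  ext X
  simp only [cubicDeriv, _root_.add_apply, _root_.smul_apply, _root_.zero_apply,
    ContinuousLinearMap.comp_apply, ContinuousLinearMap.flip_apply, id_eq,
    ContinuousLinearMap.id_apply]
  rw [h.symm₂ X v, h.symm₃ X v v, h.symm₃' v X v]
  module

theorem IsHolJet.comm (h : IsHolJet J JF a₁ a₂ a₃) (v X : E) :
    cubicDeriv a₁ a₂ a₃ v (J X) = JF (cubicDeriv a₁ a₂ a₃ v X) := by
  simp [cubicDeriv, h.comm₁, h.comm₂, h.comm₃]

/-- The coefficients of the third-order jet of a CR map. -/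
theorem IsCRNear.isHolJet [CompleteSpace E] (h : IsCRNear J JF r g p) (hR : IsTransverse J R)
    (hF : ∀ x, JF (JF x) = -x) (hr : ContDiffAt ℝ 3 r p) (h0 : fderiv ℝ r p ≠ 0)
    (hg : ContDiffAt ℝ 3 g p) :
    IsHolJet J JF (SteinnessIndex.crDeriv J R JF r g p)
      (SteinnessIndex.crDeriv J R (postJ E JF) r (SteinnessIndex.crDeriv J R JF r g) p)
      (SteinnessIndex.crDeriv J R (postJ E (postJ E JF)) r
        (SteinnessIndex.crDeriv J R (postJ E JF) r (SteinnessIndex.crDeriv J R JF r g)) p) := by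
  have hr1 : ContDiffAt ℝ 1 r p := hr.of_le (by norm_num)
  have hr2 : ContDiffAt ℝ 2 r p := hr.of_le (by norm_num)
  have hg2 : ContDiffAt ℝ 2 g p := hg.of_le (by norm_num)
  have hF2 := postJ_postJ (E := E) hF
  set g₁ := SteinnessIndex.crDeriv J R JF r g with hg₁
  have hg₁C : ContDiffAt ℝ 2 g₁ p := by
    have := contDiffAt_crDeriv (m := 2) (JF := JF) hR (by exact_mod_cast hr) h0
      (by exact_mod_cast hg)
    exact_mod_cast this
  set g₂ := SteinnessIndex.crDeriv J R (postJ E JF) r g₁ with hg₂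
  have hg₂C : ContDiffAt ℝ 1 g₂ p := by
    have := contDiffAt_crDeriv (m := 1) (JF := postJ E JF) hR (by exact_mod_cast hr2) h0
      (by exact_mod_cast hg₁C)
    exact_mod_cast this
  have hcr1 : IsCRNear J (postJ E JF) r g₁ p := h.crDeriv hR hF hr2 h0 hg2
  have hB1 : ∀ᶠ z in 𝓝 p, r z = r p →
      IsCRDeriv J JF (fderiv ℝ r z) (fderiv ℝ g₁ z) ∧ fderiv ℝ r z ≠ 0 := by
    filter_upwards [h.eventually_nhds, hr2.eventually (by simp), hg2.eventually (by simp),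
      eventually_fderiv_ne_zero hr1 h0] with z h1 h2 h3 h4 hz
    have h5 : IsCRNear J JF r g z := by
      filter_upwards [h1] with y hy hyz
      exact hy (hyz.trans hz)
    exact ⟨h5.isCRDeriv hR hF h2 h4 h3, h4⟩
  have hB1p := (hB1.self_of_nhds rfl).1
  have hB2 : IsCRDeriv J (postJ E JF) (fderiv ℝ r p) (fderiv ℝ g₂ p) :=
    hcr1.isCRDeriv hR hF2 hr2 h0 hg₁C
  set g₃ := SteinnessIndex.crDeriv J R (postJ E (postJ E JF)) r g₂ with hg₃
  have left₃ : ∀ X Y Z, g₃ p (J X) Y Z = JF (g₃ p X Y Z) := fun X Y Z => by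
    have := hB2.crPart_left hR hF2 h0 X
    exact congrArg (fun L => L Y Z) this
  have symm₃ : ∀ X Y, g₃ p X Y = g₃ p Y X := hB2.crPart_symm hR hF2 h0
  have hg₂d : DifferentiableAt ℝ g₂ p := hg₂C.differentiableAt (by norm_num)
  have tang : ∀ u, fderiv ℝ r p u = 0 → ∀ Y Z, g₃ p u Y Z = g₃ p u Z Y := by
    intro u hu Y Z
    have e : g₃ p u = fderiv ℝ g₂ p u := crPart_apply_of_mem hu
    have h1 : ∀ Y Z, HasFDerivAt (fun z => g₂ z Y Z)
        ((ContinuousLinearMap.apply ℝ F Z).comp ((fderiv ℝ g₂ p).flip Y)) p := fun Y Z =>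
      ((ContinuousLinearMap.apply ℝ F Z).hasFDerivAt).comp p (fderiv_clm_apply_const hg₂d Y)
    have h2 := (h1 Y Z).sub (h1 Z Y)
    have h3 := fderiv_eq_zero_of_level hr1 h0 h2.differentiableAt ?_ hu
    · rw [h2.fderiv] at h3
      rw [e]
      exact sub_eq_zero.1 (by simpa using h3)
    · filter_upwards [hB1] with z hz hzr
      exact sub_eq_zero.2 ((hz hzr).1.crPart_symm hR hF (hz hzr).2 Y Z)
  have symm₃' : ∀ X Y Z, g₃ p X Y Z = g₃ p X Z Y := by
    intro X Y Z
    obtain ⟨a, b, t, rfl, h1, -⟩ := hR.exists_decomp h0 X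
    have e : R (fderiv ℝ r p) = -J (J (R (fderiv ℝ r p))) := by rw [hR.sq, neg_neg]
    have h2 : ∀ Y Z, g₃ p (R (fderiv ℝ r p)) Y Z = -JF (g₃ p (J (R (fderiv ℝ r p))) Y Z) := by
      intro Y Z
      rw [← left₃, hR.sq]
      simp
    simp only [map_add, map_smul, _root_.add_apply, _root_.smul_apply, h2, tang t h1 Y Z,
      tang _ (hR.orth _) Y Z]
  refine ⟨crPart_comm hR hF h0 (h.self_of_nhds rfl), hB1p.crPart_right hR hF h0, ?_,
    hB1p.crPart_symm hR hF h0, fun X Y Z => by rw [symm₃], symm₃'⟩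
  intro X Y Z
  rw [symm₃', symm₃, left₃, symm₃, symm₃']

end Jets

section CRPoint

variable {E F : Type*} [NormedAddCommGroup E] [NormedSpace ℝ E] [NormedAddCommGroup F]
  [NormedSpace ℝ F]

theorem continuousAt_cubicDeriv {X : Type*} [TopologicalSpace X] {x : X} {b₁ : X → E →L[ℝ] F}
    {b₂ : X → E →L[ℝ] E →L[ℝ] F} {b₃ : X → E →L[ℝ] E →L[ℝ] E →L[ℝ] F} {v : X → E}
    (h₁ : ContinuousAt b₁ x) (h₂ : ContinuousAt b₂ x) (h₃ : ContinuousAt b₃ x)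
    (hv : ContinuousAt v x) : ContinuousAt (fun y => cubicDeriv (b₁ y) (b₂ y) (b₃ y) (v y)) x := by
  have h4 : ContinuousAt (fun y => b₂ y (v y)) x := h₂.clm_apply hv
  have h5 : ContinuousAt (fun y => b₃ y (v y)) x := 
    ContinuousAt.comp (f := fun y => (b₃ y, v y))
      (isBoundedBilinearMap_apply (𝕜 := ℝ) (E := E)
        (F := E →L[ℝ] E →L[ℝ] F)).continuous.continuousAt (h₃.prodMk hv)
  have h6 : ContinuousAt (fun y => b₃ y (v y) (v y)) x := h5.clm_apply hv
  unfold cubicDeriv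
  exact (h₁.add h4).add (h6.const_smul (1 / 2 : ℝ))

/-- A point `p` of a regular level set of `r` near which `f` is a CR map of class `C³`. -/
structure IsCRPoint (J : E →L[ℝ] E) (R : (E →L[ℝ] ℝ) →L[ℝ] E) (JF : F →L[ℝ] F) (r : E → ℝ)
    (f : E → F) (p : E) : Prop where
  trans : IsTransverse J R
  sq : ∀ x, JF (JF x) = -x
  smooth_r : ContDiffAt ℝ 3 r p
  ne_zero : fderiv ℝ r p ≠ 0
  zero : r p = 0
  smooth_f : ContDiffAt ℝ 3 f p
  cr : IsCRNear J JF r f p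

variable (J : E →L[ℝ] E) (R : (E →L[ℝ] ℝ) →L[ℝ] E) (JF : F →L[ℝ] F) (r : E → ℝ) (f : E → F)

/-- The second CR derivative. -/
noncomputable def crDeriv₂ : E → E →L[ℝ] E →L[ℝ] F :=
  crDeriv J R (postJ E JF) r (crDeriv J R JF r f)

/-- The third CR derivative. -/
noncomputable def crDeriv₃ : E → E →L[ℝ] E →L[ℝ] E →L[ℝ] F :=
  crDeriv J R (postJ E (postJ E JF)) r (crDeriv₂ J R JF r f)

/-- The third-order Taylor polynomial of a CR map, built from its CR derivatives. -/
noncomputable def crPoly (p z : E) : F :=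
  cubic (f p) (crDeriv J R JF r f p) (crDeriv₂ J R JF r f p) (crDeriv₃ J R JF r f p) (z - p)

/-- The first-order holomorphic extension of a CR map. -/
noncomputable def crExt (z : E) : F := f z - r z • crNormal J R JF r f z

variable {J R JF r f} {p : E}

namespace IsCRPoint

theorem eventually (h : IsCRPoint J R JF r f p) :
    ∀ᶠ z in 𝓝 p, r z = 0 → IsCRPoint J R JF r f z := by
  filter_upwards [h.cr.eventually_nhds, h.smooth_r.eventually (by simp),
    h.smooth_f.eventually (by simp),
    eventually_fderiv_ne_zero (h.smooth_r.of_le (by norm_num)) h.ne_zero] with z h1 h2 h3 h4 hz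
  refine ⟨h.trans, h.sq, h2, h4, hz, h3, ?_⟩
  filter_upwards [h1] with y hy hyz
  exact hy (by rw [hyz, hz, h.zero])

theorem contDiffAt_r_one (h : IsCRPoint J R JF r f p) : ContDiffAt ℝ 1 r p :=
  h.smooth_r.of_le (by norm_num)

theorem contDiffAt₁ (h : IsCRPoint J R JF r f p) : ContDiffAt ℝ 2 (crDeriv J R JF r f) p := by
  have := contDiffAt_crDeriv (m := 2) (JF := JF) h.trans (by exact_mod_cast h.smooth_r) h.ne_zero
    (by exact_mod_cast h.smooth_f)
  exact_mod_cast this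

theorem contDiffAt₂ (h : IsCRPoint J R JF r f p) : ContDiffAt ℝ 1 (crDeriv₂ J R JF r f) p := by
  have := contDiffAt_crDeriv (m := 1) (JF := postJ E JF) h.trans
    (by exact_mod_cast (h.smooth_r.of_le (by norm_num) : ContDiffAt ℝ 2 r p)) h.ne_zero
    (by exact_mod_cast h.contDiffAt₁)
  exact_mod_cast this

theorem continuousAt₃ (h : IsCRPoint J R JF r f p) : ContinuousAt (crDeriv₃ J R JF r f) p := by
  have := contDiffAt_crDeriv (m := 0) (JF := postJ E (postJ E JF)) h.trans
    (by exact_mod_cast h.contDiffAt_r_one) h.ne_zero (by exact_mod_cast h.contDiffAt₂)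
  exact this.continuousAt

theorem isHolJet [CompleteSpace E] (h : IsCRPoint J R JF r f p) :
    IsHolJet J JF (crDeriv J R JF r f p) (crDeriv₂ J R JF r f p) (crDeriv₃ J R JF r f p) :=
  h.cr.isHolJet h.trans h.sq h.smooth_r h.ne_zero h.smooth_f

theorem hasFDerivAt_crPoly [CompleteSpace E] (h : IsCRPoint J R JF r f p) (z : E) :
    HasFDerivAt (crPoly J R JF r f p)
      (cubicDeriv (crDeriv J R JF r f p) (crDeriv₂ J R JF r f p) (crDeriv₃ J R JF r f p) (z - p))
      z := by
  have := (h.isHolJet.hasFDerivAt (a₀ := f p) (z - p)).comp z ((hasFDerivAt_id z).sub_const p)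
  rwa [ContinuousLinearMap.comp_id] at this

theorem contDiffAt_crNormal (h : IsCRPoint J R JF r f p) :
    ContDiffAt ℝ 2 (crNormal J R JF r f) p := by
  have := SteinnessIndex.contDiffAt_crNormal (m := 2) (JF := JF) h.trans
    (by exact_mod_cast h.smooth_r) h.ne_zero (by exact_mod_cast h.smooth_f)
  exact_mod_cast this

theorem contDiffAt_crExt (h : IsCRPoint J R JF r f p) : ContDiffAt ℝ 2 (crExt J R JF r f) p :=
  (h.smooth_f.of_le (by norm_num)).sub ((h.smooth_r.of_le (by norm_num)).smul
    h.contDiffAt_crNormal)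

theorem crExt_eq (h : IsCRPoint J R JF r f p) : crExt J R JF r f p = f p := by
  simp [crExt, h.zero]

theorem fderiv_crExt (h : IsCRPoint J R JF r f p) :
    fderiv ℝ (crExt J R JF r f) p = crDeriv J R JF r f p := by
  have h1 := (h.smooth_r.differentiableAt (by norm_num)).hasFDerivAt
  have h2 := (h.contDiffAt_crNormal.differentiableAt (by norm_num)).hasFDerivAt
  have h3 := (h.smooth_f.differentiableAt (by norm_num)).hasFDerivAt
  have h4 : HasFDerivAt (crExt J R JF r f) _ p := h3.sub (h1.smul h2)
  rw [h4.fderiv, crDeriv_eq, h.zero, zero_smul, zero_add]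

/-- The Taylor polynomial approximates the extension. -/
theorem jet [CompleteSpace E] (h : IsCRPoint J R JF r f p) {e : ℝ} (he : 0 < e) :
    ∃ t > 0, ∀ q, dist q p < t → r q = 0 → ∀ z, dist z q < t →
      ‖crPoly J R JF r f q z - crExt J R JF r f z‖ ≤ e * dist z q ∧
      ‖fderiv ℝ (crPoly J R JF r f q) z - fderiv ℝ (crExt J R JF r f) z‖ ≤ e := by
  have hc : ContinuousAt (fun x : E × E => cubicDeriv (crDeriv J R JF r f x.1)
      (crDeriv₂ J R JF r f x.1) (crDeriv₃ J R JF r f x.1) (x.2 - x.1) -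
      fderiv ℝ (crExt J R JF r f) x.2) (p, p) := by
    have h1 : ContinuousAt (fun x : E × E => crDeriv J R JF r f x.1) (p, p) :=
      ContinuousAt.comp (f := Prod.fst) (x := (p, p)) h.contDiffAt₁.continuousAt continuousAt_fst
    have h2 : ContinuousAt (fun x : E × E => crDeriv₂ J R JF r f x.1) (p, p) :=
      ContinuousAt.comp (f := Prod.fst) (x := (p, p)) h.contDiffAt₂.continuousAt continuousAt_fst
    have h3 : ContinuousAt (fun x : E × E => crDeriv₃ J R JF r f x.1) (p, p) :=
      ContinuousAt.comp (f := Prod.fst) (x := (p, p)) h.continuousAt₃ continuousAt_fst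
    have h4 : ContinuousAt (fun x : E × E => fderiv ℝ (crExt J R JF r f) x.2) (p, p) :=
      ContinuousAt.comp (f := Prod.snd) (x := (p, p))
        (h.contDiffAt_crExt.continuousAt_fderiv (by norm_num)) continuousAt_snd
    have h5 : ContinuousAt (fun x : E × E => x.2 - x.1) (p, p) := by fun_prop
    exact (continuousAt_cubicDeriv h1 h2 h3 h5).sub h4
  have h0 : cubicDeriv (crDeriv J R JF r f p) (crDeriv₂ J R JF r f p) (crDeriv₃ J R JF r f p)
      (p - p) - fderiv ℝ (crExt J R JF r f) p = 0 := by
    rw [h.fderiv_crExt]; simp [cubicDeriv]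
  have hlt := hc.norm.eventually_lt (g := fun _ => e) continuousAt_const (by simp only [h0, norm_zero]; exact he)
  rw [nhds_prod_eq] at hlt
  obtain ⟨s, hs, h1⟩ := (nhds_basis_ball.prod_self.eventually_iff).1 hlt
  obtain ⟨s', hs', h2⟩ := Metric.eventually_nhds_iff.1 h.eventually
  obtain ⟨s'', hs'', h3⟩ := Metric.eventually_nhds_iff.1
    (h.contDiffAt_crExt.eventually (by simp))
  set t := min (min s s') s'' / 2 with ht
  have htpos : 0 < t := by positivity
  have hts : 2 * t ≤ s := by
    rw [ht, mul_div_cancel₀ _ (by norm_num)]; exact (min_le_left _ _).trans (min_le_left _ _)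
  have hts' : 2 * t ≤ s' := by
    rw [ht, mul_div_cancel₀ _ (by norm_num)]; exact (min_le_left _ _).trans (min_le_right _ _)
  have hts'' : 2 * t ≤ s'' := by
    rw [ht, mul_div_cancel₀ _ (by norm_num)]; exact min_le_right _ _
  refine ⟨t, htpos, fun q hq hrq => ?_⟩
  have hqp := h2 (by linarith : dist q p < s') hrq
  have hD : ∀ z, dist z q < t →
      ‖fderiv ℝ (crPoly J R JF r f q) z - fderiv ℝ (crExt J R JF r f) z‖ ≤ e := by
    intro z hz
    rw [(hqp.hasFDerivAt_crPoly z).fderiv]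
    have := dist_triangle z q p
    exact (h1 (x := (q, z)) ⟨show dist q p < s by linarith, show dist z p < s by linarith⟩).le
  intro z hz
  refine ⟨?_, hD z hz⟩
  have hdx : ∀ x ∈ ball q t, DifferentiableAt ℝ (crExt J R JF r f) x := fun x hx => by
    have := dist_triangle x q p
    exact (h3 (by linarith [mem_ball.1 hx] : dist x p < s'')).differentiableAt (by norm_num)
  have h4 := (convex_ball q t).norm_image_sub_le_of_norm_fderiv_le (𝕜 := ℝ)
    (f := fun z => crPoly J R JF r f q z - crExt J R JF r f z) (C := e)
    (fun x hx => (hqp.hasFDerivAt_crPoly x).differentiableAt.sub (hdx x hx))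
    (fun x hx => by
      have e1 := ((hqp.hasFDerivAt_crPoly x).differentiableAt.hasFDerivAt.sub
        (hdx x hx).hasFDerivAt).fderiv
      rw [show (fun z => crPoly J R JF r f q z - crExt J R JF r f z) =
        crPoly J R JF r f q - crExt J R JF r f from rfl, e1]
      exact hD x hx) (mem_ball_self htpos) hz
  have h5 : crPoly J R JF r f q q - crExt J R JF r f q = 0 := by
    rw [hqp.crExt_eq]; simp [crPoly, cubic]
  simp only [h5, sub_zero] at h4
  rwa [← dist_eq_norm z q] at h4

end IsCRPoint

end CRPoint

section MovingJet

set_option maxSynthPendingDepth 3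

variable {E F : Type*} [NormedAddCommGroup E] [NormedSpace ℝ E] [NormedAddCommGroup F]
  [NormedSpace ℝ F] {J : E →L[ℝ] E} {R : (E →L[ℝ] ℝ) →L[ℝ] E} {JF : F →L[ℝ] F} {r : E → ℝ}
  {f : E → F} {p : E}

theorem norm_apply_three_le (C : E →L[ℝ] E →L[ℝ] E →L[ℝ] F) (x y z : E) :
    ‖C x y z‖ ≤ ‖C‖ * ‖x‖ * ‖y‖ * ‖z‖ :=
  ((C x y).le_opNorm z).trans (mul_le_mul_of_nonneg_right (C.le_opNorm₂ x y) (norm_nonneg _))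

/-- The Taylor polynomial with a frozen cubic term, differentiated in the base point. -/
theorem IsCRPoint.hasFDerivAt_moving [CompleteSpace E] (h : IsCRPoint J R JF r f p)
    {C : E →L[ℝ] E →L[ℝ] E →L[ℝ] F} (hC : ∀ X Y Z, C X Y Z = C Y X Z)
    (hC' : ∀ X Y Z, C X Y Z = C X Z Y) (z : E) :
    ∃ L : E →L[ℝ] F, HasFDerivAt (fun q => cubic (f q) (crDeriv J R JF r f q)
      (crDeriv₂ J R JF r f q) C (z - q)) L p ∧ ∀ u, fderiv ℝ r p u = 0 →
      L u = (1 / 2 : ℝ) • (crDeriv₃ J R JF r f p - C) u (z - p) (z - p) := by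
  have h0 := (h.smooth_f.differentiableAt (by norm_num)).hasFDerivAt
  have h1 := (h.contDiffAt₁.differentiableAt (by norm_num)).hasFDerivAt
  have h2 := (h.contDiffAt₂.differentiableAt (by norm_num)).hasFDerivAt
  have hv : HasFDerivAt (fun q => z - q) (-ContinuousLinearMap.id ℝ E) p :=
    (hasFDerivAt_id p).const_sub z
  have h3 := (C.hasFDerivAt (x := z - p)).comp p hv
  have a1 := h1.clm_apply hv
  have a2 := (h2.clm_apply hv).clm_apply hv
  have a3 := (h3.clm_apply hv).clm_apply hv
  refine ⟨_, ((h0.add a1).add (a2.const_smul (1 / 2 : ℝ))).add (a3.const_smul (1 / 6 : ℝ)),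
    fun u hu => ?_⟩
  have e0 : fderiv ℝ f p u = crDeriv J R JF r f p u := (crPart_apply_of_mem hu).symm
  have e1 : fderiv ℝ (crDeriv J R JF r f) p u = crDeriv₂ J R JF r f p u :=
    (crPart_apply_of_mem hu).symm
  have e2 : fderiv ℝ (crDeriv₂ J R JF r f) p u = crDeriv₃ J R JF r f p u :=
    (crPart_apply_of_mem hu).symm
  simp only [_root_.add_apply, _root_.smul_apply, _root_.sub_apply, _root_.neg_apply,
    ContinuousLinearMap.comp_apply, ContinuousLinearMap.flip_apply, Function.comp_apply,
    ContinuousLinearMap.id_apply, map_neg, e0, e1, e2]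
  rw [h.isHolJet.symm₂ (z - p) u, hC' (z - p) (z - p) u, hC (z - p) u (z - p)]
  module

/-- Taylor polynomials of a CR map at nearby points agree to third order. -/
theorem IsCRPoint.jet3 [CompleteSpace E] (h : IsCRPoint J R JF r f p) {e : ℝ} (he : 0 < e) :
    ∃ t₀ > 0, ∀ q q', dist q p < t₀ → dist q' p < t₀ → r q = 0 → r q' = 0 → ∀ z t, t < t₀ →
      dist z q ≤ t → dist z q' ≤ t →
      ‖crPoly J R JF r f q z - crPoly J R JF r f q' z‖ ≤ e * t ^ 3 := by
  obtain ⟨σ, hσ⟩ := exists_isStraightening h.contDiffAt_r_one h.ne_zero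
  obtain ⟨Θ, hΘ, hΘp, hinv⟩ := hσ.inv
  have hid : ‖ContinuousLinearMap.id ℝ E‖₊ < 2 :=
    lt_of_le_of_lt (by exact_mod_cast ContinuousLinearMap.norm_id_le) one_lt_two
  obtain ⟨s₁, hs₁, hlσ⟩ := hσ.strict.exists_lipschitzOnWith_of_nnnorm_lt 2 hid
  obtain ⟨s₂, hs₂, hlΘ⟩ := hΘ.exists_lipschitzOnWith_of_nnnorm_lt 2 hid
  set e' := e / 325 with he'
  have he'0 : 0 < e' := by positivity
  have hcl : ∀ᶠ q in 𝓝 p, ‖crDeriv₃ J R JF r f q - crDeriv₃ J R JF r f p‖ < e' := by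
    have := (h.continuousAt₃.sub (continuousAt_const (y := crDeriv₃ J R JF r f p))).norm
    exact this.eventually_lt (g := fun _ => e') continuousAt_const
      (show ‖crDeriv₃ J R JF r f p - crDeriv₃ J R JF r f p‖ < e' by
        rw [sub_self, norm_zero]; exact he'0)
  obtain ⟨ε, hε, hε'⟩ := Metric.eventually_nhds_iff.1 (hcl.and h.eventually)
  obtain ⟨δ', hδ', hδ''⟩ := Metric.eventually_nhds_iff.1
    ((hσ.smooth.and hσ.level).and (eventually_of_mem hs₁ fun _ h => h))
  set δ := min δ' (ε / 2) with hδ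
  have hδ0 : 0 < δ := by positivity
  obtain ⟨τ, hτ, hτ'⟩ := Metric.eventually_nhds_iff.1
    (hinv.and (eventually_of_mem hs₂ fun _ h => h))
  set t₀ := min (min τ (δ / 2)) ε with ht₀
  have ht₀0 : 0 < t₀ := by positivity
  have ht₀1 : t₀ ≤ τ := (min_le_left _ _).trans (min_le_left _ _)
  have ht₀2 : 2 * t₀ ≤ δ := by
    have : t₀ ≤ δ / 2 := (min_le_left _ _).trans (min_le_right _ _)
    linarith
  have ht₀3 : t₀ ≤ ε := min_le_right _ _
  have hδ1 : δ ≤ δ' := min_le_left _ _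
  have hδ2 : 2 * δ ≤ ε := by
    have : δ ≤ ε / 2 := min_le_right _ _
    linarith
  clear_value e' δ t₀
  have hsΘ : ∀ q, dist q p < t₀ → dist (Θ q) 0 < δ ∧ σ (Θ q) = q ∧
      (r q = 0 → fderiv ℝ r p (Θ q) = 0) ∧ q ∈ s₂ := by
    intro q hq
    obtain ⟨⟨b1, b2⟩, b3⟩ := hτ' (hq.trans_le ht₀1)
    refine ⟨?_, b1, fun hr => ?_, b3⟩
    · have := hlΘ.dist_le_mul q b3 p (mem_of_mem_nhds hs₂)
      rw [hΘp] at this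
      push_cast at this
      linarith
    · rw [h.zero, zero_add] at b2
      rw [← b2, hr]
  refine ⟨t₀, ht₀0, fun q q' hq hq' hrq hrq' z t ht hzq hzq' => ?_⟩

  have ht0 : 0 ≤ t := dist_nonneg.trans hzq
  obtain ⟨c1, c2, c3, c4⟩ := hsΘ q hq
  obtain ⟨c1', c2', c3', c4'⟩ := hsΘ q' hq'
  set y := Θ q with hy
  set y' := Θ q' with hy'
  have hyy : ‖y' - y‖ ≤ 4 * t := by
    have h1 := hlΘ.dist_le_mul q' c4' q c4
    have h2 := dist_triangle q' z q
    rw [dist_comm q' z] at h2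
    rw [← dist_eq_norm]
    push_cast at h1
    linarith
  clear_value y y'
  set C := crDeriv₃ J R JF r f p with hC
  have hCs := h.isHolJet
  set c : ℝ → E := fun s => y + s • (y' - y) with hc
  have hcd : ∀ s, HasDerivAt c (y' - y) s := fun s => by
    have h1 := ((hasDerivAt_id s).smul_const (y' - y)).const_add y
    rw [one_smul] at h1
    exact h1
  have hcb : ∀ s ∈ Icc (0 : ℝ) 1, dist (c s) 0 < δ := by
    intro s hs
    have := (convex_ball (0 : E) δ) (mem_ball.2 c1) (mem_ball.2 c1')
      (sub_nonneg.2 hs.2) hs.1 (by ring)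
    have e1 : c s = (1 - s) • y + s • y' := by simp only [hc]; module
    rw [e1]
    exact mem_ball.1 this
  have hℓc : ∀ s, fderiv ℝ r p (c s) = 0 := fun s => by simp [hc, c3 hrq, c3' hrq']
  have hσlip : ∀ x ∈ ball (0 : E) δ, ∀ x' ∈ ball (0 : E) δ, dist (σ x) (σ x') ≤ 2 * dist x x' := by
    intro x hx x' hx'
    have := hlσ.dist_le_mul x (hδ'' ((mem_ball.1 hx).trans_le hδ1)).2 x'
      (hδ'' ((mem_ball.1 hx').trans_le hδ1)).2
    exact_mod_cast this
  set Q : E → F := fun q => cubic (f q) (crDeriv J R JF r f q) (crDeriv₂ J R JF r f q) C (z - q)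
    with hQ
  have hdist : ∀ s ∈ Icc (0 : ℝ) 1, ‖z - σ (c s)‖ ≤ 9 * t := by
    intro s hs
    have h1 := hσlip y (mem_ball.2 c1) (c s) (mem_ball.2 (hcb s hs))
    have h2 : dist y (c s) ≤ ‖y' - y‖ := by
      rw [dist_eq_norm, hc, sub_add_cancel_left, norm_neg, norm_smul, Real.norm_eq_abs,
        abs_of_nonneg hs.1]
      exact mul_le_of_le_one_left (norm_nonneg _) hs.2
    rw [c2] at h1
    have h3 := dist_triangle z q (σ (c s))
    rw [← dist_eq_norm]
    linarith
  have key : ∀ s ∈ Icc (0 : ℝ) 1, ∃ D, HasDerivAt (fun s => Q (σ (c s))) D s ∧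
      ‖D‖ ≤ 324 * e' * t ^ 3 := by
    intro s hs
    have hb := hcb s hs
    obtain ⟨⟨d1, d2⟩, d3⟩ := hδ'' (hb.trans_le hδ1)
    have hγ : HasDerivAt (fun s => σ (c s)) (fderiv ℝ σ (c s) (y' - y)) s :=
      d1.hasFDerivAt.comp_hasDerivAt s (hcd s)
    have hγp : dist (σ (c s)) p < ε := by
      have := hσlip (c s) (mem_ball.2 hb) 0 (mem_ball_self hδ0)
      rw [hσ.zero] at this
      linarith
    have hr0 : r (σ (c s)) = 0 := by rw [d2, h.zero, hℓc, add_zero]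
    obtain ⟨f1, f2⟩ := hε' hγp
    have hpt := f2 hr0
    obtain ⟨L, hL, hL'⟩ := hpt.hasFDerivAt_moving hCs.symm₃ hCs.symm₃' z
    have hlip : ‖fderiv ℝ σ (c s)‖ ≤ 2 := by
      have : LipschitzOnWith 2 σ (ball 0 δ) := LipschitzOnWith.of_dist_le_mul
        fun x hx x' hx' => by exact_mod_cast hσlip x hx x' hx'
      exact_mod_cast norm_fderiv_le_of_lipschitzOn ℝ (isOpen_ball.mem_nhds (mem_ball.2 hb)) this
    set X := fderiv ℝ σ (c s) (y' - y) with hX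
    have hXn : ‖X‖ ≤ 8 * t := by
      have h1 := (fderiv ℝ σ (c s)).le_of_opNorm_le hlip (y' - y)
      linarith
    have htan : fderiv ℝ r (σ (c s)) X = 0 := by
      have h1 := (hpt.smooth_r.differentiableAt (by norm_num)).hasFDerivAt.comp_hasDerivAt s hγ
      have h2 : (r ∘ fun s => σ (c s)) =ᶠ[𝓝 s] fun _ => 0 := by
        have h3 := (hcd s).continuousAt.eventually (isOpen_ball.mem_nhds (mem_ball.2 hb))
        filter_upwards [h3] with s' hs'
        rw [Function.comp_apply, (hδ'' (hs'.trans_le hδ1)).1.2, h.zero, hℓc, add_zero]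
      exact h1.unique ((hasDerivAt_const s (0 : ℝ)).congr_of_eventuallyEq h2)
    have hQd := hL.comp_hasDerivAt s hγ
    refine ⟨L X, hQd, ?_⟩
    rw [hL' X htan, norm_smul]
    have h1 := norm_apply_three_le (crDeriv₃ J R JF r f (σ (c s)) - C) X (z - σ (c s))
      (z - σ (c s))
    have h2 := hdist s hs
    have h3 : ‖crDeriv₃ J R JF r f (σ (c s)) - C‖ * ‖X‖ * ‖z - σ (c s)‖ * ‖z - σ (c s)‖ ≤
        e' * (8 * t) * (9 * t) * (9 * t) := by gcongr
    rw [Real.norm_of_nonneg (by norm_num)]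
    linarith
  choose! D hD hD' using key
  have hmv := norm_image_sub_le_of_norm_deriv_le_segment_01' (f := fun s => Q (σ (c s)))
    (fun s hs => (hD s hs).hasDerivWithinAt) (fun s hs => hD' s (Ico_subset_Icc_self hs))
  have hfrozen : ∀ q, dist q p < t₀ → dist z q ≤ t →
      ‖crPoly J R JF r f q z - Q q‖ ≤ e' / 6 * t ^ 3 := by
    intro q hq hzq
    have e1 : crPoly J R JF r f q z - Q q =
        (1 / 6 : ℝ) • (crDeriv₃ J R JF r f q - C) (z - q) (z - q) (z - q) := by
      simp only [crPoly, cubic, hQ, _root_.sub_apply]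
      module
    have h1 := norm_apply_three_le (crDeriv₃ J R JF r f q - C) (z - q) (z - q) (z - q)
    have h2 := (hε' (hq.trans_le ht₀3)).1.le
    rw [dist_eq_norm] at hzq
    have h3 : ‖crDeriv₃ J R JF r f q - C‖ * ‖z - q‖ * ‖z - q‖ * ‖z - q‖ ≤ e' * t * t * t := by
      gcongr
    rw [e1, norm_smul, Real.norm_of_nonneg (by norm_num)]
    linarith
  have hq1 := hfrozen q hq hzq
  have hq2 := hfrozen q' hq' hzq'
  have e0 : c 0 = y := by simp [hc]
  have e1 : c 1 = y' := by simp [hc]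
  simp only [e0, e1, c2, c2'] at hmv
  have htri : ‖crPoly J R JF r f q z - crPoly J R JF r f q' z‖ ≤
      ‖crPoly J R JF r f q z - Q q‖ + ‖Q q' - Q q‖ + ‖crPoly J R JF r f q' z - Q q'‖ := by
    have : crPoly J R JF r f q z - crPoly J R JF r f q' z = (crPoly J R JF r f q z - Q q) -
      (Q q' - Q q) - (crPoly J R JF r f q' z - Q q') := by abel
    rw [this]
    exact (norm_sub_le _ _).trans (add_le_add_left (norm_sub_le _ _) _)
  have hee : e * t ^ 3 = 325 * (e' * t ^ 3) := by rw [he']; ring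
  have : 0 ≤ e' * t ^ 3 := by positivity
  linarith

end MovingJet

section Uniform

set_option maxSynthPendingDepth 3

variable {E F : Type*} [NormedAddCommGroup E] [NormedSpace ℝ E] [NormedAddCommGroup F]
  [NormedSpace ℝ F]

theorem exists_uniform_ball {X : Type*} [PseudoMetricSpace X] {M : Set X} (hM : IsCompact M)
    {Good : Set X → Prop} (hmono : ∀ s t, s ⊆ t → Good t → Good s)
    (h : ∀ p ∈ M, ∃ s > 0, Good (ball p s)) : ∃ t > 0, ∀ p ∈ M, Good (ball p t) := by
  choose! s hs hg using h
  obtain ⟨t, ht, h⟩ := lebesgue_number_lemma_of_metric (c := fun p : M => ball (p : X) (s p)) hM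
    (fun p => isOpen_ball) fun p hp => mem_iUnion.2 ⟨⟨p, hp⟩, mem_ball_self (hs p hp)⟩
  refine ⟨t, ht, fun p hp => ?_⟩
  obtain ⟨q, hq⟩ := h p hp
  exact hmono _ _ hq (hg q q.2)

theorem exists_dist_lt_of_nhdsSet {X : Type*} [PseudoMetricSpace X] {M : Set X} (hM : IsCompact M)
    {Q : X → Prop} (h : ∀ᶠ z in 𝓝ˢ M, Q z) : ∃ t > 0, ∀ p ∈ M, ∀ z, dist z p < t → Q z := by
  refine exists_uniform_ball hM (Good := fun B => ∀ z, z ∈ B → Q z)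
    (fun s t hst ht z hz => ht z (hst hz)) fun p hp => ?_
  obtain ⟨s, hs, h⟩ := Metric.eventually_nhds_iff.1 (eventually_nhdsSet_iff_forall.1 h p hp)
  exact ⟨s, hs, fun z hz => h hz⟩

theorem exists_fderiv_bound {f : E → F} {M : Set E} (hM : IsCompact M)
    (hf : ∀ p ∈ M, ContDiffAt ℝ 1 f p) : ∃ K, 0 ≤ K ∧ ∃ t > 0, ∀ p ∈ M, ∀ z, dist z p < t →
      DifferentiableAt ℝ f z ∧ ‖fderiv ℝ f z‖ ≤ K := by
  have hc : ContinuousOn (fun z => fderiv ℝ f z) M := fun p hp =>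
    ((hf p hp).continuousAt_fderiv (by norm_num)).continuousWithinAt
  obtain ⟨K, hK⟩ := hM.exists_bound_of_continuousOn hc
  refine ⟨max K 0 + 1, by positivity, exists_dist_lt_of_nhdsSet hM ?_⟩
  refine eventually_nhdsSet_iff_forall.2 fun p hp => ?_
  have h1 := ((hf p hp).continuousAt_fderiv (by norm_num)).norm.eventually_lt
    (g := fun _ => max K 0 + 1) continuousAt_const
    (show ‖fderiv ℝ f p‖ < max K 0 + 1 by linarith [hK p hp, le_max_left K 0])
  filter_upwards [h1, (hf p hp).eventually (by simp)] with z hz hz'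
  exact ⟨hz'.differentiableAt (by norm_num), hz.le⟩

theorem exists_fderiv_osc {f : E → F} {M : Set E} (hM : IsCompact M)
    (hf : ∀ p ∈ M, ContDiffAt ℝ 1 f p) {e : ℝ} (he : 0 < e) : ∃ t > 0, ∀ p ∈ M, ∀ x y,
      dist x p < t → dist y p < t → ‖fderiv ℝ f x - fderiv ℝ f y‖ ≤ e := by
  obtain ⟨t, ht, h⟩ := exists_uniform_ball hM (Good := fun B => ∀ x ∈ B, ∀ y ∈ B,
    ‖fderiv ℝ f x - fderiv ℝ f y‖ ≤ e)
    (fun s t hst ht x hx y hy => ht x (hst hx) y (hst hy)) fun p hp => by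
      obtain ⟨s, hs, h⟩ := Metric.continuousAt_iff.1
        ((hf p hp).continuousAt_fderiv (by norm_num)) (e / 2) (half_pos he)
      refine ⟨s, hs, fun x hx y hy => ?_⟩
      have h1 := h hx
      have h2 := h hy
      have := dist_triangle_right (fderiv ℝ f x) (fderiv ℝ f y) (fderiv ℝ f p)
      rw [← dist_eq_norm]
      linarith
  exact ⟨t, ht, fun p hp x y hx hy => h p hp x hx y hy⟩

theorem exists_uniform_lower {X : Type*} [PseudoMetricSpace X] {M W : Set X} (hM : IsCompact M)
    {u v : X → ℝ} (hv : ∀ x, 0 ≤ v x)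
    (h : ∀ p ∈ M, ∃ c > 0, ∀ᶠ z in 𝓝 p, z ∈ W → c * v z ≤ u z) :
    ∃ c > 0, ∀ᶠ z in 𝓝ˢ M, z ∈ W → c * v z ≤ u z := by
  refine hM.induction_on (p := fun s => ∃ c > 0, ∀ᶠ z in 𝓝ˢ s, z ∈ W → c * v z ≤ u z) ?_ ?_ ?_ ?_
  · exact ⟨1, one_pos, by simp⟩
  · rintro s t hst ⟨c, hc, h⟩
    exact ⟨c, hc, h.filter_mono (nhdsSet_mono hst)⟩
  · rintro s t ⟨c, hc, h⟩ ⟨c', hc', h'⟩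
    refine ⟨min c c', lt_min hc hc', ?_⟩
    rw [nhdsSet_union, eventually_sup]
    constructor
    · filter_upwards [h] with z hz hzW
      exact (mul_le_mul_of_nonneg_right (min_le_left _ _) (hv z)).trans (hz hzW)
    · filter_upwards [h'] with z hz hzW
      exact (mul_le_mul_of_nonneg_right (min_le_right _ _) (hv z)).trans (hz hzW)
  · intro p hp
    obtain ⟨c, hc, h⟩ := h p hp
    refine ⟨_, mem_nhdsWithin_of_mem_nhds (eventually_eventually_nhds.2 h), c, hc, ?_⟩
    exact eventually_nhdsSet_iff_forall.2 fun q hq => hq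

variable {J : E →L[ℝ] E} {R : (E →L[ℝ] ℝ) →L[ℝ] E} {r : E → ℝ} {f : E → E} {M W : Set E}
  {ρ : E → ℝ} {η : ℝ}

/-- The approximation data provided by a CR map of class `C³` along a compact hypersurface. -/
theorem exists_jetData [CompleteSpace E] (hM : IsCompact M) (hM0 : M.Nonempty)
    (hp : ∀ p ∈ M, IsCRPoint J R J r f p) (hW : IsOpen W) (hpos : ∀ z ∈ W, 0 < infDist z M)
    (h0 : ∀ p ∈ M, ρ (f p) = 0) (hρ : ∀ p ∈ M, ContDiffAt ℝ 1 ρ (f p))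
    (hpsh : ∀ᶠ x in 𝓝ˢ (f '' M), 0 < ρ x →
      C2At (fun w => ρ w ^ η) x ∧ ∀ X, 0 ≤ lap J (fun w => ρ w ^ η) x X)
    (hlow : ∀ p ∈ M, ∃ c > 0, ∀ᶠ z in 𝓝 p, z ∈ W → c * infDist z M ≤ ρ (crExt J R J r f z)) :
    ∃ K c, JetData J M W ρ η (crExt J R J r f) (crPoly J R J r f) K c := by
  have hfM : IsCompact (f '' M) := hM.image_of_continuousOn fun p hpM =>
    (hp p hpM).smooth_f.continuousAt.continuousWithinAt
  have hρ' : ∀ q ∈ f '' M, ContDiffAt ℝ 1 ρ q := by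
    rintro _ ⟨p, hpM, rfl⟩; exact hρ p hpM
  obtain ⟨K₁, hK₁, t₁, ht₁, h₁⟩ := exists_fderiv_bound (f := crExt J R J r f) hM fun p hpM =>
    (hp p hpM).contDiffAt_crExt.of_le (by norm_num)
  obtain ⟨K₂, hK₂, t₂, ht₂, h₂⟩ := exists_fderiv_bound hfM hρ'
  obtain ⟨c, hc, hcl⟩ := exists_uniform_lower hM (fun _ => infDist_nonneg) hlow
  have hF : ∀ p ∈ M, crExt J R J r f p = f p := fun p hpM => (hp p hpM).crExt_eq
  have hFm : ∀ p ∈ M, crExt J R J r f p ∈ f '' M := fun p hpM => by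
    rw [hF p hpM]; exact mem_image_of_mem _ hpM
  refine ⟨max K₁ K₂, c, hM, hM0, hpos, hW, hK₁.trans (le_max_left _ _), hc, ?_, ?_, ?_, ?_, ?_, ?_,
    ?_, ?_, ?_, ?_⟩
  · intro p hpM
    exact contDiff_cubic.comp (contDiff_id.sub contDiff_const)
  · intro p hpM z X
    rw [((hp p hpM).hasFDerivAt_crPoly z).fderiv, (hp p hpM).isHolJet.comm]
  · intro e he
    obtain ⟨t, ht, h⟩ := exists_uniform_ball hM (Good := fun B => ∀ q ∈ B, q ∈ M → ∀ z ∈ B,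
      ‖crPoly J R J r f q z - crExt J R J r f z‖ ≤ e * dist z q ∧
      ‖fderiv ℝ (crPoly J R J r f q) z - fderiv ℝ (crExt J R J r f) z‖ ≤ e)
      (fun s t hst ht x hx hxM y hy => ht x (hst hx) hxM y (hst hy)) fun p hpM => by
        obtain ⟨t, ht, h⟩ := (hp p hpM).jet he
        refine ⟨t / 2, half_pos ht, fun q hq hqM z hz => ?_⟩
        rw [mem_ball] at hq hz
        have := dist_triangle_right z q p
        exact h q (by linarith) (hp q hqM).zero z (by linarith)
    exact ⟨t, ht, fun p hpM z hz => h p hpM p (mem_ball_self ht) hpM z hz⟩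
  · intro e he
    obtain ⟨t, ht, h⟩ := exists_uniform_ball hM (Good := fun B => ∀ q ∈ B, q ∈ M → ∀ q' ∈ B,
      q' ∈ M → ∀ z ∈ B, ‖crPoly J R J r f q z - crPoly J R J r f q' z‖ ≤
        e * (max (dist z q) (dist z q')) ^ 3)
      (fun s t hst ht x hx hxM x' hx' hxM' y hy => ht x (hst hx) hxM x' (hst hx') hxM' y (hst hy))
      fun p hpM => by
        obtain ⟨t, ht, h⟩ := (hp p hpM).jet3 he
        refine ⟨t / 2, half_pos ht, fun q hq hqM q' hq' hqM' z hz => ?_⟩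
        rw [mem_ball] at hq hq' hz
        have h1 := dist_triangle_right z q p
        have h2 := dist_triangle_right z q' p
        exact h q q' (by linarith) (by linarith) (hp q hqM).zero (hp q' hqM').zero z _
          (max_lt (by linarith) (by linarith)) (le_max_left _ _) (le_max_right _ _)
    refine ⟨t / 2, half_pos ht, fun p hpM p' hpM' z s hs h1 h2 => ?_⟩
    have h3 := dist_triangle_left p' p z
    have h4 : dist p' p < t := by rw [dist_comm]; rw [dist_comm p p']; linarith
    refine (h p hpM p (mem_ball_self ht) hpM p' h4 hpM' z (by rw [mem_ball]; linarith)).trans ?_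
    gcongr
    exact max_le h1 h2
  · exact ⟨t₁, ht₁, fun p hpM z hz => ⟨(h₁ p hpM z hz).1,
      (h₁ p hpM z hz).2.trans (le_max_left _ _)⟩⟩
  · intro p hpM; rw [hF p hpM, h0 p hpM]
  · exact ⟨t₂, ht₂, fun p hpM z hz => ⟨(h₂ _ (hFm p hpM) z hz).1,
      (h₂ _ (hFm p hpM) z hz).2.trans (le_max_right _ _)⟩⟩
  · intro e he
    obtain ⟨t, ht, h⟩ := exists_fderiv_osc hfM hρ' he
    exact ⟨t, ht, fun p hpM => h _ (hFm p hpM)⟩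
  · obtain ⟨t, ht, h⟩ := exists_dist_lt_of_nhdsSet hfM hpsh
    exact ⟨t, ht, fun p hpM => h _ (hFm p hpM)⟩
  · obtain ⟨t, ht, h⟩ := exists_dist_lt_of_nhdsSet hM hcl
    refine ⟨t, ht, fun z hzW hz => ?_⟩
    obtain ⟨p, hpM, e⟩ := hM.exists_infDist_eq_dist hM0 z
    exact h p hpM z (e ▸ hz) hzW

end Uniform

section Boundary

variable {E : Type*} [NormedAddCommGroup E] [NormedSpace ℝ E] {Ω : Set E} {r : E → ℝ} {p : E}

/-- `r` is a continuously differentiable defining function of `Ω` near the boundary of `Ω`. -/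
structure IsBoundaryFunction (Ω : Set E) (r : E → ℝ) : Prop where
  isOpen : IsOpen Ω
  smooth : ∀ᶠ z in 𝓝ˢ (frontier Ω), ContDiffAt ℝ 1 r z
  ne_zero : ∀ p ∈ frontier Ω, fderiv ℝ r p ≠ 0
  mem_iff : ∀ᶠ z in 𝓝ˢ (frontier Ω), (z ∈ Ω ↔ r z < 0)

namespace IsBoundaryFunction

theorem contDiffAt (h : IsBoundaryFunction Ω r) (hp : p ∈ frontier Ω) : ContDiffAt ℝ 1 r p :=
  h.smooth.self_of_nhdsSet p hp

theorem zero (h : IsBoundaryFunction Ω r) (hp : p ∈ frontier Ω) : r p = 0 := by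
  have hpc : ContinuousAt r p := (h.contDiffAt hp).continuousAt
  have h1 : ¬ r p < 0 := by
    rw [← h.mem_iff.self_of_nhdsSet p hp]
    rw [h.isOpen.frontier_eq] at hp
    exact hp.2
  refine le_antisymm ?_ (not_lt.1 h1)
  by_contra! h2
  have h3 : ∀ᶠ z in 𝓝 p, 0 < r z := hpc.eventually (lt_mem_nhds h2)
  have h4 : ∃ᶠ z in 𝓝 p, z ∈ Ω := mem_closure_iff_frequently.1 (frontier_subset_closure hp)
  obtain ⟨z, hz, hz2, hz3⟩ :=
    (h4.and_eventually (h3.and (eventually_nhdsSet_iff_forall.1 h.mem_iff p hp))).exists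
  exact absurd (hz3.1 hz) (not_lt.2 hz2.le)

theorem eventually_zero_iff (h : IsBoundaryFunction Ω r) :
    ∀ᶠ z in 𝓝ˢ (frontier Ω), (r z = 0 ↔ z ∈ frontier Ω) := by
  rw [eventually_nhdsSet_iff_forall]
  intro p hp
  filter_upwards [eventually_fderiv_ne_zero (h.contDiffAt hp) (h.ne_zero p hp),
    (eventually_nhdsSet_iff_forall.1 h.mem_iff p hp).eventually_nhds] with z h1 h2
  refine ⟨fun hz => ?_, fun hz => h.zero hz⟩
  rw [h.isOpen.frontier_eq]
  refine ⟨?_, fun hzΩ => (h2.self_of_nhds.1 hzΩ).ne hz⟩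
  by_contra hzc
  have h3 : ∀ᶠ w in 𝓝 z, w ∉ closure Ω := isClosed_closure.isOpen_compl.mem_nhds hzc
  have h4 : IsLocalMin r z := by
    filter_upwards [h2, h3] with w hw hw2
    rw [hz]
    exact not_lt.1 fun hlt => hw2 (subset_closure (hw.2 hlt))
  exact h1 h4.fderiv_eq_zero

theorem eventually_pos_iff (h : IsBoundaryFunction Ω r) :
    ∀ᶠ z in 𝓝ˢ (frontier Ω), (0 < r z ↔ z ∈ (closure Ω)ᶜ) := by
  filter_upwards [h.eventually_zero_iff, h.mem_iff] with z h1 h2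
  rw [h.isOpen.frontier_eq] at h1
  constructor
  · exact fun hz hzc => (h1.2 ⟨hzc, fun hzΩ => absurd (h2.1 hzΩ) (not_lt.2 hz.le)⟩).not_gt hz
  · intro hz
    rcases lt_trichotomy (r z) 0 with h3 | h3 | h3
    · exact absurd (subset_closure (h2.2 h3)) hz
    · exact absurd (h1.1 h3).1 hz
    · exact h3

theorem frontier_subset (h : IsBoundaryFunction Ω r) :
    frontier Ω ⊆ closure (closure Ω)ᶜ := by
  intro p hp
  rw [mem_closure_iff_frequently]
  intro hev
  have h4 : IsLocalMax r p := by
    filter_upwards [hev, eventually_nhdsSet_iff_forall.1 h.eventually_pos_iff p hp] with w hw hw2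
    rw [h.zero hp]
    exact not_lt.1 fun hlt => hw (hw2.1 hlt)
  exact h.ne_zero p hp h4.fderiv_eq_zero

/-- Linear lower bounds, in the exterior, for functions vanishing on the boundary. -/
theorem exists_growth_exterior (h : IsBoundaryFunction Ω r) (hp : p ∈ frontier Ω) {u : E → ℝ}
    {v : E} (hu : ContDiffAt ℝ 1 u p) (hv : 0 < fderiv ℝ r p v) (hv' : 0 < fderiv ℝ u p v)
    (h0 : ∀ z ∈ frontier Ω, u z = 0) :
    ∃ c > 0, ∀ᶠ z in 𝓝 p, z ∈ (closure Ω)ᶜ → c * infDist z (frontier Ω) ≤ u z := by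
  have hz := eventually_nhdsSet_iff_forall.1 h.eventually_zero_iff p hp
  obtain ⟨c, hc, h1⟩ := exists_linear_growth (M := frontier Ω)
    ((h.contDiffAt hp).hasStrictFDerivAt one_ne_zero) (hu.hasStrictFDerivAt one_ne_zero) hv hv' (h.zero hp)
    (hz.mono fun z hz hr => ⟨hz.1 hr, h0 z (hz.1 hr)⟩)
    ((eventually_nhdsSet_iff_forall.1 h.smooth p hp).mono fun z hz => hz.continuousAt)
  refine ⟨c, hc, ?_⟩
  filter_upwards [h1, eventually_nhdsSet_iff_forall.1 h.eventually_pos_iff p hp] with z h2 h3 h4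
  exact h2 (h3.2 h4)

/-- Linear lower bounds, in the interior, for functions vanishing on the boundary. -/
theorem exists_growth_interior (h : IsBoundaryFunction Ω r) (hp : p ∈ frontier Ω) {u : E → ℝ}
    {v : E} (hu : ContDiffAt ℝ 1 u p) (hv : 0 < fderiv ℝ r p v) (hv' : fderiv ℝ u p v < 0)
    (h0 : ∀ z ∈ frontier Ω, u z = 0) :
    ∃ c > 0, ∀ᶠ z in 𝓝 p, z ∈ Ω → c * infDist z (frontier Ω) ≤ u z := by
  have hz := eventually_nhdsSet_iff_forall.1 h.eventually_zero_iff p hp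
  obtain ⟨c, hc, h1⟩ := exists_linear_growth (M := frontier Ω) (v := -v) (r := fun z => -r z)
    ((h.contDiffAt hp).hasStrictFDerivAt one_ne_zero).fun_neg (hu.hasStrictFDerivAt one_ne_zero)
    (by simpa using hv) (by simpa using hv') (by simp [h.zero hp])
    (hz.mono fun z hz hr => ⟨hz.1 (neg_eq_zero.1 hr), h0 z (hz.1 (neg_eq_zero.1 hr))⟩)
    ((eventually_nhdsSet_iff_forall.1 h.smooth p hp).mono fun z hz => hz.continuousAt.neg)
  refine ⟨c, hc, ?_⟩
  filter_upwards [h1, eventually_nhdsSet_iff_forall.1 h.mem_iff p hp] with z h2 h3 h4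
  exact h2 (neg_pos.2 (h3.1 h4))

end IsBoundaryFunction

theorem nonempty_frontier_of_isBounded [Nontrivial E] (hb : Bornology.IsBounded Ω)
    (hne : Ω.Nonempty) : (frontier Ω).Nonempty := by
  rw [nonempty_frontier_iff]
  refine ⟨hne, fun h => ?_⟩
  rw [h] at hb
  exact NormedSpace.unbounded_univ ℝ E hb

end Boundary

section Equivalence

variable {E : Type*} [NormedAddCommGroup E] [NormedSpace ℝ E] {Ω₁ Ω₂ : Set E} {r₁ r₂ : E → ℝ}
  {f g : E → E} {p : E} {J : E →L[ℝ] E} {R : (E →L[ℝ] ℝ) →L[ℝ] E}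

/-- `f` and `g` are mutually inverse maps, of class `C³`, between the boundaries of `Ω₁` and
`Ω₂`. -/
structure IsBoundaryEquiv (Ω₁ Ω₂ : Set E) (r₁ r₂ : E → ℝ) (f g : E → E) : Prop where
  left : IsBoundaryFunction Ω₁ r₁
  right : IsBoundaryFunction Ω₂ r₂
  smooth_left : ∀ p ∈ frontier Ω₁, ContDiffAt ℝ 3 r₁ p
  smooth_right : ∀ p ∈ frontier Ω₂, ContDiffAt ℝ 3 r₂ p
  smooth_map : ∀ p ∈ frontier Ω₁, ContDiffAt ℝ 3 f p
  smooth_inv : ∀ p ∈ frontier Ω₂, ContDiffAt ℝ 3 g p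
  maps : ∀ p ∈ frontier Ω₁, f p ∈ frontier Ω₂
  maps_inv : ∀ p ∈ frontier Ω₂, g p ∈ frontier Ω₁
  left_inv : ∀ p ∈ frontier Ω₁, g (f p) = p
  right_inv : ∀ p ∈ frontier Ω₂, f (g p) = p

namespace IsBoundaryEquiv

theorem symm (h : IsBoundaryEquiv Ω₁ Ω₂ r₁ r₂ f g) : IsBoundaryEquiv Ω₂ Ω₁ r₂ r₁ g f :=
  ⟨h.right, h.left, h.smooth_right, h.smooth_left, h.smooth_inv, h.smooth_map, h.maps_inv, h.maps,
    h.right_inv, h.left_inv⟩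

theorem image_eq (h : IsBoundaryEquiv Ω₁ Ω₂ r₁ r₂ f g) : f '' frontier Ω₁ = frontier Ω₂ :=
  Subset.antisymm (by rintro _ ⟨p, hp, rfl⟩; exact h.maps p hp)
    fun q hq => ⟨g q, h.maps_inv q hq, h.right_inv q hq⟩

theorem differentiableAt (h : IsBoundaryEquiv Ω₁ Ω₂ r₁ r₂ f g) (hp : p ∈ frontier Ω₁) :
    DifferentiableAt ℝ f p := (h.smooth_map p hp).differentiableAt (by norm_num)

theorem eventually_mem (h : IsBoundaryEquiv Ω₁ Ω₂ r₁ r₂ f g) (hp : p ∈ frontier Ω₁) :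
    ∀ᶠ z in 𝓝 p, r₁ z = r₁ p → z ∈ frontier Ω₁ := by
  filter_upwards [eventually_nhdsSet_iff_forall.1 h.left.eventually_zero_iff p hp] with z hz hr
  exact hz.1 (by rw [hr, h.left.zero hp])

theorem fderiv_comp_eq_zero [CompleteSpace E] (h : IsBoundaryEquiv Ω₁ Ω₂ r₁ r₂ f g)
    (hp : p ∈ frontier Ω₁) {u : E → ℝ} (hu : IsBoundaryFunction Ω₂ u) {X : E}
    (hX : fderiv ℝ r₁ p X = 0) : fderiv ℝ u (f p) (fderiv ℝ f p X) = 0 := by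
  have hd : HasFDerivAt (fun z => u (f z)) ((fderiv ℝ u (f p)).comp (fderiv ℝ f p)) p :=
    ((hu.contDiffAt (h.maps p hp)).differentiableAt one_ne_zero).hasFDerivAt.comp p
      (h.differentiableAt hp).hasFDerivAt
  have := fderiv_eq_zero_of_level (h.left.contDiffAt hp) (h.left.ne_zero p hp)
    hd.differentiableAt ((h.eventually_mem hp).mono fun z hz hr => hu.zero (h.maps z (hz hr))) hX
  rw [hd.fderiv] at this
  exact this

theorem fderiv_inv_fderiv [CompleteSpace E] (h : IsBoundaryEquiv Ω₁ Ω₂ r₁ r₂ f g)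
    (hp : p ∈ frontier Ω₁) {X : E} (hX : fderiv ℝ r₁ p X = 0) :
    fderiv ℝ g (f p) (fderiv ℝ f p X) = X := by
  have hd : HasFDerivAt (fun z => g (f z) - z)
      ((fderiv ℝ g (f p)).comp (fderiv ℝ f p) - ContinuousLinearMap.id ℝ E) p :=
    ((h.symm.differentiableAt (h.maps p hp)).hasFDerivAt.comp p
      (h.differentiableAt hp).hasFDerivAt).sub (hasFDerivAt_id p)
  have := fderiv_eq_zero_of_level (h.left.contDiffAt hp) (h.left.ne_zero p hp)
    hd.differentiableAt ((h.eventually_mem hp).mono fun z hz hr =>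
      sub_eq_zero.2 (h.left_inv z (hz hr))) hX
  rw [hd.fderiv] at this
  exact sub_eq_zero.1 this

end IsBoundaryEquiv

/-- A boundary equivalence which is a CR map. -/
structure IsCREquiv (J : E →L[ℝ] E) (R : (E →L[ℝ] ℝ) →L[ℝ] E) (Ω₁ Ω₂ : Set E) (r₁ r₂ : E → ℝ)
    (f g : E → E) : Prop extends IsBoundaryEquiv Ω₁ Ω₂ r₁ r₂ f g where
  trans : IsTransverse J R
  cr : ∀ p ∈ frontier Ω₁, ∀ X, fderiv ℝ r₁ p X = 0 → fderiv ℝ r₁ p (J X) = 0 →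
    fderiv ℝ f p (J X) = J (fderiv ℝ f p X)

/-- The transversal derivative of `u ∘ f` for the holomorphic extension of `f`. -/
noncomputable def normalRate (J : E →L[ℝ] E) (R : (E →L[ℝ] ℝ) →L[ℝ] E)
    (r₁ u : E → ℝ) (f : E → E) (p : E) : ℝ :=
  fderiv ℝ u (f p) (crDeriv J R J r₁ f p (R (fderiv ℝ r₁ p)))

namespace IsCREquiv

theorem isCRPoint (h : IsCREquiv J R Ω₁ Ω₂ r₁ r₂ f g) (hp : p ∈ frontier Ω₁) :
    IsCRPoint J R J r₁ f p where
  trans := h.trans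
  sq := h.trans.sq
  smooth_r := h.smooth_left p hp
  ne_zero := h.left.ne_zero p hp
  zero := h.left.zero hp
  smooth_f := h.smooth_map p hp
  cr := (h.eventually_mem hp).mono fun z hz hr X => h.cr z (hz hr) X

theorem crDeriv_apply {X : E} (hX : fderiv ℝ r₁ p X = 0) :
    crDeriv J R J r₁ f p X = fderiv ℝ f p X := crPart_apply_of_mem hX

theorem crDeriv_injective [CompleteSpace E] (h : IsCREquiv J R Ω₁ Ω₂ r₁ r₂ f g)
    (hp : p ∈ frontier Ω₁) : Function.Injective (crDeriv J R J r₁ f p) := by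
  rw [injective_iff_map_eq_zero]
  intro X hX
  have hker : ∀ Y, fderiv ℝ r₁ p Y = 0 → crDeriv J R J r₁ f p Y = 0 → Y = 0 := by
    intro Y hY hY'
    rw [← h.fderiv_inv_fderiv hp hY, ← crDeriv_apply (J := J) (R := R) hY, hY', map_zero]
  have hJ := (h.isCRPoint hp).isHolJet.comm₁
  set a := fderiv ℝ r₁ p (J X) with ha
  set b := fderiv ℝ r₁ p X with hb
  have h1 : a • X - b • J X = 0 := by
    apply hker
    · rw [map_sub, map_smul, map_smul, ← ha, ← hb, smul_eq_mul, smul_eq_mul]; ring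
    · rw [map_sub, map_smul, map_smul, hJ, hX, map_zero, smul_zero, smul_zero, sub_zero]
  have h2 : (a ^ 2 + b ^ 2) • X = 0 := by
    have h3 : a • (a • X - b • J X) + b • J (a • X - b • J X) = 0 := by rw [h1]; simp
    rw [map_sub, map_smul, map_smul, h.trans.sq] at h3
    rw [← h3]
    module
  rcases smul_eq_zero.1 h2 with h3 | h3
  · exact hker X (by nlinarith [sq_nonneg a, sq_nonneg b]) hX
  · exact h3

theorem symm [CompleteSpace E] (h : IsCREquiv J R Ω₁ Ω₂ r₁ r₂ f g) :
    IsCREquiv J R Ω₂ Ω₁ r₂ r₁ g f where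
  toIsBoundaryEquiv := h.toIsBoundaryEquiv.symm
  trans := h.trans
  cr := by
    intro q hq X hX hJX
    obtain ⟨p, hp, rfl⟩ := h.image_eq.symm ▸ hq
    have hs := h.toIsBoundaryEquiv.symm
    have e1 := hs.fderiv_comp_eq_zero hq h.left hX
    have e2 := hs.fderiv_comp_eq_zero hq h.left hJX
    have i1 := hs.fderiv_inv_fderiv hq hX
    have i2 := hs.fderiv_inv_fderiv hq hJX
    rw [h.left_inv p hp] at e1 e2 i1 i2
    rw [← crDeriv_apply (J := J) (R := R) e1] at i1
    rw [← crDeriv_apply (J := J) (R := R) e2] at i2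
    apply h.crDeriv_injective hp
    rw [i2, (h.isCRPoint hp).isHolJet.comm₁, i1]

variable {u : E → ℝ}

theorem fderiv_comp_crExt (h : IsCREquiv J R Ω₁ Ω₂ r₁ r₂ f g) (hu : IsBoundaryFunction Ω₂ u)
    (hp : p ∈ frontier Ω₁) : fderiv ℝ (fun z => u (crExt J R J r₁ f z)) p =
      (fderiv ℝ u (f p)).comp (crDeriv J R J r₁ f p) := by
  have h1 := (h.isCRPoint hp).crExt_eq
  have h2 : HasFDerivAt u (fderiv ℝ u (f p)) (crExt J R J r₁ f p) := by
    rw [h1]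
    exact ((hu.contDiffAt (h.maps p hp)).differentiableAt one_ne_zero).hasFDerivAt
  have h3 := ((h.isCRPoint hp).contDiffAt_crExt.differentiableAt (by norm_num)).hasFDerivAt
  have h4 := h2.comp p h3
  rw [(h.isCRPoint hp).fderiv_crExt] at h4
  exact h4.fderiv

theorem contDiffAt_comp_crExt (h : IsCREquiv J R Ω₁ Ω₂ r₁ r₂ f g) (hu : IsBoundaryFunction Ω₂ u)
    (hp : p ∈ frontier Ω₁) : ContDiffAt ℝ 1 (fun z => u (crExt J R J r₁ f z)) p := by
  have h1 : ContDiffAt ℝ 1 u (crExt J R J r₁ f p) := by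
    rw [(h.isCRPoint hp).crExt_eq]; exact hu.contDiffAt (h.maps p hp)
  exact h1.comp p ((h.isCRPoint hp).contDiffAt_crExt.of_le (by norm_num))

theorem comp_crExt_eq_zero (h : IsCREquiv J R Ω₁ Ω₂ r₁ r₂ f g) (hu : IsBoundaryFunction Ω₂ u)
    (hp : p ∈ frontier Ω₁) : u (crExt J R J r₁ f p) = 0 := by
  rw [(h.isCRPoint hp).crExt_eq]; exact hu.zero (h.maps p hp)

theorem normalRate_ne_zero [FiniteDimensional ℝ E] [CompleteSpace E]
    (h : IsCREquiv J R Ω₁ Ω₂ r₁ r₂ f g)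
    (hu : IsBoundaryFunction Ω₂ u) (hp : p ∈ frontier Ω₁) : normalRate J R r₁ u f p ≠ 0 := by
  intro h0
  apply hu.ne_zero _ (h.maps p hp)
  have hs : Function.Surjective (crDeriv J R J r₁ f p) :=
    LinearMap.injective_iff_surjective (f := (crDeriv J R J r₁ f p : E →ₗ[ℝ] E)).1
      (h.crDeriv_injective hp)
  ext Y
  obtain ⟨X, rfl⟩ := hs Y
  have hν := (h.trans.pos _ (h.left.ne_zero p hp)).ne'
  set ν := R (fderiv ℝ r₁ p) with hνd
  have hX : X = (fderiv ℝ r₁ p X / fderiv ℝ r₁ p ν) • ν +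
      (X - (fderiv ℝ r₁ p X / fderiv ℝ r₁ p ν) • ν) := by abel
  have hT : fderiv ℝ r₁ p (X - (fderiv ℝ r₁ p X / fderiv ℝ r₁ p ν) • ν) = 0 := by
    rw [map_sub, map_smul, smul_eq_mul, div_mul_cancel₀ _ hν, sub_self]
  have h1 : fderiv ℝ u (f p) (crDeriv J R J r₁ f p ν) = 0 := h0
  rw [hX, map_add, map_smul, crDeriv_apply hT, map_add, map_smul, h1,
    h.fderiv_comp_eq_zero hp hu hT]
  simp

theorem continuousAt_normalRate (h : IsCREquiv J R Ω₁ Ω₂ r₁ r₂ f g)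
    (hu : IsBoundaryFunction Ω₂ u) (hp : p ∈ frontier Ω₁) :
    ContinuousAt (normalRate J R r₁ u f) p := by
  have h1 : ContinuousAt (fun z => fderiv ℝ u (f z)) p :=
    ContinuousAt.comp (g := fderiv ℝ u)
      ((hu.contDiffAt (h.maps p hp)).continuousAt_fderiv one_ne_zero)
      (h.smooth_map p hp).continuousAt
  have h2 := (h.isCRPoint hp).contDiffAt₁.continuousAt
  have h3 : ContinuousAt (fun z => R (fderiv ℝ r₁ z)) p :=
    R.continuous.continuousAt.comp ((h.left.contDiffAt hp).continuousAt_fderiv one_ne_zero)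
  exact h1.clm_apply (h2.clm_apply h3)

end IsCREquiv

end Equivalence

section Transfer

variable {E : Type*} [NormedAddCommGroup E] [NormedSpace ℝ E] {Ω₁ Ω₂ W : Set E} {r₁ r₂ : E → ℝ}
  {f g : E → E} {p : E} {J : E →L[ℝ] E} {R : (E →L[ℝ] ℝ) →L[ℝ] E} {q : E →L[ℝ] E →L[ℝ] ℝ}
  {η η' : ℝ} {u : E → ℝ}

/-- `u` is positive at `z` and its power `u ^ η` is strictly plurisubharmonic at `z`. -/
def IsStrictPSHPow (J : E →L[ℝ] E) (η : ℝ) (u : E → ℝ) (z : E) : Prop :=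
  0 < u z ∧ C2At (fun x => u x ^ η) z ∧ ∀ X, X ≠ 0 → 0 < lap J (fun x => u x ^ η) z X

namespace IsCREquiv

/-- Correction of the pulled back defining function on one side of the boundary. -/
theorem exists_correction [ProperSpace E] (h : IsCREquiv J R Ω₁ Ω₂ r₁ r₂ f g)
    (hq : IsHermitianForm J q) (hc : IsCompact (frontier Ω₁)) (hne : (frontier Ω₁).Nonempty)
    (hu : IsBoundaryFunction Ω₂ u) (hη : 0 < η) (hη' : η < η')
    (hpsh : ∀ᶠ z in 𝓝ˢ (frontier Ω₂), z ∈ (closure Ω₂)ᶜ → IsStrictPSHPow J η u z)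
    (hW : IsOpen W) (hWd : Disjoint W (frontier Ω₁)) (hfr : frontier W ⊆ frontier Ω₁)
    (hlow : ∀ p ∈ frontier Ω₁, ∃ c > 0, ∀ᶠ z in 𝓝 p, z ∈ W →
      c * infDist z (frontier Ω₁) ≤ u (crExt J R J r₁ f z)) :
    ∃ ε : ℝ, ∃ w : E → ℝ, (∀ᶠ z in 𝓝ˢ (frontier Ω₁), ContDiffAt ℝ 1 w z) ∧
      (∀ p ∈ frontier Ω₁, w p = 0 ∧ fderiv ℝ w p =
        Real.exp (ε * q p p) • fderiv ℝ (fun z => u (crExt J R J r₁ f z)) p) ∧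
      (∀ᶠ z in 𝓝ˢ (frontier Ω₁), z ∈ W → IsStrictPSHPow J η' w z) ∧
      ∀ z ∉ W, w z = u (crExt J R J r₁ f z) * Real.exp (ε * q z z) := by
  have hpsh' : ∀ᶠ x in 𝓝ˢ (f '' frontier Ω₁), 0 < u x →
      C2At (fun w => u w ^ η) x ∧ ∀ X, 0 ≤ lap J (fun w => u w ^ η) x X := by
    rw [h.image_eq]
    filter_upwards [hpsh, hu.eventually_pos_iff] with x hx hx' hpos
    obtain ⟨-, h2, h3⟩ := hx (hx'.1 hpos)
    refine ⟨h2, fun X => ?_⟩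
    rcases eq_or_ne X 0 with rfl | hX
    · simp [lap, hess]
    · exact (h3 X hX).le
  obtain ⟨K, c, hJ⟩ := exists_jetData hc hne (fun p hp => h.isCRPoint hp) hW
    (fun z hz => (isClosed_frontier.notMem_iff_infDist_pos hne).1
      fun hzf => disjoint_left.1 hWd hz hzf)
    (fun p hp => hu.zero (h.maps p hp)) (fun p hp => hu.contDiffAt (h.maps p hp)) hpsh' hlow
  exact hJ.exists_smooth hq hη hη' hfr (eventually_nhdsSet_iff_forall.2 fun p hp =>
    (h.contDiffAt_comp_crExt hu hp).eventually (by simp))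

theorem normal_pos (h : IsCREquiv J R Ω₁ Ω₂ r₁ r₂ f g) (hp : p ∈ frontier Ω₁) :
    0 < fderiv ℝ r₁ p (R (fderiv ℝ r₁ p)) := h.trans.pos _ (h.left.ne_zero p hp)

theorem fderiv_comp_crExt_normal (h : IsCREquiv J R Ω₁ Ω₂ r₁ r₂ f g)
    (hu : IsBoundaryFunction Ω₂ u) (hp : p ∈ frontier Ω₁) :
    fderiv ℝ (fun z => u (crExt J R J r₁ f z)) p (R (fderiv ℝ r₁ p)) =
      normalRate J R r₁ u f p := by
  rw [h.fderiv_comp_crExt hu hp]; rfl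

/-- A CR equivalence matches exteriors with exteriors. -/
theorem normalRate_pos [FiniteDimensional ℝ E] (h : IsCREquiv J R Ω₁ Ω₂ r₁ r₂ f g)
    (hq : IsHermitianForm J q) (hn : ∀ z : E, ∃ X, X ≠ 0 ∧ q z X = 0 ∧ q z (J X) = 0)
    (hE : 1 < Module.rank ℝ E) (hΩ₁ : Ω₁.Nonempty) (hb₁ : Bornology.IsBounded Ω₁)
    (hΩ₂ : IsPreconnected Ω₂) (hb₂ : Bornology.IsBounded Ω₂)
    (hu : IsBoundaryFunction Ω₂ u) (hη : 0 < η)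
    (hpsh : ∀ᶠ z in 𝓝ˢ (frontier Ω₂), z ∈ (closure Ω₂)ᶜ → IsStrictPSHPow J η u z)
    (hp : p ∈ frontier Ω₁) : 0 < normalRate J R r₁ u f p := by
  have : ProperSpace E := FiniteDimensional.proper ℝ E
  set M := frontier Ω₁ with hM
  have hMc : IsCompact M :=
    isCompact_of_isClosed_isBounded isClosed_frontier (hb₁.closure.subset frontier_subset_closure)
  set κ := normalRate J R r₁ u f with hκ
  have hκc : ContinuousOn κ M := fun x hx => (h.continuousAt_normalRate hu hx).continuousWithinAt
  have hκ0 : ∀ x ∈ M, κ x ≠ 0 := fun x hx => h.normalRate_ne_zero hu hx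
  by_contra! hneg
  by_cases hB : ∃ x ∈ M, 0 < κ x
  · obtain ⟨b, hb, hb'⟩ := hB
    have hA1 : IsCompact (M ∩ κ ⁻¹' Iic 0) :=
      hMc.of_isClosed_subset (hκc.preimage_isClosed_of_isClosed hMc.isClosed isClosed_Iic)
        inter_subset_left
    have hB1 : IsCompact (M ∩ κ ⁻¹' Ici 0) :=
      hMc.of_isClosed_subset (hκc.preimage_isClosed_of_isClosed hMc.isClosed isClosed_Ici)
        inter_subset_left
    have hfc : ContinuousOn f M := fun x hx =>
      (h.smooth_map x hx).continuousAt.continuousWithinAt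
    have hA2 := (hA1.image_of_continuousOn (hfc.mono inter_subset_left)).isClosed
    have hB2 := (hB1.image_of_continuousOn (hfc.mono inter_subset_left)).isClosed
    obtain ⟨K, hK, hK0, hKb, hKΩ, hKf⟩ := exists_hole hE hu.isOpen hΩ₂ hb₂ hA2 hB2
      (by
        rw [disjoint_left]
        rintro _ ⟨x, ⟨hx, hx'⟩, rfl⟩ ⟨y, ⟨hy, hy'⟩, hxy⟩
        have : y = x := by rw [← h.left_inv y hy, hxy, h.left_inv x hx]
        subst this
        exact hκ0 y hy (le_antisymm hx' hy'))
      ⟨_, mem_image_of_mem f ⟨hp, hneg⟩⟩ ⟨_, mem_image_of_mem f ⟨hb, hb'.le⟩⟩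
      (by
        rw [← image_union, ← inter_union_distrib_left, ← preimage_union, Iic_union_Ici,
          preimage_univ, inter_univ, h.image_eq])
      hu.frontier_subset
    refine not_exists_psh_near_frontier hq hn hK hK0 hKb hη (w := u) (fun x hx => hu.zero (hKf hx))
      ?_ ?_
    · exact (hu.smooth.filter_mono (nhdsSet_mono hKf)).mono fun z hz => hz.continuousAt
    · exact (hpsh.filter_mono (nhdsSet_mono hKf)).mono fun z hz hzK => hz (hKΩ hzK)
  · push Not at hB
    obtain ⟨ε, w, h1, h2, h3, -⟩ := h.exists_correction (W := Ω₁) hq hMc ⟨p, hp⟩ hu hη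
      (lt_add_one η) hpsh h.left.isOpen
      (disjoint_left.2 fun x hx hx' => by
        rw [h.left.isOpen.frontier_eq] at hx'; exact hx'.2 hx) Subset.rfl
      (fun x hx => h.left.exists_growth_interior hx (h.contDiffAt_comp_crExt hu hx)
        (h.normal_pos hx)
        (by
          rw [h.fderiv_comp_crExt_normal hu hx]
          exact lt_of_le_of_ne (hB x hx) (hκ0 x hx))
        fun z hz => h.comp_crExt_eq_zero hu hz)
    exact not_exists_psh_near_frontier hq hn h.left.isOpen hΩ₁ hb₁ (by linarith : 0 < η + 1)
      (fun x hx => (h2 x hx).1) (h1.mono fun z hz => hz.continuousAt) h3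

/-- Transfer of defining functions with strictly plurisubharmonic powers along CR equivalences. -/
theorem exists_transfer [FiniteDimensional ℝ E] (h : IsCREquiv J R Ω₁ Ω₂ r₁ r₂ f g)
    (hq : IsHermitianForm J q) (hn : ∀ z : E, ∃ X, X ≠ 0 ∧ q z X = 0 ∧ q z (J X) = 0)
    (hE : 1 < Module.rank ℝ E) (hΩ₁ : Ω₁.Nonempty) (hb₁ : Bornology.IsBounded Ω₁)
    (hΩ₂ : IsPreconnected Ω₂) (hb₂ : Bornology.IsBounded Ω₂)
    (hu : IsBoundaryFunction Ω₂ u) (hη : 0 < η) (hη' : η < η')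
    (hpsh : ∀ᶠ z in 𝓝ˢ (frontier Ω₂), z ∈ (closure Ω₂)ᶜ → IsStrictPSHPow J η u z) :
    ∃ w : E → ℝ, IsBoundaryFunction Ω₁ w ∧
      ∀ᶠ z in 𝓝ˢ (frontier Ω₁), z ∈ (closure Ω₁)ᶜ → IsStrictPSHPow J η' w z := by
  have : ProperSpace E := FiniteDimensional.proper ℝ E
  have : Nontrivial E := by
    rw [← rank_pos_iff_nontrivial (R := ℝ)]
    exact zero_lt_one.trans hE
  have hMc : IsCompact (frontier Ω₁) :=
    isCompact_of_isClosed_isBounded isClosed_frontier (hb₁.closure.subset frontier_subset_closure)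
  have hne := nonempty_frontier_of_isBounded hb₁ hΩ₁
  have hκ : ∀ x ∈ frontier Ω₁, 0 < normalRate J R r₁ u f x := fun x hx =>
    h.normalRate_pos hq hn hE hΩ₁ hb₁ hΩ₂ hb₂ hu hη hpsh hx
  obtain ⟨ε, w, h1, h2, h3, h4⟩ := h.exists_correction (W := (closure Ω₁)ᶜ) hq hMc hne hu hη
    hη' hpsh isClosed_closure.isOpen_compl
    (disjoint_left.2 fun x hx hx' => hx (frontier_subset_closure hx'))
    (by rw [frontier_compl]; exact frontier_closure_subset)
    (fun x hx => h.left.exists_growth_exterior hx (h.contDiffAt_comp_crExt hu hx)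
      (h.normal_pos hx) (by rw [h.fderiv_comp_crExt_normal hu hx]; exact hκ x hx)
      fun z hz => h.comp_crExt_eq_zero hu hz)
  refine ⟨w, ⟨h.left.isOpen, h1, fun x hx => ?_, ?_⟩, h3⟩
  · rw [(h2 x hx).2, Ne, smul_eq_zero, not_or]
    refine ⟨(Real.exp_pos _).ne', fun h0 => (hκ x hx).ne' ?_⟩
    rw [← h.fderiv_comp_crExt_normal hu hx, h0]; simp
  · have hin : ∀ᶠ z in 𝓝ˢ (frontier Ω₁), z ∈ Ω₁ → w z < 0 := by
      rw [eventually_nhdsSet_iff_forall]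
      intro x hx
      obtain ⟨c, hc, hz⟩ := h.left.exists_growth_interior hx
        (u := fun z => -u (crExt J R J r₁ f z)) (h.contDiffAt_comp_crExt hu hx).neg
        (h.normal_pos hx)
        (by
          rw [fderiv_fun_neg, _root_.neg_apply, h.fderiv_comp_crExt_normal hu hx]
          exact neg_neg_of_pos (hκ x hx))
        fun z hz => by simp [h.comp_crExt_eq_zero hu hz]
      filter_upwards [hz] with z hz hzΩ
      rw [h4 z (fun hzc => hzc (subset_closure hzΩ))]
      have hd : 0 < infDist z (frontier Ω₁) :=
        (isClosed_frontier.notMem_iff_infDist_pos hne).1 fun hzf => by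
          rw [h.left.isOpen.frontier_eq] at hzf; exact hzf.2 hzΩ
      have := hz hzΩ
      have := mul_pos hc hd
      exact mul_neg_of_neg_of_pos (by linarith) (Real.exp_pos _)
    filter_upwards [hin, h3] with z hz1 hz2
    refine ⟨hz1, fun hz => ?_⟩
    by_contra hzΩ
    by_cases hzc : z ∈ closure Ω₁
    · have hzf : z ∈ frontier Ω₁ := by
        rw [h.left.isOpen.frontier_eq]; exact ⟨hzc, hzΩ⟩
      exact hz.ne (h2 z hzf).1
    · exact hz.not_gt (hz2 hzc).1

end IsCREquiv

end Transfer

section Euclidean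

variable {n : ℕ}

/-- The gradient operator for the Euclidean structure of `ℂⁿ`. -/
noncomputable def gradOp (n : ℕ) : (Pt n →L[ℝ] ℝ) →L[ℝ] Pt n :=
  ContinuousLinearMap.pi fun j =>
    (ContinuousLinearMap.apply ℝ ℝ (Pi.single j 1 : Pt n)).smulRight (1 : ℂ) +
      (ContinuousLinearMap.apply ℝ ℝ (Pi.single j Complex.I : Pt n)).smulRight Complex.I

theorem gradOp_apply (ℓ : Pt n →L[ℝ] ℝ) (j : Fin n) :
    gradOp n ℓ j = ℓ (Pi.single j 1) + ℓ (Pi.single j Complex.I) * Complex.I := by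
  simp [gradOp]

theorem apply_gradOp (ℓ : Pt n →L[ℝ] ℝ) :
    ℓ (gradOp n ℓ) = ∑ j, (ℓ (Pi.single j 1) ^ 2 + ℓ (Pi.single j Complex.I) ^ 2) := by
  conv_lhs => rw [pt_eq_sum (gradOp n ℓ)]
  simp only [map_sum, map_add, map_smul, gradOp_apply]
  simp [sq]

theorem isTransverse_gradOp (n : ℕ) : IsTransverse (mulI n) (gradOp n) where
  sq := mulI_mulI
  pos ℓ hℓ := by
    rw [apply_gradOp]
    refine lt_of_le_of_ne (Finset.sum_nonneg fun j _ => by positivity) fun h0 => hℓ ?_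
    rw [eq_comm, Finset.sum_eq_zero_iff_of_nonneg fun j _ => by positivity] at h0
    ext X
    rw [pt_eq_sum X, map_sum]
    refine Finset.sum_eq_zero fun j hj => ?_
    have h1 := h0 j hj
    have h2 : ℓ (Pi.single j 1) = 0 := by
      nlinarith [sq_nonneg (ℓ (Pi.single j 1)), sq_nonneg (ℓ (Pi.single j Complex.I))]
    have h3 : ℓ (Pi.single j Complex.I) = 0 := by
      nlinarith [sq_nonneg (ℓ (Pi.single j 1)), sq_nonneg (ℓ (Pi.single j Complex.I))]
    simp [h2, h3]
  orth ℓ := by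
    rw [mulI_eq_sum, map_sum]
    refine Finset.sum_eq_zero fun j _ => ?_
    simp only [map_sub, map_smul, gradOp_apply]
    simp [mul_comm]

/-- The Euclidean inner product of `ℂⁿ`. -/
noncomputable def innerForm (n : ℕ) : Pt n →L[ℝ] Pt n →L[ℝ] ℝ :=
  ∑ j, (innerSL ℝ : ℂ →L[ℝ] ℂ →L[ℝ] ℝ).bilinearComp
    (ContinuousLinearMap.proj j : Pt n →L[ℝ] ℂ) (ContinuousLinearMap.proj j : Pt n →L[ℝ] ℂ)

theorem innerForm_apply (x y : Pt n) : innerForm n x y = ∑ j, inner ℝ (x j) (y j) := by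
  simp [innerForm, _root_.sum_apply]

theorem isHermitianForm_innerForm (n : ℕ) : IsHermitianForm (mulI n) (innerForm n) where
  sq := mulI_mulI
  symm x y := by
    simp only [innerForm_apply]
    exact Finset.sum_congr rfl fun j _ => real_inner_comm _ _
  inv x y := by
    simp only [innerForm_apply]
    refine Finset.sum_congr rfl fun j _ => ?_
    simp [mulI_apply, Complex.inner]
  norm_sq_le x := by
    rw [innerForm_apply]
    have h : ∀ j, ‖x j‖ ^ 2 ≤ ∑ j, inner ℝ (x j) (x j) := fun j => by
      rw [← real_inner_self_eq_norm_sq]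
      exact Finset.single_le_sum (f := fun j => inner ℝ (x j) (x j))
        (fun i _ => real_inner_self_nonneg) (Finset.mem_univ j)
    have h0 : 0 ≤ ∑ j, inner ℝ (x j) (x j) := Finset.sum_nonneg fun i _ => real_inner_self_nonneg
    refine (Real.le_sqrt (norm_nonneg _) h0).1 ((pi_norm_le_iff_of_nonneg (Real.sqrt_nonneg _)).2
      fun j => Real.le_sqrt_of_sq_le (h j))

theorem exists_complex_orthogonal (hn : 2 ≤ n) (z : Pt n) :
    ∃ X, X ≠ 0 ∧ innerForm n z X = 0 ∧ innerForm n z (mulI n X) = 0 := by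
  set a : Fin n := ⟨0, by omega⟩
  set b : Fin n := ⟨1, by omega⟩
  have hab : a ≠ b := by simp [a, b]
  by_cases hz : z a = 0
  · refine ⟨Pi.single a 1, by simp, ?_, ?_⟩ <;>
    · rw [innerForm_apply]
      refine Finset.sum_eq_zero fun j _ => ?_
      by_cases hj : j = a
      · subst hj; rw [hz]; simp
      · simp [mulI_apply, hj]
  · have key : ∀ Y : Pt n, Y = Pi.single a (Y a) + Pi.single b (Y b) →
        innerForm n z Y = inner ℝ (z a) (Y a) + inner ℝ (z b) (Y b) := by
      intro Y hY
      rw [innerForm_apply, ← Finset.sum_subset (Finset.subset_univ {a, b}),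
        Finset.sum_pair hab]
      intro j _ hj
      simp only [Finset.mem_insert, Finset.mem_singleton, not_or] at hj
      rw [hY]
      simp [hj.1, hj.2]
    set X : Pt n := Pi.single a (-(starRingEnd ℂ) (z b)) + Pi.single b ((starRingEnd ℂ) (z a))
      with hX
    have hXa : X a = -(starRingEnd ℂ) (z b) := by simp [hX, hab]
    have hXb : X b = (starRingEnd ℂ) (z a) := by simp [hX, hab.symm]
    refine ⟨X, fun h => hz ?_, ?_, ?_⟩
    · have := congrFun h b
      rw [hXb] at this
      simpa using this
    · rw [key X (by rw [hXa, hXb]), hXa, hXb]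
      simp [Complex.inner]
      ring
    · rw [key (mulI n X) ?_, mulI_apply, mulI_apply, hXa, hXb]
      · simp [Complex.inner]
        ring
      · ext j
        rw [mulI_apply, mulI_apply, mulI_apply, hXa, hXb, hX]
        by_cases ha : j = a
        · subst ha; simp [hab]
        · by_cases hb : j = b
          · subst hb; simp [hab.symm]
          · simp [ha, hb]

theorem one_lt_rank_pt (hn : 2 ≤ n) : 1 < Module.rank ℝ (Pt n) := by
  rw [← Module.finrank_eq_rank, Module.finrank_pi_fintype]
  simp only [Complex.finrank_real_complex]
  simp
  exact_mod_cast (by omega : 1 < n * 2)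

end Euclidean

section Assembly

variable {n : ℕ} {Ω Ω₁ Ω₂ : Set (Pt n)}

theorem _root_.IsDefining.isBoundaryFunction {s : ℕ∞} {ρ : Pt n → ℝ} {V : Set (Pt n)}
    (h : IsDefining n s Ω ρ V) (hs : 1 ≤ s) (hΩ : IsOpen Ω) : IsBoundaryFunction Ω ρ := by
  obtain ⟨hV, hΩV, hρ, heq, h0⟩ := h
  have hnear : ∀ᶠ z in 𝓝ˢ (frontier Ω), z ∈ V :=
    hV.mem_nhdsSet.2 (frontier_subset_closure.trans hΩV)
  refine ⟨hΩ, ?_, h0, ?_⟩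
  · filter_upwards [hnear] with z hz
    exact (hρ.contDiffAt (hV.mem_nhds hz)).of_le (by exact_mod_cast hs)
  · filter_upwards [hnear] with z hz
    constructor
    · intro hzΩ
      rw [heq] at hzΩ
      exact hzΩ.2
    · intro hzρ
      rw [heq]
      exact ⟨hz, hzρ⟩

theorem three_le_coe {k : ℕ} (hk : 3 ≤ k) : (3 : WithTop ℕ∞) ≤ ((k : ℕ∞) : WithTop ℕ∞) := by
  have h : ((3 : ℕ∞) : WithTop ℕ∞) ≤ ((k : ℕ∞) : WithTop ℕ∞) :=
    WithTop.coe_le_coe.2 (by exact_mod_cast hk)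
  exact h

theorem contDiffAt_of_contDiffOn_apply {k : ℕ} (hk : 3 ≤ k) {f : Pt n → Pt n} {U : Set (Pt n)}
    (hU : IsOpen U) (hf : ∀ l, ContDiffOn ℝ (k : ℕ∞) (fun z => f z l) U) {p : Pt n}
    (hp : p ∈ U) : ContDiffAt ℝ 3 f p :=
  contDiffAt_pi.2 fun l => ((hf l).contDiffAt (hU.mem_nhds hp)).of_le (three_le_coe hk)

theorem _root_.IsDefining.contDiffAt_three {k : ℕ} (hk : 3 ≤ k) {ρ : Pt n → ℝ} {V : Set (Pt n)}
    (h : IsDefining n (k : ℕ∞) Ω ρ V) {p : Pt n} (hp : p ∈ frontier Ω) : ContDiffAt ℝ 3 ρ p :=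
  (h.2.2.1.contDiffAt (h.1.mem_nhds (h.2.1 (frontier_subset_closure hp)))).of_le
    (three_le_coe hk)

theorem _root_.IsCRDiffeo.isCREquiv {k : ℕ} (hk : 3 ≤ k) {ρ₁ ρ₂ : Pt n → ℝ}
    {V₁ V₂ U₁ U₂ : Set (Pt n)} {f g : Pt n → Pt n} (hΩ₁ : IsOpen Ω₁) (hΩ₂ : IsOpen Ω₂)
    (hρ₁ : IsDefining n (k : ℕ∞) Ω₁ ρ₁ V₁) (hρ₂ : IsDefining n (k : ℕ∞) Ω₂ ρ₂ V₂)
    (h : IsCRDiffeo n (k : ℕ∞) Ω₁ Ω₂ ρ₁ ρ₂ f g U₁ U₂) :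
    IsCREquiv (mulI n) (gradOp n) Ω₁ Ω₂ ρ₁ ρ₂ f g := by
  obtain ⟨hU₁, hU₂, hM₁, hM₂, hf, hg, him, hgf, hfg, hcr⟩ := h
  have h1 : (1 : ℕ∞) ≤ k := by exact_mod_cast (by omega : 1 ≤ k)
  have hsf : ∀ p ∈ frontier Ω₁, ContDiffAt ℝ 3 f p := fun p hp =>
    contDiffAt_of_contDiffOn_apply hk hU₁ hf (hM₁ hp)
  exact {
    left := hρ₁.isBoundaryFunction h1 hΩ₁
    right := hρ₂.isBoundaryFunction h1 hΩ₂
    smooth_left := fun p hp => hρ₁.contDiffAt_three hk hp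
    smooth_right := fun p hp => hρ₂.contDiffAt_three hk hp
    smooth_map := hsf
    smooth_inv := fun p hp => contDiffAt_of_contDiffOn_apply hk hU₂ hg (hM₂ hp)
    maps := fun p hp => him ▸ mem_image_of_mem f hp
    maps_inv := by
      rw [← him]
      rintro _ ⟨p, hp, rfl⟩
      rwa [hgf p hp]
    left_inv := hgf
    right_inv := hfg
    trans := isTransverse_gradOp n
    cr := fun p hp X hX hX' => fderiv_apply_of_push ((hsf p hp).differentiableAt (by norm_num))
      (hcr p hp X ((mem_T10_iff _ _ _).2 ⟨hX, hX'⟩)).1 }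

/-- `η` is an admissible exponent for some continuously differentiable defining function. -/
def IsSteinExponent (n : ℕ) (Ω : Set (Pt n)) (η : ℝ) : Prop :=
  ∃ ρ V, IsDefining n 1 Ω ρ V ∧ 1 < η ∧ ∃ U, IsOpen U ∧ frontier Ω ⊆ U ∧
    StrictPSHOn n (fun z => ρ z ^ η) ((closure Ω)ᶜ ∩ U)

theorem IsSteinExponent.exists_boundaryFunction {η : ℝ} (h : IsSteinExponent n Ω η)
    (hΩ : IsOpen Ω) : ∃ u, IsBoundaryFunction Ω u ∧
      ∀ᶠ z in 𝓝ˢ (frontier Ω), z ∈ (closure Ω)ᶜ → IsStrictPSHPow (mulI n) η u z := by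
  obtain ⟨ρ, V, hρ, -, U, hU, hMU, hpsh⟩ := h
  have hb := hρ.isBoundaryFunction le_rfl hΩ
  refine ⟨ρ, hb, ?_⟩
  filter_upwards [hb.smooth, hb.eventually_pos_iff, hU.mem_nhdsSet.2 hMU] with z h1 h2 h3 hz
  have hpos := h2.2 hz
  have hL := hpsh z ⟨hz, h3⟩
  have hd := differentiableAt_fderiv_of_levi_ne hL
  refine ⟨hpos, ⟨?_, hd⟩, fun X hX => ?_⟩
  · filter_upwards [h1.eventually (by simp), h1.continuousAt.eventually (lt_mem_nhds hpos)]
      with w hw hw'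
    exact (hw.differentiableAt one_ne_zero).rpow_const (Or.inl hw'.ne')
  · have := hL X hX
    rw [levi_re_eq hd] at this
    linarith

theorem IsBoundaryFunction.isSteinExponent {η : ℝ} {w : Pt n → ℝ} (h : IsBoundaryFunction Ω w)
    (hη : 1 < η) (hpsh : ∀ᶠ z in 𝓝ˢ (frontier Ω), z ∈ (closure Ω)ᶜ →
      IsStrictPSHPow (mulI n) η w z) : IsSteinExponent n Ω η := by
  obtain ⟨N, hN, hMN, hgood⟩ := eventually_nhdsSet_iff_exists.1
    (h.smooth.and (h.mem_iff.and hpsh))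
  obtain ⟨v, hv, hMv, hvN⟩ := normal_exists_closure_subset isClosed_frontier hN hMN
  obtain ⟨χ, hχ1, hχ0, hχ⟩ := exists_contMDiffMap_one_nhds_of_subset_interior (n := 1)
    (modelWithCornersSelf ℝ (Pt n)) (s := frontier Ω) (t := closure v) isClosed_frontier
    (hMv.trans (interior_maximal subset_closure hv))
  have hχd : ContDiff ℝ 1 χ := contMDiff_iff_contDiff.1 χ.contMDiff
  obtain ⟨O, hO, hMO, hOχ⟩ := eventually_nhdsSet_iff_exists.1 (hχ1.and (hN.mem_nhdsSet.2 hMN))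
  set ρ : Pt n → ℝ := fun z => χ z * w z - (1 - χ z) with hρ
  have hρO : ∀ z ∈ O, ρ =ᶠ[𝓝 z] w := fun z hz => by
    filter_upwards [hO.mem_nhds hz] with x hx
    simp [hρ, (hOχ x hx).1]
  have hρ_smooth : ContDiff ℝ 1 ρ := by
    rw [contDiff_iff_contDiffAt]
    intro z
    by_cases hz : z ∈ N
    · exact (hχd.contDiffAt.mul (hgood z hz).1).sub (contDiffAt_const.sub hχd.contDiffAt)
    · have hz' : z ∈ (closure v)ᶜ := fun hzv => hz (hvN hzv)
      have he : ρ =ᶠ[𝓝 z] fun _ => (-1 : ℝ) := by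
        filter_upwards [isClosed_closure.isOpen_compl.mem_nhds hz'] with x hx
        simp [hρ, hχ0 x hx]
      exact contDiffAt_const.congr_of_eventuallyEq he
  have hneg : ∀ z ∈ Ω, ρ z < 0 := fun z hz => by
    obtain ⟨h0, h1⟩ := hχ z
    by_cases hzN : z ∈ N
    · have hw := (hgood z hzN).2.1.1 hz
      rcases h0.eq_or_lt with h0 | h0
      · simp [hρ, ← h0]
      · have := mul_neg_of_pos_of_neg h0 hw
        simp only [hρ]
        linarith
    · have := hχ0 z fun hzv => hzN (hvN hzv)
      simp [hρ, this]
  refine ⟨ρ, Ω ∪ O, ⟨h.isOpen.union hO, ?_, hρ_smooth.contDiffOn, ?_, fun z hz => ?_⟩, hη, O, hO,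
    hMO, ?_⟩
  · rw [closure_eq_self_union_frontier]
    exact union_subset_union_right _ hMO
  · ext z
    refine ⟨fun hz => ⟨Or.inl hz, hneg z hz⟩, ?_⟩
    rintro ⟨hz | hz, hz'⟩
    · exact hz
    · rw [(hρO z hz).self_of_nhds] at hz'
      exact (hgood z (hOχ z hz).2).2.1.2 hz'
  · rw [(hρO z (hMO hz)).fderiv_eq]
    exact h.ne_zero z hz
  · rintro z ⟨hz, hzO⟩ X hX
    obtain ⟨-, h2, h3⟩ := (hgood z (hOχ z hzO).2).2.2 hz
    have he : (fun x => ρ x ^ η) =ᶠ[𝓝 z] fun x => w x ^ η := (hρO z hzO).fun_comp (· ^ η)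
    rw [levi_re_eq (h2.congr he).2, lap_congr _ he]
    have := h3 X hX
    linarith

theorem sindex_le_of_isSteinExponent {η : ℝ} (h : IsSteinExponent n Ω η) :
    Sindex n Ω ≤ η := by
  obtain ⟨ρ, V, hρ, hη, hU⟩ := h
  have h1 : Sindex n Ω ≤ Sexp n ρ Ω := sInf_le ⟨ρ, V, hρ, rfl⟩
  exact h1.trans (sInf_le ⟨η, hη, hU, rfl⟩)

theorem sindex_le_sindex (h : ∀ η η', IsSteinExponent n Ω₂ η → η < η' →
    IsSteinExponent n Ω₁ η') : Sindex n Ω₁ ≤ Sindex n Ω₂ := by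
  refine le_sInf ?_
  rintro _ ⟨ρ, V, hρ, rfl⟩
  refine le_sInf ?_
  rintro _ ⟨η, hη, hU, rfl⟩
  refine le_of_forall_gt_imp_ge_of_dense fun a ha => ?_
  obtain ⟨η', h1, h2⟩ := EReal.lt_iff_exists_real_btwn.1 ha
  exact (sindex_le_of_isSteinExponent (h η η' ⟨ρ, V, hρ, hη, hU⟩
    (EReal.coe_lt_coe_iff.1 h1))).trans h2.le

theorem IsCREquiv.sindex_le (hn : 2 ≤ n) {r₁ r₂ : Pt n → ℝ} {f g : Pt n → Pt n}
    (h : IsCREquiv (mulI n) (gradOp n) Ω₁ Ω₂ r₁ r₂ f g) (hΩ₁ : Ω₁.Nonempty)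
    (hb₁ : Bornology.IsBounded Ω₁) (hΩ₂ : IsPreconnected Ω₂) (hb₂ : Bornology.IsBounded Ω₂) :
    Sindex n Ω₁ ≤ Sindex n Ω₂ := by
  refine sindex_le_sindex fun η η' hη hlt => ?_
  have h1 : 1 < η := hη.choose_spec.choose_spec.2.1
  obtain ⟨u, hu, hpsh⟩ := hη.exists_boundaryFunction h.right.isOpen
  obtain ⟨w, hw, hw'⟩ := h.exists_transfer (isHermitianForm_innerForm n)
    (exists_complex_orthogonal hn) (one_lt_rank_pt hn) hΩ₁ hb₁ hΩ₂ hb₂ hu (by linarith) hlt hpsh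
  exact hw.isSteinExponent (h1.trans hlt) hw'

end Assembly

end SteinnessIndex

/-- Theorem 1.2, Steinness part: the Steinness index is invariant
under CR-diffeomorphisms of the boundaries. -/
theorem Sindex_CR_invariant
    (n k : ℕ) (hn : 2 ≤ n) (hk : 3 ≤ k)
    (Ω₁ Ω₂ : Set (Pt n))
    (h1o : IsOpen Ω₁) (h1c : IsConnected Ω₁) (h1b : Bornology.IsBounded Ω₁)
    (h2o : IsOpen Ω₂) (h2c : IsConnected Ω₂) (h2b : Bornology.IsBounded Ω₂)
    (ρ₁ : Pt n → ℝ) (V₁ : Set (Pt n)) (hρ₁ : IsDefining n (k : ℕ∞) Ω₁ ρ₁ V₁)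
    (ρ₂ : Pt n → ℝ) (V₂ : Set (Pt n)) (hρ₂ : IsDefining n (k : ℕ∞) Ω₂ ρ₂ V₂)
    (f g : Pt n → Pt n) (U₁ U₂ : Set (Pt n))
    (hcr : IsCRDiffeo n (k : ℕ∞) Ω₁ Ω₂ ρ₁ ρ₂ f g U₁ U₂) :
    Sindex n Ω₁ = Sindex n Ω₂ := by
  have h := hcr.isCREquiv hk h1o h2o hρ₁ hρ₂
  exact le_antisymm
    (h.sindex_le hn h1c.nonempty h1b h2c.isPreconnected h2b)
    (h.symm.sindex_le hn h2c.nonempty h2b h1c.isPreconnected h1b)
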